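/- Let X be the simple random walk on Z^4 started at the origin. There exist constants C > 0 and C' such that P( Cap(LE(X)^n) ≤ C·n/(log n)^{2/3} ) ≤ C' · (log log n)/(log n)^{2/3} for every n ≥ 2, where LE(X)^n denotes the first n steps of the loop-erasure of X. -/

import Mathlib

open MeasureTheory Filter Set
open scoped ENNReal Classical Topology

noncomputable section

abbrev V4 : Type := Fin 4 → ℤ

/-- Nearest-neighbour adjacency in `ℤ⁴`. -/
def latAdj (x y : V4) : Prop := ∑ i, |x i - y i| = 1

/-- `μ` is the family of laws of the simple random walk on `ℤ⁴`: `μ x` is the law on path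
space `ℕ → ℤ⁴` of the walk started at `x`, characterised by its cylinder probabilities. -/
def IsSRW4 (μ : V4 → Measure (ℕ → V4)) : Prop :=
  (∀ x, IsProbabilityMeasure (μ x)) ∧
  ∀ (x : V4) (n : ℕ) (γ : ℕ → V4),
    μ x {ω | ∀ k ≤ n, ω k = γ k} =
      (if γ 0 = x then 1 else 0) *
        ∏ k ∈ Finset.range n, (if latAdj (γ k) (γ (k + 1)) then (8 : ℝ≥0∞)⁻¹ else 0)

/-- The lattice neighbours of `y` in `ℤ⁴`. -/
def latNbrs (y : V4) : Finset V4 :=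
  Finset.univ.image fun p : Fin 4 × Bool =>
    Function.update y p.1 (y p.1 + if p.2 then 1 else -1)

/-- The number of `n`-step nearest-neighbour paths started at `a` whose positions at
times `1,…,n` all avoid `A`. -/
def avoidCount (A : Set V4) : ℕ → V4 → ℕ
  | 0, _ => 1
  | n + 1, a => ∑ b ∈ (latNbrs a).filter (fun b => b ∉ A), avoidCount A n b

/-- The probability that the simple random walk on `ℤ⁴` started at `a` never returns
to `A` after time zero. -/
def escProb (A : Set V4) (a : V4) : ℝ := ⨅ n : ℕ, (avoidCount A n a : ℝ) / 8 ^ n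

/-- The capacity of `A ⊆ ℤ⁴`: `Cap(A) = Σ_{a∈A} deg(a) P_a(no return to A)`. -/
def cap4 (A : Set V4) : ℝ := ∑' a : A, 8 * escProb A a

/-- The times `ℓ_i` of the loop-erasure of the (transient) path `w`:
`ℓ_0 = 0` and `ℓ_{i+1} = 1 + max{k : w_k = w_{ℓ_i}}`. -/
def ell (w : ℕ → V4) : ℕ → ℕ
  | 0 => 0
  | i + 1 => sSup {k | w k = w (ell w i)} + 1

/-- The vertex set of the first `n` steps of the loop-erasure of `w`:
`{LE(w)_i : 0 ≤ i ≤ n}` where `LE(w)_i = w_{ℓ_i}`. -/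
def leSet (w : ℕ → V4) (n : ℕ) : Set V4 := {z | ∃ i ≤ n, z = w (ell w i)}

/-! ### Averages over nearest-neighbour step lists -/

/-- The eight unit steps of `ℤ⁴`. -/
def dirs : Finset V4 := latNbrs 0

/-- The expectation of a functional of the first `n` steps of the simple random walk. -/
def Es : ℕ → (List V4 → ℝ) → ℝ
  | 0, F => F []
  | n + 1, F => (∑ d ∈ dirs, Es n fun s => F (d :: s)) / 8

/-- `IsSteps n s` says that `s` is a list of `n` unit steps. -/
def IsSteps (n : ℕ) (s : List V4) : Prop := s.length = n ∧ ∀ d ∈ s, d ∈ dirs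

/-- Real-valued indicator of a proposition. -/
def ind (p : Prop) : ℝ := if p then 1 else 0

/-- The position after `i` steps of the walk from the origin with step list `s`. -/
def walk (s : List V4) (i : ℕ) : V4 := (s.take i).sum

lemma ind_true {p : Prop} (h : p) : ind p = 1 := if_pos h
lemma ind_false {p : Prop} (h : ¬p) : ind p = 0 := if_neg h
lemma ind_nonneg (p : Prop) : 0 ≤ ind p := by unfold ind; split_ifs <;> norm_num
lemma ind_le_one (p : Prop) : ind p ≤ 1 := by unfold ind; split_ifs <;> norm_num
lemma ind_mono {p q : Prop} (h : p → q) : ind p ≤ ind q := by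
  by_cases hp : p
  · rw [ind_true hp, ind_true (h hp)]
  · rw [ind_false hp]; exact ind_nonneg q
lemma ind_congr {p q : Prop} (h : p ↔ q) : ind p = ind q := by rw [propext h]
lemma ind_not (p : Prop) : ind (¬p) = 1 - ind p := by
  by_cases hp : p
  · rw [ind_true hp, ind_false (not_not.2 hp)]; norm_num
  · rw [ind_false hp, ind_true hp]; norm_num
lemma ind_and (p q : Prop) : ind (p ∧ q) = ind p * ind q := by
  by_cases hp : p <;> by_cases hq : q <;> simp [ind, hp, hq]
lemma ind_or_le (p q : Prop) : ind (p ∨ q) ≤ ind p + ind q := by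
  by_cases hp : p <;> by_cases hq : q <;> simp [ind, hp, hq]

lemma sum_ind {ι : Type*} (t : Finset ι) (p : ι → Prop) :
    ∑ i ∈ t, ind (p i) = ((t.filter p).card : ℝ) := by
  simp [ind, Finset.sum_boole]

lemma card_dirs : dirs.card = 8 := by decide +kernel

lemma neg_mem_dirs {d : V4} : -d ∈ dirs ↔ d ∈ dirs := by
  have key : ∀ d ∈ dirs, -d ∈ dirs := by decide +kernel
  exact ⟨fun h => by simpa using key _ h, key d⟩

lemma sum_dirs_neg (f : V4 → ℝ) : ∑ d ∈ dirs, f (-d) = ∑ d ∈ dirs, f d :=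
  Finset.sum_nbij' (fun d => -d) (fun d => -d) (fun _ h => neg_mem_dirs.2 h)
    (fun _ h => neg_mem_dirs.2 h) (by simp) (by simp) (by simp)

lemma dirs_eq : dirs = Finset.univ.image fun p : Fin 4 × Bool =>
    (Pi.single p.1 (if p.2 then 1 else -1) : V4) := by decide +kernel

lemma sum_dirs (f : V4 → ℝ) :
    ∑ d ∈ dirs, f d = ∑ j : Fin 4, (f (Pi.single j 1) + f (Pi.single j (-1))) := by
  have hinj : Function.Injective fun p : Fin 4 × Bool =>
      (Pi.single p.1 (if p.2 then 1 else -1) : V4) := by decide +kernel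
  rw [dirs_eq, Finset.sum_image hinj.injOn, Fintype.sum_prod_type]
  simp

lemma latNbrs_eq (y : V4) : latNbrs y = dirs.image (y + ·) := by
  unfold dirs latNbrs
  rw [Finset.image_image]
  refine Finset.image_congr fun p _ => ?_
  funext i
  by_cases h : i = p.1
  · subst h; simp
  · simp [Function.update_of_ne h]

lemma sum_latNbrs (y : V4) (f : V4 → ℝ) : ∑ b ∈ latNbrs y, f b = ∑ d ∈ dirs, f (y + d) := by
  rw [latNbrs_eq, Finset.sum_image (fun _ _ _ _ h => add_left_cancel h)]

lemma isSteps_nil : IsSteps 0 [] := ⟨rfl, by simp⟩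

lemma IsSteps.cons {n : ℕ} {s : List V4} {d : V4} (hs : IsSteps n s) (hd : d ∈ dirs) :
    IsSteps (n + 1) (d :: s) := by
  refine ⟨by simp [hs.1], fun e he => ?_⟩
  rcases List.mem_cons.1 he with rfl | he
  exacts [hd, hs.2 _ he]

lemma IsSteps.append {a b : ℕ} {s t : List V4} (hs : IsSteps a s) (ht : IsSteps b t) :
    IsSteps (a + b) (s ++ t) := by
  refine ⟨by simp [hs.1, ht.1], fun e he => ?_⟩
  rcases List.mem_append.1 he with he | he
  exacts [hs.2 _ he, ht.2 _ he]

lemma Es_zero (F : List V4 → ℝ) : Es 0 F = F [] := rfl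

lemma Es_succ (n : ℕ) (F : List V4 → ℝ) :
    Es (n + 1) F = (∑ d ∈ dirs, Es n fun s => F (d :: s)) / 8 := rfl

lemma Es_mono {n : ℕ} {F G : List V4 → ℝ} (h : ∀ s, IsSteps n s → F s ≤ G s) :
    Es n F ≤ Es n G := by
  induction n generalizing F G with
  | zero => exact h [] isSteps_nil
  | succ n ih =>
    rw [Es_succ, Es_succ]
    gcongr with d hd
    exact ih fun s hs => h _ (hs.cons hd)

lemma Es_congr {n : ℕ} {F G : List V4 → ℝ} (h : ∀ s, IsSteps n s → F s = G s) :
    Es n F = Es n G :=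
  le_antisymm (Es_mono fun s hs => (h s hs).le) (Es_mono fun s hs => (h s hs).ge)

lemma Es_const (n : ℕ) (c : ℝ) : Es n (fun _ => c) = c := by
  induction n with
  | zero => rfl
  | succ n ih => rw [Es_succ]; simp [ih, card_dirs]

lemma Es_add (n : ℕ) (F G : List V4 → ℝ) :
    Es n (fun s => F s + G s) = Es n F + Es n G := by
  induction n generalizing F G with
  | zero => rfl
  | succ n ih => simp only [Es_succ, ih, Finset.sum_add_distrib, add_div]

lemma Es_mul_left (n : ℕ) (c : ℝ) (F : List V4 → ℝ) :
    Es n (fun s => c * F s) = c * Es n F := by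
  induction n generalizing F with
  | zero => rfl
  | succ n ih => simp only [Es_succ, ih, ← Finset.mul_sum, mul_div_assoc]

lemma Es_mul_right (n : ℕ) (c : ℝ) (F : List V4 → ℝ) :
    Es n (fun s => F s * c) = Es n F * c := by
  simp only [mul_comm _ c, Es_mul_left]

lemma Es_div (n : ℕ) (c : ℝ) (F : List V4 → ℝ) :
    Es n (fun s => F s / c) = Es n F / c := by
  simp only [div_eq_mul_inv, Es_mul_right]

lemma Es_neg (n : ℕ) (F : List V4 → ℝ) : Es n (fun s => -F s) = -Es n F := by
  simpa using Es_mul_left n (-1) F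

lemma Es_sub (n : ℕ) (F G : List V4 → ℝ) :
    Es n (fun s => F s - G s) = Es n F - Es n G := by
  simp only [sub_eq_add_neg, Es_add, Es_neg]

lemma Es_sum {ι : Type*} (n : ℕ) (t : Finset ι) (F : ι → List V4 → ℝ) :
    Es n (fun s => ∑ i ∈ t, F i s) = ∑ i ∈ t, Es n (F i) := by
  induction n generalizing F with
  | zero => rfl
  | succ n ih => simp only [Es_succ, ih]; rw [Finset.sum_comm, Finset.sum_div]

lemma Es_nonneg {n : ℕ} {F : List V4 → ℝ} (h : ∀ s, IsSteps n s → 0 ≤ F s) : 0 ≤ Es n F :=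
  (Es_const n 0).symm.le.trans (Es_mono h)

lemma Es_le_const {n : ℕ} {F : List V4 → ℝ} {c : ℝ} (h : ∀ s, IsSteps n s → F s ≤ c) :
    Es n F ≤ c :=
  (Es_mono h).trans_eq (Es_const n c)

lemma const_le_Es {n : ℕ} {F : List V4 → ℝ} {c : ℝ} (h : ∀ s, IsSteps n s → c ≤ F s) :
    c ≤ Es n F :=
  (Es_const n c).symm.trans_le (Es_mono h)

lemma Es_append (a b : ℕ) (F : List V4 → ℝ) :
    Es (a + b) F = Es a fun p => Es b fun q => F (p ++ q) := by
  induction a generalizing F with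
  | zero => simp [Es_zero]
  | succ a ih => rw [Nat.succ_add, Es_succ, Es_succ]; simp only [ih, List.cons_append]

lemma Es_comm (a b : ℕ) (F : List V4 → List V4 → ℝ) :
    (Es a fun p => Es b fun q => F p q) = Es b fun q => Es a fun p => F p q := by
  induction a generalizing F with
  | zero => rfl
  | succ a ih => simp only [Es_succ, ih, ← Es_sum, Es_div]

lemma Es_one (F : List V4 → ℝ) : Es 1 F = (∑ d ∈ dirs, F [d]) / 8 := rfl

lemma Es_reverse (n : ℕ) (F : List V4 → ℝ) : Es n (fun s => F s.reverse) = Es n F := by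
  induction n generalizing F with
  | zero => rfl
  | succ n ih =>
    rw [Es_append n 1 F, Es_succ]
    simp only [List.reverse_cons, Es_one, Es_div, Es_sum]
    congr 1
    exact Finset.sum_congr rfl fun d _ => ih fun s => F (s ++ [d])

lemma Es_map_neg (n : ℕ) (F : List V4 → ℝ) :
    Es n (fun s => F (s.map fun d => -d)) = Es n F := by
  induction n generalizing F with
  | zero => rfl
  | succ n ih =>
    simp only [Es_succ, List.map_cons]
    rw [← sum_dirs_neg]
    congr 1
    exact Finset.sum_congr rfl fun d _ => by rw [neg_neg]; exact ih fun s => F (d :: s)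

lemma Es_take {n k : ℕ} (hk : k ≤ n) (F : List V4 → ℝ) :
    Es n (fun s => F (s.take k)) = Es k F := by
  obtain ⟨m, rfl⟩ := Nat.exists_eq_add_of_le hk
  rw [Es_append]
  refine Es_congr fun p hp => ?_
  simp [hp.1, Es_const]

lemma Es_drop {n k : ℕ} (hk : k ≤ n) (F : List V4 → ℝ) :
    Es n (fun s => F (s.drop k)) = Es (n - k) F := by
  obtain ⟨m, rfl⟩ := Nat.exists_eq_add_of_le hk
  rw [Es_append, Nat.add_sub_cancel_left, ← Es_const k (Es m F)]
  refine Es_congr fun p hp => ?_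
  simp [← hp.1]

/-- Markov's inequality for the averages `Es`. -/
lemma Es_markov {n : ℕ} {F : List V4 → ℝ} {c : ℝ} (hc : 0 < c)
    (h : ∀ s, IsSteps n s → 0 ≤ F s) : Es n (fun s => ind (c ≤ F s)) ≤ Es n F / c := by
  rw [← Es_div]
  refine Es_mono fun s hs => ?_
  by_cases hp : c ≤ F s
  · rw [ind_true hp, le_div_iff₀ hc]; linarith
  · rw [ind_false hp]; exact div_nonneg (h s hs) hc.le

/-! ### Positions of the walk -/

lemma walk_zero (s : List V4) : walk s 0 = 0 := by simp [walk]

lemma walk_append_left {p : List V4} (q : List V4) {i : ℕ} (hi : i ≤ p.length) :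
    walk (p ++ q) i = walk p i := by
  simp [walk, List.take_append_of_le_length hi]

lemma walk_append_right (p q : List V4) (i : ℕ) :
    walk (p ++ q) (p.length + i) = p.sum + walk q i := by
  rw [walk, walk, ← List.sum_append]
  congr 1
  rw [List.take_append, List.take_of_length_le (by omega), Nat.add_sub_cancel_left]

lemma walk_length (s : List V4) : walk s s.length = s.sum := by simp [walk]

lemma walk_of_length_le {s : List V4} {i : ℕ} (h : s.length ≤ i) : walk s i = s.sum := by
  simp [walk, List.take_of_length_le h]

lemma walk_cons_succ (d : V4) (s : List V4) (i : ℕ) : walk (d :: s) (i + 1) = d + walk s i := by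
  simp [walk]

lemma walk_take {s : List V4} {k i : ℕ} (h : i ≤ k) : walk (s.take k) i = walk s i := by
  simp [walk, List.take_take, min_eq_left h]

lemma walk_add (s : List V4) (k i : ℕ) : walk s (k + i) = walk s k + walk (s.drop k) i := by
  unfold walk
  rw [List.take_add, List.sum_append]

lemma sum_take_append (s : List V4) (k : ℕ) : s.sum = walk s k + (s.drop k).sum := by
  unfold walk
  rw [← List.sum_append, List.take_append_drop]

lemma walk_reverse {n : ℕ} {s : List V4} (hs : s.length = n) (i : ℕ) :
    walk s.reverse i = s.sum - walk s (n - i) := by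
  have h : s.reverse.take i = (s.drop (n - i)).reverse := by
    rw [List.take_reverse, hs]
  rw [sum_take_append s (n - i), walk, h, List.sum_reverse]
  abel

lemma walk_map_neg (s : List V4) (i : ℕ) : walk (s.map fun d => -d) i = -walk s i := by
  unfold walk
  rw [← List.map_take, List.sum_neg]

/-- The function `f` averaged over the position at time `n` of the walk started at `x`. -/
def Pn (n : ℕ) (f : V4 → ℝ) (x : V4) : ℝ := Es n fun s => f (x + s.sum)

lemma Pn_zero (f : V4 → ℝ) (x : V4) : Pn 0 f x = f x := by simp [Pn, Es_zero]

lemma Pn_one (f : V4 → ℝ) (x : V4) : Pn 1 f x = (∑ d ∈ dirs, f (x + d)) / 8 := by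
  simp [Pn, Es_one]

lemma Pn_add (a b : ℕ) (f : V4 → ℝ) (x : V4) : Pn (a + b) f x = Pn a (Pn b f) x := by
  simp only [Pn, Es_append, List.sum_append, add_assoc]

lemma Pn_succ (n : ℕ) (f : V4 → ℝ) (x : V4) :
    Pn (n + 1) f x = (∑ d ∈ dirs, Pn n f (x + d)) / 8 := by
  rw [add_comm, Pn_add, Pn_one]

lemma Pn_succ' (n : ℕ) (f : V4 → ℝ) (x : V4) :
    Pn (n + 1) f x = Pn n (Pn 1 f) x := Pn_add n 1 f x

lemma Pn_mono {n : ℕ} {f g : V4 → ℝ} (h : ∀ y, f y ≤ g y) (x : V4) : Pn n f x ≤ Pn n g x :=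
  Es_mono fun _ _ => h _

lemma Pn_nonneg {n : ℕ} {f : V4 → ℝ} (h : ∀ y, 0 ≤ f y) (x : V4) : 0 ≤ Pn n f x :=
  Es_nonneg fun _ _ => h _

lemma Pn_const (n : ℕ) (c : ℝ) (x : V4) : Pn n (fun _ => c) x = c := Es_const n c

lemma Pn_add_fun (n : ℕ) (f g : V4 → ℝ) (x : V4) :
    Pn n (fun y => f y + g y) x = Pn n f x + Pn n g x := Es_add n _ _

lemma Pn_sub_fun (n : ℕ) (f g : V4 → ℝ) (x : V4) :
    Pn n (fun y => f y - g y) x = Pn n f x - Pn n g x := Es_sub n _ _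

lemma Pn_mul_left (n : ℕ) (c : ℝ) (f : V4 → ℝ) (x : V4) :
    Pn n (fun y => c * f y) x = c * Pn n f x := Es_mul_left n c _

lemma Pn_sum {ι : Type*} (n : ℕ) (t : Finset ι) (f : ι → V4 → ℝ) (x : V4) :
    Pn n (fun y => ∑ i ∈ t, f i y) x = ∑ i ∈ t, Pn n (f i) x := Es_sum n t _

lemma Pn_translate (n : ℕ) (f : V4 → ℝ) (x z : V4) :
    Pn n (fun y => f (y + z)) x = Pn n f (x + z) := by
  simp only [Pn]
  congr 1; funext s; congr 1; abel

lemma Pn_neg (n : ℕ) (f : V4 → ℝ) (x : V4) :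
    Pn n (fun y => f (-y)) x = Pn n f (-x) := by
  simp only [Pn]
  rw [← Es_map_neg]
  congr 1; funext s; congr 1
  rw [← List.sum_neg]; abel

/-- The `n`-step transition probability of the simple random walk. -/
def pk (n : ℕ) (a b : V4) : ℝ := Pn n (fun y => ind (y = b)) a

lemma pk_nonneg (n : ℕ) (a b : V4) : 0 ≤ pk n a b := Pn_nonneg (fun _ => ind_nonneg _) a

lemma pk_translate (n : ℕ) (a b z : V4) : pk n (a + z) (b + z) = pk n a b := by
  unfold pk
  rw [← Pn_translate]
  simp

lemma pk_symm (n : ℕ) (a b : V4) : pk n a b = pk n b a := by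
  have h1 : pk n a b = pk n (-a) (-b) := by
    unfold pk; rw [← Pn_neg]; simp
  have h2 := pk_translate n (-a) (-b) (a + b)
  rw [h1, ← h2]; congr 1 <;> abel

lemma sum_pk_mul (n : ℕ) (Λ : Finset V4) (f : V4 → ℝ) (x : V4) :
    ∑ b ∈ Λ, pk n x b * f b = Pn n (fun y => if y ∈ Λ then f y else 0) x := by
  have : ∀ b, pk n x b * f b = Pn n (fun y => ind (y = b) * f b) x := fun b => by
    unfold pk Pn; rw [Es_mul_right]
  simp only [this]
  rw [← Pn_sum]
  congr 1; funext y
  simp [ind]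

/-- The Green function truncated at time `M`. -/
def gk (M : ℕ) (a b : V4) : ℝ := ∑ i ∈ Finset.range M, pk i a b

lemma gk_nonneg (M : ℕ) (a b : V4) : 0 ≤ gk M a b :=
  Finset.sum_nonneg fun i _ => pk_nonneg i a b

lemma gk_symm (M : ℕ) (a b : V4) : gk M a b = gk M b a :=
  Finset.sum_congr rfl fun i _ => pk_symm i a b

lemma gk_mono {M N : ℕ} (h : M ≤ N) (a b : V4) : gk M a b ≤ gk N a b :=
  Finset.sum_le_sum_of_subset_of_nonneg (Finset.range_mono h) fun i _ _ => pk_nonneg i a b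

/-! ### The heat kernel bound -/

/-- The transition probabilities of the one-dimensional simple random walk. -/
def qk : ℕ → ℤ → ℝ
  | 0, z => ind (z = 0)
  | k + 1, z => (qk k (z + 1) + qk k (z - 1)) / 2

lemma qk_eq (k : ℕ) (z : ℤ) : (∀ j : ℕ, z = 2 * j - k → qk k z = k.choose j / 2 ^ k) ∧
    ((∀ j : ℕ, z ≠ 2 * j - k) → qk k z = 0) := by
  induction k generalizing z with
  | zero =>
    refine ⟨fun j hj => ?_, fun h => ?_⟩
    · rcases j with _ | j
      · simp at hj; simp [qk, ind, hj]
      · have : z ≠ 0 := by push_cast at hj; omega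
        simp [qk, ind, this]
    · have : z ≠ 0 := by simpa using h 0
      simp [qk, ind, this]
  | succ k ih =>
    refine ⟨fun j hj => ?_, fun h => ?_⟩
    · push_cast at hj
      rw [qk, (ih (z + 1)).1 j (by omega)]
      rcases j with _ | j
      · rw [(ih (z - 1)).2 (fun j => by push_cast at hj; omega)]
        simp; ring
      · rw [(ih (z - 1)).1 j (by push_cast at hj; omega), Nat.choose_succ_succ]
        push_cast; ring
    · rw [qk, (ih (z + 1)).2 (fun j => ?_), (ih (z - 1)).2 (fun j => ?_)]
      · simp
      · have := h (j + 1); push_cast at this; omega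
      · have := h j; push_cast at this; omega

lemma centralBinom_sq_le (m : ℕ) : (m.centralBinom : ℝ) ^ 2 * (2 * m + 1) ≤ 16 ^ m := by
  induction m with
  | zero => simp
  | succ m ih =>
    have h : ((m : ℝ) + 1) * (m + 1).centralBinom = 2 * (2 * m + 1) * m.centralBinom := by
      exact_mod_cast Nat.succ_mul_centralBinom_succ m
    have hm : (0 : ℝ) < (m + 1) ^ 2 := by positivity
    have h2 : ((m : ℝ) + 1) ^ 2 * ((m + 1).centralBinom : ℝ) ^ 2
        = 4 * (2 * m + 1) * ((m.centralBinom : ℝ) ^ 2 * (2 * m + 1)) := by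
      rw [← mul_pow, h]; ring
    refine le_of_mul_le_mul_left ?_ hm
    push_cast
    calc ((m : ℝ) + 1) ^ 2 * (((m + 1).centralBinom : ℝ) ^ 2 * (2 * (m + 1) + 1))
        = (((m : ℝ) + 1) ^ 2 * ((m + 1).centralBinom : ℝ) ^ 2) * (2 * m + 3) := by ring
      _ = 4 * (2 * m + 1) * (2 * m + 3) * ((m.centralBinom : ℝ) ^ 2 * (2 * m + 1)) := by
        rw [h2]; ring
      _ ≤ 4 * (2 * m + 1) * (2 * m + 3) * 16 ^ m := by gcongr
      _ ≤ 16 * (m + 1) ^ 2 * 16 ^ m :=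
        mul_le_mul_of_nonneg_right (by nlinarith) (by positivity)
      _ = _ := by ring

lemma qk_even_sq_le (m : ℕ) (z : ℤ) : qk (2 * m) z ^ 2 * (2 * m + 1) ≤ 1 := by
  by_cases h : ∃ j : ℕ, z = 2 * j - (2 * m : ℕ)
  · obtain ⟨j, hj⟩ := h
    rw [(qk_eq _ z).1 j hj]
    have hc : ((2 * m).choose j : ℝ) ≤ m.centralBinom := by
      exact_mod_cast Nat.choose_le_centralBinom j m
    have h16 : ((2 : ℝ) ^ (2 * m)) ^ 2 = 16 ^ m := by
      rw [← pow_mul, show 2 * m * 2 = 4 * m by ring, pow_mul]; norm_num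
    rw [div_pow, h16, div_mul_eq_mul_div, div_le_one (by positivity)]
    exact le_trans (by gcongr) (centralBinom_sq_le m)
  · rw [(qk_eq _ z).2 (by push Not at h; exact h)]; simp

lemma qk_sq_le (k : ℕ) (z : ℤ) : qk k z ^ 2 ≤ 2 / (k + 1) := by
  rw [le_div_iff₀ (by positivity)]
  obtain ⟨m, rfl | rfl⟩ := Nat.even_or_odd' k
  · push_cast; linarith [qk_even_sq_le m z]
  · rw [qk]
    have h1 := qk_even_sq_le m (z + 1)
    have h2 := qk_even_sq_le m (z - 1)
    push_cast
    have : ((qk (2 * m) (z + 1) + qk (2 * m) (z - 1)) / 2) ^ 2 ≤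
        (qk (2 * m) (z + 1) ^ 2 + qk (2 * m) (z - 1) ^ 2) / 2 := by
      nlinarith [sq_nonneg (qk (2 * m) (z + 1) - qk (2 * m) (z - 1))]
    calc _ ≤ (qk (2 * m) (z + 1) ^ 2 + qk (2 * m) (z - 1) ^ 2) / 2 * (2 * m + 1 + 1) := by
          gcongr
      _ ≤ 2 := by nlinarith [sq_nonneg (qk (2 * m) (z + 1)), sq_nonneg (qk (2 * m) (z - 1)),
            Nat.cast_nonneg (α := ℝ) m]

/-- The product of one-dimensional kernels with `m j` steps in direction `j`. -/
def prodKernel (m : Fin 4 → ℕ) (y : V4) : ℝ := ∏ j, qk (m j) (y j)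

lemma prodKernel_zero (y : V4) : prodKernel 0 y = ind (y = 0) := by
  by_cases h : y = 0
  · subst h; simp [prodKernel, qk, ind]
  · obtain ⟨j, hj⟩ := Function.ne_iff.1 h
    rw [ind_false h, prodKernel]
    exact Finset.prod_eq_zero (Finset.mem_univ j) (by simp [qk, ind] at hj ⊢; exact hj)

lemma Pn_one_prodKernel (m : Fin 4 → ℕ) (y : V4) :
    Pn 1 (prodKernel m) y = (∑ j, prodKernel (Function.update m j (m j + 1)) y) / 4 := by
  rw [Pn_one, sum_dirs]
  have : ∀ j : Fin 4, prodKernel m (y + Pi.single j 1) + prodKernel m (y + Pi.single j (-1)) =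
      2 * prodKernel (Function.update m j (m j + 1)) y := fun j => by
    have key : ∀ e : ℤ, prodKernel m (y + Pi.single j e) =
        qk (m j) (y j + e) * ∏ i ∈ Finset.univ.erase j, qk (m i) (y i) := fun e => by
      rw [prodKernel, ← Finset.mul_prod_erase _ _ (Finset.mem_univ j)]
      congr 1
      · simp
      · refine Finset.prod_congr rfl fun i hi => ?_
        simp [Finset.ne_of_mem_erase hi]
    rw [key, key, prodKernel, ← Finset.mul_prod_erase _ _ (Finset.mem_univ j)]
    have h3 : ∏ i ∈ Finset.univ.erase j, qk (Function.update m j (m j + 1) i) (y i)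
        = ∏ i ∈ Finset.univ.erase j, qk (m i) (y i) :=
      Finset.prod_congr rfl fun i hi => by simp [Finset.ne_of_mem_erase hi]
    rw [h3, Function.update_self, qk, ← sub_eq_add_neg]
    ring
  simp only [this, ← Finset.mul_sum]
  ring

lemma prodKernel_le (m : Fin 4 → ℕ) (y : V4) :
    prodKernel m y ≤ ∑ j, 1 / ((m j : ℝ) + 1) ^ 2 := by
  have hb : ∀ j, qk (m j) (y j) ^ 4 ≤ 4 / ((m j : ℝ) + 1) ^ 2 := fun j => by
    have := qk_sq_le (m j) (y j)
    calc qk (m j) (y j) ^ 4 = (qk (m j) (y j) ^ 2) ^ 2 := by ring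
      _ ≤ (2 / ((m j : ℝ) + 1)) ^ 2 := by gcongr
      _ = _ := by rw [div_pow]; norm_num
  have amgm : ∀ a b c d : ℝ, a * b * c * d ≤ (a ^ 4 + b ^ 4 + c ^ 4 + d ^ 4) / 4 := by
    intro a b c d
    nlinarith [sq_nonneg (a * b - c * d), sq_nonneg (a ^ 2 - b ^ 2), sq_nonneg (c ^ 2 - d ^ 2)]
  rw [prodKernel, Fin.prod_univ_four, Fin.sum_univ_four]
  have e : ∀ x : ℝ, 4 / x = 4 * (1 / x) := fun x => by ring
  simp only [e] at hb
  linarith [amgm (qk (m 0) (y 0)) (qk (m 1) (y 1)) (qk (m 2) (y 2)) (qk (m 3) (y 3)),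
    hb 0, hb 1, hb 2, hb 3]

lemma inv_sq_step {x : ℝ} (hx : 10 ≤ x) :
    3 / 4 * (1 / x ^ 2) + 1 / 4 * (1 / (x + 1) ^ 2) ≤ 1 / (x + 1 / 8) ^ 2 := by
  rw [← sub_nonneg]
  have : 1 / (x + 1 / 8) ^ 2 - (3 / 4 * (1 / x ^ 2) + 1 / 4 * (1 / (x + 1) ^ 2)) =
      (4 * x ^ 2 * (x + 1) ^ 2 - (x + 1 / 8) ^ 2 * (3 * (x + 1) ^ 2 + x ^ 2)) /
        (4 * x ^ 2 * (x + 1) ^ 2 * (x + 1 / 8) ^ 2) := by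
    field_simp
  rw [this]
  refine div_nonneg ?_ (by positivity)
  obtain ⟨t, rfl, ht⟩ : ∃ t, x = 10 + t ∧ 0 ≤ t := ⟨x - 10, by ring, by linarith⟩
  ring_nf
  positivity

lemma Pn_prodKernel_le (n : ℕ) (m : Fin 4 → ℕ) (y : V4) :
    Pn n (prodKernel m) y ≤ 100 * ∑ j, 1 / ((n : ℝ) / 8 + m j + 10) ^ 2 := by
  induction n generalizing m with
  | zero =>
    rw [Pn_zero, Finset.mul_sum]
    refine (prodKernel_le m y).trans (Finset.sum_le_sum fun j _ => ?_)
    have : (0 : ℝ) ≤ m j := Nat.cast_nonneg _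
    rw [mul_one_div, div_le_div_iff₀ (by positivity) (by positivity)]
    push_cast
    nlinarith
  | succ n ih =>
    rw [Pn_succ']
    have : Pn 1 (prodKernel m) =
        fun y => (∑ j, prodKernel (Function.update m j (m j + 1)) y) * (1 / 4) := by
      funext y; rw [Pn_one_prodKernel]; ring
    rw [this]
    simp only [mul_comm _ ((1 : ℝ) / 4)]
    rw [Pn_mul_left, Pn_sum]
    refine (mul_le_mul_of_nonneg_left (Finset.sum_le_sum fun j _ => ih _) (by norm_num)).trans ?_
    have key : ∀ j, 3 / 4 * (1 / ((n : ℝ) / 8 + m j + 10) ^ 2) +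
        1 / 4 * (1 / ((n : ℝ) / 8 + (m j + 1) + 10) ^ 2) ≤
        1 / ((n + 1 : ℕ) / 8 + m j + 10 : ℝ) ^ 2 := fun j => by
      have := inv_sq_step (x := (n : ℝ) / 8 + m j + 10) (by
        have : (0 : ℝ) ≤ n := Nat.cast_nonneg _
        have : (0 : ℝ) ≤ m j := Nat.cast_nonneg _
        linarith)
      convert this using 3
      · ring
      · push_cast; ring
    rw [← Finset.mul_sum, ← mul_assoc, mul_comm (1 / 4 : ℝ), mul_assoc]
    gcongr
    simp only [Fin.sum_univ_four, Function.update_apply] at key ⊢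
    simp only [Fin.isValue, ↓reduceIte, zero_ne_one, one_ne_zero, Fin.reduceEq, Nat.cast_add,
      Nat.cast_one] at key ⊢
    linarith [key 0, key 1, key 2, key 3]

/-- The heat kernel bound for the simple random walk on `ℤ⁴`. -/
lemma pk_le (n : ℕ) (a b : V4) : pk n a b ≤ 25600 / ((n : ℝ) + 1) ^ 2 := by
  have h : pk n a b = Pn n (prodKernel 0) (a - b) := by
    have := pk_translate n (a - b) 0 b
    rw [sub_add_cancel, zero_add] at this
    rw [this, pk]
    congr 1; funext y; rw [prodKernel_zero]
  rw [h]
  refine (Pn_prodKernel_le n 0 _).trans ?_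
  simp only [Pi.zero_apply, Nat.cast_zero, add_zero, Finset.sum_const, Finset.card_univ,
    Fintype.card_fin, nsmul_eq_mul]
  have : (0 : ℝ) ≤ n := Nat.cast_nonneg _
  push_cast
  rw [← mul_assoc, mul_one_div, div_le_div_iff₀ (by positivity) (by positivity)]
  nlinarith

/-! ### A superharmonic function -/

lemma sum_inv_sq_le (r n : ℕ) :
    ∑ i ∈ Finset.range n, 1 / ((r : ℝ) + i + 1) ^ 2 ≤ 2 / ((r : ℝ) + 1) := by
  have hr : (0 : ℝ) ≤ r := Nat.cast_nonneg _
  have key : ∑ i ∈ Finset.range n, 1 / ((r : ℝ) + i + 1) ^ 2 ≤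
      2 / ((r : ℝ) + 1) - 1 / ((r : ℝ) + n + 1 / 2) := by
    induction n with
    | zero =>
      simp only [Finset.range_zero, Finset.sum_empty, Nat.cast_zero, add_zero, sub_nonneg]
      rw [div_le_div_iff₀ (by positivity) (by positivity)]; linarith
    | succ n ih =>
      rw [Finset.sum_range_succ]
      have hn : (0 : ℝ) ≤ n := Nat.cast_nonneg _
      have : 1 / ((r : ℝ) + n + 1) ^ 2 ≤
          1 / ((r : ℝ) + n + 1 / 2) - 1 / ((r : ℝ) + (n + 1 : ℕ) + 1 / 2) := by
        push_cast
        rw [div_sub_div _ _ (by positivity) (by positivity),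
          div_le_div_iff₀ (by positivity) (by positivity)]
        nlinarith
      linarith
  have : 0 ≤ 1 / ((r : ℝ) + n + 1 / 2) := by positivity
  linarith

/-- The squared Euclidean norm on `ℤ⁴`. -/
def nsq (x : V4) : ℝ := ∑ j, (x j : ℝ) ^ 2

/-- The superharmonic function `1 / (4 + |x|²)`. -/
def hs (x : V4) : ℝ := 1 / (4 + nsq x)

/-- The charge `h - Ph` of the superharmonic function `h`. -/
def ks (x : V4) : ℝ := hs x - Pn 1 hs x

lemma nsq_nonneg (x : V4) : 0 ≤ nsq x := Finset.sum_nonneg fun _ _ => sq_nonneg _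

lemma hs_pos (x : V4) : 0 < hs x := by
  have := nsq_nonneg x; unfold hs; positivity

lemma hs_nonneg (x : V4) : 0 ≤ hs x := (hs_pos x).le

lemma hs_le (x : V4) : hs x ≤ 1 / 4 := by
  have := nsq_nonneg x
  unfold hs; exact one_div_le_one_div_of_le (by norm_num) (by linarith)

lemma hs_neg (x : V4) : hs (-x) = hs x := by simp [hs, nsq]

lemma nsq_add_single (x : V4) (j : Fin 4) (e : ℤ) :
    nsq (x + Pi.single j e) = nsq x + 2 * e * x j + (e : ℝ) ^ 2 := by
  unfold nsq
  rw [← Finset.add_sum_erase _ _ (Finset.mem_univ j),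
    ← Finset.add_sum_erase _ (fun i => (x i : ℝ) ^ 2) (Finset.mem_univ j)]
  have : ∑ i ∈ Finset.univ.erase j, (((x + Pi.single j e : V4) i : ℤ) : ℝ) ^ 2 =
      ∑ i ∈ Finset.univ.erase j, (x i : ℝ) ^ 2 :=
    Finset.sum_congr rfl fun i hi => by simp [Finset.ne_of_mem_erase hi]
  rw [this]
  simp
  ring

lemma Pn_one_nsq (x : V4) : Pn 1 (fun y => 4 + nsq y) x = 5 + nsq x := by
  rw [Pn_one, sum_dirs]
  simp only [nsq_add_single, Fin.sum_univ_four]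
  push_cast
  ring

lemma sq_le_nsq (x : V4) (j : Fin 4) : (x j : ℝ) ^ 2 ≤ nsq x :=
  Finset.single_le_sum (f := fun i => (x i : ℝ) ^ 2) (fun _ _ => sq_nonneg _) (Finset.mem_univ j)

lemma Pn_one_hs (x : V4) : Pn 1 hs x =
    (∑ j, (5 + nsq x) / ((5 + nsq x) ^ 2 - 4 * (x j : ℝ) ^ 2)) / 4 := by
  rw [Pn_one, sum_dirs, div_eq_div_iff (by norm_num) (by norm_num), Finset.sum_mul, Finset.sum_mul]
  refine Finset.sum_congr rfl fun j _ => ?_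
  have h1 := sq_le_nsq x j
  have hE : (x j : ℝ) ^ 2 + 5 ≤ 5 + nsq x := by linarith
  unfold hs
  rw [nsq_add_single, nsq_add_single]
  push_cast
  set E := 5 + nsq x with hEd
  have e1 : 4 + (nsq x + 2 * 1 * (x j : ℝ) + 1 ^ 2) = E + 2 * x j := by rw [hEd]; ring
  have e2 : 4 + (nsq x + 2 * -1 * (x j : ℝ) + (-1) ^ 2) = E - 2 * x j := by rw [hEd]; ring
  rw [e1, e2]
  have p1 : 0 < E + 2 * (x j : ℝ) := by nlinarith [sq_nonneg ((x j : ℝ) + 1)]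
  have p2 : 0 < E - 2 * (x j : ℝ) := by nlinarith [sq_nonneg ((x j : ℝ) - 1)]
  have e3 : E ^ 2 - 4 * (x j : ℝ) ^ 2 = (E + 2 * x j) * (E - 2 * x j) := by ring
  rw [e3]
  field_simp
  ring

lemma ks_nonneg (x : V4) : 0 ≤ ks x := by
  have hr := nsq_nonneg x
  rw [ks, sub_nonneg, Pn_one_hs]
  set E := 5 + nsq x with hE
  have h0 : 0 < E := by positivity
  have hD : 0 < E ^ 2 - 4 * nsq x := by nlinarith
  have key : ∀ j, E / (E ^ 2 - 4 * (x j : ℝ) ^ 2) ≤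
      1 / E + (x j : ℝ) ^ 2 * (4 / (E * (E ^ 2 - 4 * nsq x))) := fun j => by
    have h1 := sq_le_nsq x j
    have h2 : 0 < E ^ 2 - 4 * (x j : ℝ) ^ 2 := by linarith
    have : E / (E ^ 2 - 4 * (x j : ℝ) ^ 2) =
        1 / E + (x j : ℝ) ^ 2 * (4 / (E * (E ^ 2 - 4 * (x j : ℝ) ^ 2))) := by
      field_simp
      ring
    rw [this]
    gcongr
  have hsum := Finset.sum_le_sum fun j (_ : j ∈ Finset.univ) => key j
  rw [Finset.sum_add_distrib, ← Finset.sum_mul] at hsum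
  change _ ≤ _ + nsq x * _ at hsum
  have hx : nsq x = E - 5 := by rw [hE]; ring
  have hfin : (4 * (1 / E) + nsq x * (4 / (E * (E ^ 2 - 4 * nsq x)))) / 4 ≤ 1 / (E - 1) := by
    have hE5 : 5 ≤ E := by linarith
    rw [hx] at hD ⊢
    have h3 : (4 * (1 / E) + (E - 5) * (4 / (E * (E ^ 2 - 4 * (E - 5))))) / 4 =
        (E ^ 2 - 4 * (E - 5) + (E - 5)) / (E * (E ^ 2 - 4 * (E - 5))) := by
      field_simp
    rw [h3, div_le_div_iff₀ (by positivity) (by linarith)]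
    nlinarith
  have h4 : hs x = 1 / (E - 1) := by rw [hs, hE]; congr 1; ring
  rw [h4]
  refine le_trans ?_ hfin
  simp only [Finset.sum_const, Finset.card_univ, Fintype.card_fin, nsmul_eq_mul] at hsum
  push_cast at hsum
  gcongr

lemma ks_le (x : V4) : ks x ≤ 8 / (5 + nsq x) ^ 3 := by
  have hr := nsq_nonneg x
  rw [ks, Pn_one_hs]
  set E := 5 + nsq x with hE
  have hE5 : 5 ≤ E := by linarith
  have h0 : 0 < E := by positivity
  have key : ∀ j, 1 / E + (x j : ℝ) ^ 2 * (4 / E ^ 3) ≤ E / (E ^ 2 - 4 * (x j : ℝ) ^ 2) := fun j => by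
    have h1 := sq_le_nsq x j
    have h2 : 0 < E ^ 2 - 4 * (x j : ℝ) ^ 2 := by nlinarith
    have : E / (E ^ 2 - 4 * (x j : ℝ) ^ 2) =
        1 / E + (x j : ℝ) ^ 2 * (4 / (E * (E ^ 2 - 4 * (x j : ℝ) ^ 2))) := by
      field_simp
      ring
    rw [this, show E ^ 3 = E * E ^ 2 by ring]
    gcongr
    linarith [sq_nonneg (x j : ℝ)]
  have hsum := Finset.sum_le_sum fun j (_ : j ∈ Finset.univ) => key j
  rw [Finset.sum_add_distrib, ← Finset.sum_mul] at hsum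
  change _ + nsq x * _ ≤ _ at hsum
  simp only [Finset.sum_const, Finset.card_univ, Fintype.card_fin, nsmul_eq_mul] at hsum
  push_cast at hsum
  have hx : nsq x = E - 5 := by rw [hE]; ring
  have h4 : hs x = 1 / (E - 1) := by rw [hs, hE]; congr 1; ring
  rw [h4]
  rw [hx] at hsum
  have hfin : 1 / (E - 1) - (4 * (1 / E) + (E - 5) * (4 / E ^ 3)) / 4 ≤ 8 / E ^ 3 := by
    have hE1 : 0 < E - 1 := by linarith
    have h3 : 1 / (E - 1) - (4 * (1 / E) + (E - 5) * (4 / E ^ 3)) / 4 =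
        (6 * E - 5) / (E ^ 3 * (E - 1)) := by
      have : E - 1 ≠ 0 := hE1.ne'
      field_simp
      ring
    rw [h3, div_le_div_iff₀ (by positivity) (by positivity)]
    nlinarith [pow_pos h0 3]
  linarith

lemma exists_sum_ks_le : ∃ K : ℝ, 0 < K ∧ ∀ Λ : Finset V4, ∑ x ∈ Λ, ks x ≤ K := by
  set f : ℤ → ℝ := fun z => (1 + (z : ℝ) ^ 2) ^ (-(3 / 4) : ℝ) with hf
  have hf0 : ∀ z, 0 ≤ f z := fun z => by rw [hf]; positivity
  have hsum : Summable f := by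
    have h1 : Summable fun z : ℤ => |(z : ℝ)| ^ (-(3 / 2) : ℝ) :=
      Real.summable_abs_int_rpow (by norm_num)
    have h2 : Summable fun z : ℤ => if z = 0 then (1 : ℝ) else 0 :=
      summable_of_ne_finset_zero (s := {0}) fun z hz => by simp at hz; simp [hz]
    refine Summable.of_nonneg_of_le hf0 (fun z => ?_) (h1.add h2)
    by_cases hz : z = 0
    · subst hz; simp [hf]
    · have hz' : 0 < |(z : ℝ)| := by positivity
      simp only [hz, if_false, add_zero, hf]
      have : |(z : ℝ)| ^ (-(3 / 2) : ℝ) = (|(z : ℝ)| ^ (2 : ℕ)) ^ (-(3 / 4) : ℝ) := by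
        rw [← Real.rpow_natCast, ← Real.rpow_mul hz'.le]; norm_num
      rw [this]
      refine Real.rpow_le_rpow_of_nonpos (by positivity) ?_ (by norm_num)
      rw [sq_abs]; linarith
  have hS : 0 ≤ ∑' z, f z := tsum_nonneg hf0
  refine ⟨8 * (∑' z, f z) ^ 4 + 1, by positivity, fun Λ => ?_⟩
  have hk : ∀ x, ks x ≤ 8 * ∏ i, f (x i) := fun x => by
    have hE : 0 < 5 + nsq x := by have := nsq_nonneg x; positivity
    refine (ks_le x).trans ?_
    have h1 : 8 / (5 + nsq x) ^ 3 = 8 * ∏ _i : Fin 4, (5 + nsq x) ^ (-(3 / 4) : ℝ) := by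
      simp only [Finset.prod_const, Finset.card_univ, Fintype.card_fin]
      rw [← Real.rpow_natCast ((5 + nsq x) ^ (-(3 / 4) : ℝ)), ← Real.rpow_mul hE.le, div_eq_mul_inv]
      congr 1
      rw [← Real.rpow_natCast, ← Real.rpow_neg hE.le]
      norm_num
    rw [h1]
    refine mul_le_mul_of_nonneg_left ?_ (by norm_num)
    refine Finset.prod_le_prod (fun _ _ => by positivity) fun i _ => ?_
    refine Real.rpow_le_rpow_of_nonpos (by positivity) ?_ (by norm_num)
    linarith [sq_le_nsq x i]
  let B : Finset V4 := Fintype.piFinset fun i => Λ.image fun x => x i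
  have hsub : Λ ⊆ B := fun x hx => Fintype.mem_piFinset.2 fun i => Finset.mem_image_of_mem _ hx
  calc ∑ x ∈ Λ, ks x ≤ ∑ x ∈ B, 8 * ∏ i, f (x i) :=
        (Finset.sum_le_sum fun x _ => hk x).trans
          (Finset.sum_le_sum_of_subset_of_nonneg hsub fun x _ _ => by
            have := Finset.prod_nonneg fun i (_ : i ∈ Finset.univ) => hf0 (x i)
            positivity)
    _ = 8 * ∏ i : Fin 4, ∑ z ∈ Λ.image (fun x => x i), f z := by
        rw [← Finset.mul_sum, Finset.prod_univ_sum]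
    _ ≤ 8 * ∏ _i : Fin 4, ∑' z, f z := by
        refine mul_le_mul_of_nonneg_left ?_ (by norm_num)
        exact Finset.prod_le_prod (fun i _ => Finset.sum_nonneg fun z _ => hf0 z)
          fun i _ => hsum.sum_le_tsum _ fun z _ => hf0 z
    _ ≤ _ := by simp

/-- A bound for the total charge of `h`. -/
def ksMass : ℝ := exists_sum_ks_le.choose

lemma ksMass_pos : 0 < ksMass := exists_sum_ks_le.choose_spec.1

lemma sum_ks_le (Λ : Finset V4) : ∑ x ∈ Λ, ks x ≤ ksMass := exists_sum_ks_le.choose_spec.2 Λ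

lemma exists_reach (n : ℕ) (x : V4) : ∃ Λ : Finset V4, ∀ s, IsSteps n s → x + s.sum ∈ Λ := by
  induction n generalizing x with
  | zero =>
    refine ⟨{x}, fun s hs => ?_⟩
    rw [List.length_eq_zero_iff.1 hs.1]; simp
  | succ n ih =>
    choose f hf using ih
    refine ⟨dirs.biUnion fun d => f (x + d), fun s hs => ?_⟩
    rcases s with _ | ⟨d, s⟩
    · simpa using hs.1
    · refine Finset.mem_biUnion.2 ⟨d, hs.2 d (by simp), ?_⟩
      rw [List.sum_cons, ← add_assoc]
      exact hf _ s ⟨by simpa using hs.1, fun e he => hs.2 e (by simp [he])⟩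

/-- Expand `Pn` over a finite set, chosen so as to contain a prescribed finite set. -/
lemma exists_Pn_eq_sum (n : ℕ) (x : V4) (Λ₀ : Finset V4) :
    ∃ Λ : Finset V4, Λ₀ ⊆ Λ ∧ ∀ f : V4 → ℝ, Pn n f x = ∑ b ∈ Λ, pk n x b * f b := by
  obtain ⟨Λ, hΛ⟩ := exists_reach n x
  refine ⟨Λ₀ ∪ Λ, Finset.subset_union_left, fun f => ?_⟩
  rw [sum_pk_mul]
  refine Es_congr fun s hs => ?_
  dsimp only
  rw [if_pos (Finset.mem_union_right _ (hΛ s hs))]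

lemma Pn_ks_le (n : ℕ) (x : V4) : Pn n ks x ≤ 25600 * ksMass / ((n : ℝ) + 1) ^ 2 := by
  obtain ⟨Λ, -, hΛ⟩ := exists_Pn_eq_sum n x ∅
  rw [hΛ]
  calc ∑ b ∈ Λ, pk n x b * ks b ≤ ∑ b ∈ Λ, 25600 / ((n : ℝ) + 1) ^ 2 * ks b :=
        Finset.sum_le_sum fun b _ => mul_le_mul_of_nonneg_right (pk_le n x b) (ks_nonneg b)
    _ ≤ 25600 / ((n : ℝ) + 1) ^ 2 * ksMass := by
        rw [← Finset.mul_sum]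
        exact mul_le_mul_of_nonneg_left (sum_ks_le Λ) (by positivity)
    _ = _ := by ring

lemma sum_Pn_ks (n : ℕ) (x : V4) : ∑ i ∈ Finset.range n, Pn i ks x = hs x - Pn n hs x := by
  induction n with
  | zero => simp [Pn_zero]
  | succ n ih =>
    rw [Finset.sum_range_succ, ih]
    have : Pn n ks x = Pn n hs x - Pn (n + 1) hs x := by
      rw [Pn_succ']; exact Pn_sub_fun n _ _ x
    rw [this]; ring

lemma Pn_hs_sub (n m : ℕ) (x : V4) :
    Pn n hs x - Pn (n + m) hs x = ∑ i ∈ Finset.range m, Pn (n + i) ks x := by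
  have h1 := sum_Pn_ks n x
  have h2 := sum_Pn_ks (n + m) x
  rw [Finset.sum_range_add] at h2
  linarith

lemma finite_hs_ge {ε : ℝ} (hε : 0 < ε) : {x | ε ≤ hs x}.Finite := by
  obtain ⟨R, hR⟩ := exists_nat_ge (1 / ε)
  refine Set.Finite.subset (Set.Finite.pi' fun _ : Fin 4 => Set.finite_Icc (-(R : ℤ)) R)
    fun x hx i => ?_
  have h1 : 4 + nsq x ≤ 1 / ε := by
    have := nsq_nonneg x
    rw [le_div_iff₀ hε]
    have hx' : ε ≤ 1 / (4 + nsq x) := hx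
    rw [le_div_iff₀ (by positivity)] at hx'
    linarith
  have h2 := sq_le_nsq x i
  have h3 : ((x i : ℤ) : ℝ) ^ 2 ≤ R := by linarith
  have h4 : (x i) ^ 2 ≤ (R : ℤ) := by exact_mod_cast h3
  constructor <;> nlinarith

lemma Pn_hs_tendsto (x : V4) {ε : ℝ} (hε : 0 < ε) : ∃ n₀ : ℕ, ∀ n ≥ n₀, Pn n hs x ≤ ε := by
  set Λ := (finite_hs_ge (half_pos hε)).toFinset with hΛ
  obtain ⟨n₀, hn₀⟩ := exists_nat_ge (25600 * Λ.card * (2 / ε))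
  refine ⟨n₀, fun n hn => ?_⟩
  have h1 : Pn n hs x ≤ ε / 2 + ∑ b ∈ Λ, pk n x b * 1 := by
    rw [sum_pk_mul, ← Pn_const n (ε / 2) x, ← Pn_add_fun]
    refine Pn_mono (fun y => ?_) x
    by_cases hy : y ∈ Λ
    · rw [if_pos hy]; linarith [hs_le y]
    · rw [if_neg hy]
      rw [hΛ, Set.Finite.mem_toFinset, mem_ofPred_eq, not_le] at hy
      linarith
  have h2 : ∑ b ∈ Λ, pk n x b * 1 ≤ 25600 * Λ.card / ((n : ℝ) + 1) := by
    calc ∑ b ∈ Λ, pk n x b * 1 ≤ ∑ _b ∈ Λ, 25600 / ((n : ℝ) + 1) := by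
          refine Finset.sum_le_sum fun b _ => ?_
          rw [mul_one]
          refine (pk_le n x b).trans ?_
          have : (0 : ℝ) ≤ n := Nat.cast_nonneg _
          gcongr
          nlinarith
      _ = _ := by rw [Finset.sum_const, nsmul_eq_mul]; ring
  have h3 : 25600 * Λ.card / ((n : ℝ) + 1) ≤ ε / 2 := by
    rw [div_le_iff₀ (by positivity)]
    have : (n₀ : ℝ) ≤ n := by exact_mod_cast hn
    have h5 : 25600 * Λ.card * (2 / ε) ≤ (n : ℝ) + 1 := by linarith
    rw [← mul_div_assoc, div_le_iff₀ hε] at h5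
    linarith
  linarith

/-- The constant in the decay of `Pⁿ h`. -/
def hsDecay : ℝ := 51200 * ksMass

lemma hsDecay_pos : 0 < hsDecay := mul_pos (by norm_num) ksMass_pos

lemma Pn_hs_le (n : ℕ) (x : V4) : Pn n hs x ≤ hsDecay / ((n : ℝ) + 1) := by
  refine le_of_forall_pos_le_add fun ε hε => ?_
  obtain ⟨m, hm⟩ := Pn_hs_tendsto x hε
  have h1 := Pn_hs_sub n m x
  have h2 : ∑ i ∈ Finset.range m, Pn (n + i) ks x ≤ hsDecay / ((n : ℝ) + 1) := by
    calc _ ≤ ∑ i ∈ Finset.range m, 25600 * ksMass * (1 / ((n : ℝ) + i + 1) ^ 2) := by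
          refine Finset.sum_le_sum fun i _ => (Pn_ks_le _ x).trans_eq ?_
          push_cast; ring
      _ ≤ 25600 * ksMass * (2 / ((n : ℝ) + 1)) := by
          rw [← Finset.mul_sum]
          exact mul_le_mul_of_nonneg_left (sum_inv_sq_le n m)
            (mul_nonneg (by norm_num) ksMass_pos.le)
      _ = _ := by rw [hsDecay]; ring
  linarith [hm (n + m) (by omega)]

lemma Pn_hs_le_hs (n : ℕ) (x : V4) : Pn n hs x ≤ hs x := by
  have h := sum_Pn_ks n x
  have : 0 ≤ ∑ i ∈ Finset.range n, Pn i ks x :=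
    Finset.sum_nonneg fun i _ => Pn_nonneg ks_nonneg x
  linarith

/-! ### The accumulated potential along a walk -/

lemma Es_prod_martingale (n : ℕ) (x : V4) :
    Es n (fun s => (4 + nsq (x + s.sum)) * ∏ i ∈ Finset.range n, (1 + hs (x + walk s i))⁻¹) =
      4 + nsq x := by
  induction n generalizing x with
  | zero => simp [Es_zero]
  | succ n ih =>
    have hx := hs_pos x
    have hn := nsq_nonneg x
    have h1 := Pn_one_nsq x
    rw [Pn_one] at h1
    have h2 : ∀ d, (Es n fun s => (4 + nsq (x + (d :: s).sum)) *
        ∏ i ∈ Finset.range (n + 1), (1 + hs (x + walk (d :: s) i))⁻¹) =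
        (4 + nsq (x + d)) * (1 + hs x)⁻¹ := fun d => by
      rw [← ih (x + d), ← Es_mul_right]
      congr 1; funext s
      rw [Finset.prod_range_succ']
      simp only [walk_cons_succ, walk_zero, List.sum_cons, add_zero, ← add_assoc]
      ring
    rw [Es_succ]
    simp only [h2]
    rw [← Finset.sum_mul, mul_div_right_comm, h1, hs]
    field_simp
    ring

lemma Es_sum_hs_small (r : ℕ) (hr : 1 ≤ r) :
    Es r (fun s => ind (∑ i ∈ Finset.range r, hs (walk s i) ≤ 1 / 4 * Real.log r)) ≤
      (4 + hsDecay) * (r : ℝ) ^ (-(1 / 4) : ℝ) := by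
  have hr0 : (0 : ℝ) < r := by exact_mod_cast hr
  have hr1 : (1 : ℝ) ≤ r := by exact_mod_cast hr
  set q : ℝ := (r : ℝ) ^ (-(1 / 4) : ℝ) with hq
  have hq0 : 0 < q := by positivity
  have hqq : q ^ 4 * r = 1 := by
    rw [hq, ← Real.rpow_natCast, ← Real.rpow_mul hr0.le]
    norm_num
    rw [Real.rpow_neg_one]; field_simp
  have hq1 : q ≤ 1 := Real.rpow_le_one_of_one_le_of_nonpos hr1 (by norm_num)
  set W : List V4 → ℝ := fun s =>
    (4 + nsq (0 + s.sum)) * ∏ i ∈ Finset.range r, (1 + hs (0 + walk s i))⁻¹ with hW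
  have hW4 : Es r W = 4 := by rw [hW, Es_prod_martingale]; simp [nsq]
  have hpt : ∀ s, ind (∑ i ∈ Finset.range r, hs (walk s i) ≤ 1 / 4 * Real.log r) ≤
      q * W s + hs (0 + s.sum) / q ^ 2 := fun s => by
    have hn := nsq_nonneg (0 + s.sum)
    have hW0 : 0 ≤ W s := by
      refine mul_nonneg (by positivity) (Finset.prod_nonneg fun i _ => ?_)
      have := hs_pos (0 + walk s i); positivity
    have hh := hs_pos (0 + s.sum)
    by_cases hp : ∑ i ∈ Finset.range r, hs (walk s i) ≤ 1 / 4 * Real.log r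
    · rw [ind_true hp]
      by_cases hc : 4 + nsq (0 + s.sum) ≤ 1 / q ^ 2
      · have : 1 ≤ hs (0 + s.sum) / q ^ 2 := by
          rw [hs, div_div, le_div_iff₀ (by positivity), one_mul]
          rw [le_div_iff₀ (by positivity)] at hc; linarith
        linarith [mul_nonneg hq0.le hW0]
      · push Not at hc
        have hprod : q ≤ ∏ i ∈ Finset.range r, (1 + hs (0 + walk s i))⁻¹ := by
          have h1 : ∀ i ∈ Finset.range r, Real.exp (-hs (walk s i)) ≤ (1 + hs (0 + walk s i))⁻¹ := by
            intro i _
            have := hs_pos (walk s i)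
            rw [zero_add, Real.exp_neg]
            apply inv_anti₀ (by positivity)
            linarith [Real.add_one_le_exp (hs (walk s i))]
          refine le_trans ?_ (Finset.prod_le_prod (fun _ _ => (Real.exp_pos _).le) h1)
          rw [← Real.exp_sum, hq, Real.rpow_def_of_pos hr0, Finset.sum_neg_distrib]
          apply Real.exp_le_exp.2
          linarith
        have : 1 ≤ q * W s := by
          have h3 : 1 / q ^ 2 * q ≤ W s :=
            mul_le_mul hc.le hprod hq0.le (by positivity)
          calc 1 = q * (1 / q ^ 2 * q) := by field_simp
            _ ≤ _ := mul_le_mul_of_nonneg_left h3 hq0.le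
        linarith [div_nonneg hh.le (sq_nonneg q)]
    · rw [ind_false hp]
      exact add_nonneg (mul_nonneg hq0.le hW0) (div_nonneg hh.le (sq_nonneg q))
  refine (Es_mono fun s _ => hpt s).trans ?_
  rw [Es_add, Es_mul_left, hW4, Es_div]
  have h5 := Pn_hs_le r 0
  rw [Pn] at h5
  have h6 : hsDecay / ((r : ℝ) + 1) / q ^ 2 ≤ hsDecay * q := by
    have := hsDecay_pos
    rw [div_div, div_le_iff₀ (by positivity)]
    have h7 : 1 ≤ q * (((r : ℝ) + 1) * q ^ 2) := by
      have : q ^ 4 * r ≤ q ^ 3 * r := by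
        have := pow_le_pow_of_le_one hq0.le hq1 (show 3 ≤ 4 by norm_num)
        gcongr
      nlinarith [pow_pos hq0 3]
    nlinarith
  have h8 : Es r (fun s => hs (0 + s.sum)) / q ^ 2 ≤ hsDecay / ((r : ℝ) + 1) / q ^ 2 := by gcongr
  linarith

/-! ### Avoidance probabilities and last-exit decompositions -/

/-- The probability that the walk from `x` avoids `A` at times `1, …, n`. -/
def av (A : Set V4) (n : ℕ) (x : V4) : ℝ :=
  Es n fun s => ind (∀ i, 1 ≤ i → i ≤ n → x + walk s i ∉ A)

lemma av_nonneg (A : Set V4) (n : ℕ) (x : V4) : 0 ≤ av A n x := Es_nonneg fun _ _ => ind_nonneg _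

lemma av_le_one (A : Set V4) (n : ℕ) (x : V4) : av A n x ≤ 1 := Es_le_const fun _ _ => ind_le_one _

lemma av_zero (A : Set V4) (x : V4) : av A 0 x = 1 := by
  rw [av, Es_zero]; exact ind_true fun i h1 h2 => by omega

lemma av_succ (A : Set V4) (n : ℕ) (x : V4) :
    av A (n + 1) x = (∑ d ∈ dirs, ind (x + d ∉ A) * av A n (x + d)) / 8 := by
  rw [av, Es_succ]
  congr 1
  refine Finset.sum_congr rfl fun d _ => ?_
  rw [av, ← Es_mul_left]
  congr 1; funext s
  rw [← ind_and]
  refine ind_congr ⟨fun h => ⟨?_, fun i h1 h2 => ?_⟩, fun h i h1 h2 => ?_⟩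
  · simpa [walk_cons_succ, walk_zero] using h 1 le_rfl (by omega)
  · have := h (i + 1) (by omega) (by omega)
    rwa [walk_cons_succ, ← add_assoc] at this
  · obtain ⟨i, rfl⟩ : ∃ k, i = k + 1 := ⟨i - 1, by omega⟩
    rw [walk_cons_succ, ← add_assoc]
    rcases Nat.eq_zero_or_pos i with rfl | hi
    · rw [walk_zero, add_zero]; exact h.1
    · exact h.2 i hi (by omega)

lemma av_antitone_time (A : Set V4) {m n : ℕ} (h : m ≤ n) (x : V4) : av A n x ≤ av A m x := by
  have := Es_take h fun s => ind (∀ i, 1 ≤ i → i ≤ m → x + walk s i ∉ A)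
  rw [av, av, ← this]
  refine Es_mono fun s _ => ind_mono fun H i h1 h2 => ?_
  rw [walk_take h2]
  exact H i h1 (h2.trans h)

lemma av_antitone_set {A B : Set V4} (h : A ⊆ B) (n : ℕ) (x : V4) : av B n x ≤ av A n x :=
  Es_mono fun _ _ => ind_mono fun H i h1 h2 hm => H i h1 h2 (h hm)

lemma avoidCount_div (A : Set V4) (n : ℕ) (x : V4) :
    (avoidCount A n x : ℝ) / 8 ^ n = av A n x := by
  induction n generalizing x with
  | zero => simp [avoidCount, av_zero]
  | succ n ih =>
    rw [avoidCount, av_succ, Finset.sum_filter, pow_succ, ← div_div]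
    push_cast
    rw [sum_latNbrs x fun b => if b ∉ A then (avoidCount A n b : ℝ) else 0, Finset.sum_div]
    congr 1
    refine Finset.sum_congr rfl fun d _ => ?_
    rw [← ih]
    by_cases hd : x + d ∈ A <;> simp [ind, hd]

lemma escProb_eq (A : Set V4) (x : V4) : escProb A x = ⨅ n, av A n x := by
  simp only [escProb, avoidCount_div]

lemma tendsto_av (A : Set V4) (x : V4) :
    Tendsto (fun n => av A n x) atTop (𝓝 (escProb A x)) := by
  rw [escProb_eq]
  exact tendsto_atTop_ciInf (fun _ _ h => av_antitone_time A h x)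
    ⟨0, by rintro _ ⟨n, rfl⟩; exact av_nonneg A n x⟩

lemma escProb_nonneg (A : Set V4) (x : V4) : 0 ≤ escProb A x := by
  rw [escProb_eq]; exact Real.iInf_nonneg fun n => av_nonneg A n x

lemma escProb_le_av (A : Set V4) (n : ℕ) (x : V4) : escProb A x ≤ av A n x := by
  rw [escProb_eq]
  exact ciInf_le ⟨0, by rintro _ ⟨n, rfl⟩; exact av_nonneg A n x⟩ n

/-- Avoidance probability restricted to starting points in `A`. -/
def avOn (A : Set V4) (n : ℕ) (x : V4) : ℝ := ind (x ∈ A) * av A n x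

lemma avOn_nonneg (A : Set V4) (n : ℕ) (x : V4) : 0 ≤ avOn A n x :=
  mul_nonneg (ind_nonneg _) (av_nonneg _ _ _)

/-- The probability that the walk from `y` visits `A` during `[0, r]`, decomposed according to
the last visit. -/
def hitP (A : Set V4) (r : ℕ) (y : V4) : ℝ :=
  ∑ i ∈ Finset.range (r + 1), Pn i (avOn A (r - i)) y

lemma hitP_add (A : Set V4) (r : ℕ) (y : V4) : hitP A r y + ind (y ∉ A) * av A r y = 1 := by
  induction r generalizing y with
  | zero => simp [hitP, Pn_zero, avOn, av_zero, ind_not]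
  | succ r ih =>
    have h1 : hitP A (r + 1) y = avOn A (r + 1) y + (∑ d ∈ dirs, hitP A r (y + d)) / 8 := by
      rw [hitP, Finset.sum_range_succ', Pn_zero, add_comm]
      congr 1
      simp only [Pn_succ, hitP, Nat.add_sub_add_right]
      rw [← Finset.sum_div, Finset.sum_comm]
    have h2 : ∀ d, hitP A r (y + d) = 1 - ind (y + d ∉ A) * av A r (y + d) := fun d => by
      linarith [ih (y + d)]
    rw [h1]
    have h3 := av_succ A r y
    simp only [h2, Finset.sum_sub_distrib, sub_div, ← h3, avOn, ind_not (y ∈ A)]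
    simp [card_dirs]
    ring

lemma hitP_le_one (A : Set V4) (r : ℕ) (y : V4) : hitP A r y ≤ 1 := by
  have := hitP_add A r y
  have : 0 ≤ ind (y ∉ A) * av A r y := mul_nonneg (ind_nonneg _) (av_nonneg _ _ _)
  linarith

lemma hitP_mono {A B : Set V4} (h : A ⊆ B) (r : ℕ) (y : V4) : hitP A r y ≤ hitP B r y := by
  have h1 := hitP_add A r y
  have h2 := hitP_add B r y
  have : ind (y ∉ B) * av B r y ≤ ind (y ∉ A) * av A r y :=
    mul_le_mul (ind_mono fun hB hA => hB (h hA)) (av_antitone_set h r y) (av_nonneg _ _ _)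
      (ind_nonneg _)
  linarith

lemma hitP_eq_one {A : Set V4} {y : V4} (hy : y ∈ A) (r : ℕ) : hitP A r y = 1 := by
  have := hitP_add A r y
  rw [ind_false (not_not.2 hy)] at this
  linarith

lemma hitP_reflect (A : Set V4) (r : ℕ) (y : V4) :
    hitP A r y = ∑ j ∈ Finset.range (r + 1), Pn (r - j) (avOn A j) y := by
  rw [hitP, ← Finset.sum_range_reflect]
  refine Finset.sum_congr rfl fun j hj => ?_
  have := Finset.mem_range.1 hj
  rw [show r + 1 - 1 - j = r - j by omega, show r - (r - j) = j by omega]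

/-- The total hitting probability over time horizons with window `N`. -/
lemma sum_hitP (A : Set V4) (L N : ℕ) (y : V4) :
    ∑ r ∈ Finset.range L, Pn (r - N) (hitP A (min r N)) y =
      ∑ j ∈ Finset.range (N + 1), ∑ i ∈ Finset.range (L - j), Pn i (avOn A j) y := by
  induction L with
  | zero => simp
  | succ L ih =>
    rw [Finset.sum_range_succ, ih]
    have h1 : Pn (L - N) (hitP A (min L N)) y =
        ∑ j ∈ Finset.range (N + 1), if j ≤ L then Pn (L - j) (avOn A j) y else 0 := by
      have : hitP A (min L N) = fun z =>
          ∑ j ∈ Finset.range (min L N + 1), Pn (min L N - j) (avOn A j) z :=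
        funext fun z => hitP_reflect A _ z
      rw [this, Pn_sum, ← Finset.sum_filter]
      have hf : (Finset.range (N + 1)).filter (fun j => j ≤ L) = Finset.range (min L N + 1) := by
        ext j; simp; omega
      rw [hf]
      refine Finset.sum_congr rfl fun j hj => ?_
      have := Finset.mem_range.1 hj
      rw [← Pn_add]
      congr 1; omega
    rw [h1, ← Finset.sum_add_distrib]
    refine Finset.sum_congr rfl fun j _ => ?_
    by_cases hj : j ≤ L
    · rw [if_pos hj, show L + 1 - j = L - j + 1 by omega, Finset.sum_range_succ]
    · rw [if_neg hj, show L + 1 - j = 0 by omega, show L - j = 0 by omega]; simp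

/-- The expected time, up to `N`, before the walk from `a` returns to `A`. -/
def avSum (A : Set V4) (N : ℕ) (a : V4) : ℝ := ∑ j ∈ Finset.range (N + 1), av A j a

lemma avSum_nonneg (A : Set V4) (N : ℕ) (a : V4) : 0 ≤ avSum A N a :=
  Finset.sum_nonneg fun _ _ => av_nonneg _ _ _

lemma avSum_le (A : Set V4) (N : ℕ) (a : V4) : avSum A N a ≤ N + 1 := by
  calc avSum A N a ≤ ∑ _j ∈ Finset.range (N + 1), (1 : ℝ) :=
        Finset.sum_le_sum fun _ _ => av_le_one _ _ _
    _ = _ := by simp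

lemma sum_pk_avOn (A : Finset V4) (i j : ℕ) (y : V4) :
    Pn i (avOn A j) y = ∑ a ∈ A, pk i y a * av A j a := by
  rw [sum_pk_mul]
  congr 1; funext z
  by_cases hz : z ∈ A <;> simp [avOn, ind, hz]

/-- The potential of `avSum` on a finite set. -/
lemma sum_gk_avSum (A : Finset V4) (M N : ℕ) (y : V4) :
    ∑ a ∈ A, gk M y a * avSum A N a =
      ∑ j ∈ Finset.range (N + 1), ∑ i ∈ Finset.range M, Pn i (avOn A j) y := by
  simp only [sum_pk_avOn, gk, avSum, Finset.sum_mul_sum]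
  rw [Finset.sum_comm]
  conv_rhs => rw [Finset.sum_comm]
  exact Finset.sum_congr rfl fun i _ => Finset.sum_comm

lemma sum_gk_avSum_mono {A B : Finset V4} (h : A ⊆ B) (M N : ℕ) (y : V4) :
    ∑ a ∈ A, gk M y a * avSum A N a ≤ ∑ b ∈ B, gk (M + N) y b * avSum B N b := by
  rw [sum_gk_avSum, sum_gk_avSum]
  calc _ ≤ ∑ j ∈ Finset.range (N + 1), ∑ i ∈ Finset.range (M + N - j), Pn i (avOn A j) y := by
        refine Finset.sum_le_sum fun j hj => Finset.sum_le_sum_of_subset_of_nonneg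
          (Finset.range_mono ?_) fun i _ _ => Pn_nonneg (avOn_nonneg _ _) _
        have := Finset.mem_range.1 hj; omega
    _ ≤ ∑ j ∈ Finset.range (N + 1), ∑ i ∈ Finset.range (M + N - j), Pn i (avOn B j) y := by
        rw [← sum_hitP, ← sum_hitP]
        exact Finset.sum_le_sum fun r _ =>
          Pn_mono (fun z => hitP_mono (Finset.coe_subset.2 h) _ z) _
    _ ≤ _ := by
        refine Finset.sum_le_sum fun j hj => Finset.sum_le_sum_of_subset_of_nonneg
          (Finset.range_mono (by omega)) fun i _ _ => Pn_nonneg (avOn_nonneg _ _) _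

lemma sum_Pn_avOn_le (A : Set V4) (N : ℕ) (y : V4) :
    ∑ j ∈ Finset.range (N + 1), ∑ i ∈ Finset.range (N + 1), Pn i (avOn A j) y ≤ 2 * N + 1 := by
  calc _ ≤ ∑ j ∈ Finset.range (N + 1), ∑ i ∈ Finset.range (2 * N + 1 - j), Pn i (avOn A j) y := by
        refine Finset.sum_le_sum fun j hj => Finset.sum_le_sum_of_subset_of_nonneg
          (Finset.range_mono ?_) fun i _ _ => Pn_nonneg (avOn_nonneg _ _) _
        have := Finset.mem_range.1 hj; omega
    _ ≤ ∑ _r ∈ Finset.range (2 * N + 1), (1 : ℝ) := by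
        rw [← sum_hitP]
        exact Finset.sum_le_sum fun r _ => Es_le_const fun s _ => hitP_le_one _ _ _
    _ = _ := by simp

lemma sum_pk_tail_le (r n : ℕ) (a b : V4) :
    ∑ i ∈ Finset.range n, pk (r + i) a b ≤ 51200 / ((r : ℝ) + 1) := by
  calc _ ≤ ∑ i ∈ Finset.range n, 25600 * (1 / ((r : ℝ) + i + 1) ^ 2) :=
        Finset.sum_le_sum fun i _ => (pk_le _ a b).trans_eq (by push_cast; ring)
    _ ≤ 25600 * (2 / ((r : ℝ) + 1)) := by
        rw [← Finset.mul_sum]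
        exact mul_le_mul_of_nonneg_left (sum_inv_sq_le r n) (by norm_num)
    _ = _ := by ring

lemma gk_le_add (r M : ℕ) (a b : V4) : gk M a b ≤ gk r a b + 51200 / ((r : ℝ) + 1) := by
  refine (gk_mono (Nat.le_add_left M r) a b).trans ?_
  rw [gk, Finset.sum_range_add]
  gcongr
  exacts [le_rfl, sum_pk_tail_le r M a b]

/-- The potential of `avSum A N` is of order `N` as soon as `A` has at most `N + 1` points. -/
lemma sum_gk_avSum_le {A : Finset V4} {N : ℕ} (hA : A.card ≤ N + 1) (M : ℕ) (y : V4) :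
    ∑ a ∈ A, gk M y a * avSum A N a ≤ 51202 * ((N : ℝ) + 1) := by
  have hN : (0 : ℝ) ≤ N := Nat.cast_nonneg _
  calc _ ≤ ∑ a ∈ A, (gk (N + 1) y a * avSum A N a + 51200 / ((N : ℝ) + 1) * ((N : ℝ) + 1)) := by
        refine Finset.sum_le_sum fun a _ => ?_
        have h1 := gk_le_add (N + 1) M y a
        have h2 : 51200 / (((N + 1 : ℕ) : ℝ) + 1) ≤ 51200 / ((N : ℝ) + 1) := by
          push_cast; gcongr; linarith
        calc gk M y a * avSum A N a
            ≤ (gk (N + 1) y a + 51200 / ((N : ℝ) + 1)) * avSum A N a :=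
              mul_le_mul_of_nonneg_right (by linarith) (avSum_nonneg _ _ _)
          _ ≤ _ := by
              rw [add_mul]
              gcongr
              exact avSum_le _ _ _
    _ = ∑ a ∈ A, gk (N + 1) y a * avSum A N a + A.card * 51200 := by
        rw [Finset.sum_add_distrib, Finset.sum_const, nsmul_eq_mul,
          div_mul_cancel₀ _ (by positivity)]
    _ ≤ (2 * N + 1) + ((N : ℝ) + 1) * 51200 := by
        rw [sum_gk_avSum]
        gcongr
        · exact sum_Pn_avOn_le _ _ _
        · exact_mod_cast hA
    _ ≤ _ := by linarith

/-- The total mass of `avSum A N` on `A`. -/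
def avMass (A : Finset V4) (N : ℕ) : ℝ := ∑ a ∈ A, avSum A N a

lemma avMass_nonneg (A : Finset V4) (N : ℕ) : 0 ≤ avMass A N :=
  Finset.sum_nonneg fun _ _ => avSum_nonneg _ _ _

/-- The difference set `A - σ[0, N]`. -/
def diffSet (A : Finset V4) (N : ℕ) (σ : List V4) : Finset V4 :=
  (A ×ˢ Finset.range (N + 1)).image fun q => q.1 - walk σ q.2

lemma mem_diffSet {A : Finset V4} {N : ℕ} {σ : List V4} {x : V4} :
    x ∈ diffSet A N σ ↔ ∃ j ≤ N, x + walk σ j ∈ A := by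
  simp only [diffSet, Finset.mem_image, Finset.mem_product, Finset.mem_range, Nat.lt_succ_iff]
  constructor
  · rintro ⟨⟨a, j⟩, ⟨ha, hj⟩, rfl⟩
    exact ⟨j, hj, by simpa using ha⟩
  · rintro ⟨j, hj, h⟩
    exact ⟨(x + walk σ j, j), ⟨h, hj⟩, by simp⟩

lemma card_diffSet_le (A : Finset V4) (N : ℕ) (σ : List V4) :
    ((diffSet A N σ).card : ℝ) ≤ ∑ a ∈ A, ∑ j ∈ Finset.range (N + 1),
      ind (∀ i, 1 ≤ i → i ≤ N - j → a + walk (σ.drop j) i ∉ A) := by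
  rw [← Finset.sum_product', sum_ind]
  refine Nat.cast_le.2 (Finset.card_le_card_of_surjOn (fun q => q.1 - walk σ q.2) ?_)
  intro x hx
  have hx' := mem_diffSet.1 (Finset.mem_coe.1 hx)
  let P : ℕ → Prop := fun j => x + walk σ j ∈ A
  obtain ⟨j₀, hj₀, hP⟩ := hx'
  have hspec := Nat.findGreatest_spec (P := P) hj₀ hP
  have hle := Nat.findGreatest_le (P := P) N
  set j := Nat.findGreatest P N with hj
  refine ⟨(x + walk σ j, j), ?_, by simp⟩
  simp only [Finset.coe_filter, Finset.mem_product, Finset.mem_range]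
  refine ⟨⟨hspec, by omega⟩, fun i h1 h2 hmem => ?_⟩
  rw [add_assoc, ← walk_add] at hmem
  exact Nat.findGreatest_is_greatest (P := P) (n := N) (k := j + i) (by omega) (by omega) hmem

lemma Es_card_diffSet_le (A : Finset V4) (N : ℕ) :
    Es N (fun σ => ((diffSet A N σ).card : ℝ)) ≤ avMass A N := by
  refine (Es_mono fun σ _ => card_diffSet_le A N σ).trans_eq ?_
  rw [Es_sum, avMass]
  refine Finset.sum_congr rfl fun a _ => ?_
  rw [Es_sum, avSum, ← Finset.sum_range_reflect]
  refine Finset.sum_congr rfl fun j hj => ?_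
  have := Finset.mem_range.1 hj
  rw [show N + 1 - 1 - j = N - j by omega, av,
    show N - (N - j) = j by omega]
  have h := Es_drop (show N - j ≤ N by omega) fun s =>
      ind (∀ i, 1 ≤ i → i ≤ j → a + walk s i ∉ (A : Set V4))
  rw [show N - (N - j) = j by omega] at h
  exact h

lemma exists_common_reach (A : Finset V4) (N : ℕ) : ∃ Λ : Finset V4, ∀ i ≤ N, ∀ a ∈ A,
    ∀ f : V4 → ℝ, Pn i f a = ∑ b ∈ Λ, pk i a b * f b := by
  choose L hL using exists_reach
  refine ⟨(Finset.range (N + 1)).biUnion fun i => A.biUnion fun a => L i a, fun i hi a ha f => ?_⟩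
  rw [sum_pk_mul]
  refine Es_congr fun s hs => ?_
  dsimp only
  rw [if_pos]
  exact Finset.mem_biUnion.2 ⟨i, by simp; omega, Finset.mem_biUnion.2 ⟨a, ha, hL i a s hs⟩⟩

/-- Duality bound: the mass `avSum A N` weighted by the time-`N` potential of a charge `m`
is at most `2N+1` times the total charge. -/
lemma sum_potential_avSum_le (A : Finset V4) (N : ℕ) {m : V4 → ℝ} (hm : ∀ y, 0 ≤ m y) {K : ℝ}
    (hK : ∀ Λ : Finset V4, ∑ y ∈ Λ, m y ≤ K) :
    ∑ a ∈ A, (∑ i ∈ Finset.range (N + 1), Pn i m a) * avSum A N a ≤ (2 * N + 1) * K := by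
  obtain ⟨Λ, hΛ⟩ := exists_common_reach A N
  calc _ = ∑ y ∈ Λ, m y * ∑ a ∈ A, gk (N + 1) y a * avSum A N a := by
        simp only [Finset.mul_sum]
        rw [Finset.sum_comm]
        refine Finset.sum_congr rfl fun a ha => ?_
        have : ∀ i ∈ Finset.range (N + 1), Pn i m a = ∑ b ∈ Λ, pk i a b * m b :=
          fun i hi => hΛ i (by have := Finset.mem_range.1 hi; omega) a ha m
        rw [Finset.sum_congr rfl this, Finset.sum_comm, Finset.sum_mul]
        refine Finset.sum_congr rfl fun y _ => ?_
        rw [← Finset.sum_mul, gk_symm, gk]; ring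
    _ ≤ ∑ y ∈ Λ, m y * (2 * N + 1) := by
        refine Finset.sum_le_sum fun y _ => mul_le_mul_of_nonneg_left ?_ (hm y)
        rw [sum_gk_avSum]; exact sum_Pn_avOn_le _ _ _
    _ ≤ _ := by
        rw [← Finset.sum_mul, mul_comm]
        exact mul_le_mul_of_nonneg_left (hK Λ) (by positivity)

/-! ### Capacity -/

lemma cap4_eq (A : Finset V4) : cap4 A = ∑ a ∈ A, 8 * escProb A a := by
  rw [cap4, tsum_fintype]
  exact Finset.sum_coe_sort A fun a => 8 * escProb (A : Set V4) a

/-- Dual lower bound for the capacity of a finite set. -/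
lemma le_cap4 {A : Finset V4} {f : V4 → ℝ} (hf : ∀ a ∈ A, 0 ≤ f a) {c : ℝ}
    (hG : ∀ M, ∀ y ∈ A, ∑ a ∈ A, gk M y a * f a ≤ c) :
    8 * ∑ a ∈ A, f a ≤ c * cap4 A := by
  set S := ∑ a ∈ A, f a with hS
  have hS0 : 0 ≤ S := Finset.sum_nonneg hf
  have key : ∀ m : ℕ, S ≤ c * ∑ a ∈ A, av A m a + 51200 * A.card * S * (1 / ((m : ℝ) + 1)) := by
    intro m
    have h1 : ∀ y ∈ A, f y ≤ (∑ a ∈ A, gk m y a * f y * av A m a) +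
        f y * (51200 * A.card * (1 / ((m : ℝ) + 1))) := fun y hy => by
      have h2 := hitP_eq_one (A := (A : Set V4)) (Finset.mem_coe.2 hy) (2 * m)
      rw [hitP, show 2 * m + 1 = m + (m + 1) by ring, Finset.sum_range_add] at h2
      have h3 : ∑ i ∈ Finset.range m, Pn i (avOn A (2 * m - i)) y ≤
          ∑ a ∈ A, gk m y a * av A m a := by
        simp only [sum_pk_avOn, gk, Finset.sum_mul]
        rw [Finset.sum_comm]
        refine Finset.sum_le_sum fun a _ => Finset.sum_le_sum fun i hi => ?_
        have := Finset.mem_range.1 hi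
        exact mul_le_mul_of_nonneg_left (av_antitone_time _ (by omega) a) (pk_nonneg _ _ _)
      have h4 : ∑ i ∈ Finset.range (m + 1), Pn (m + i) (avOn A (2 * m - (m + i))) y ≤
          51200 * A.card * (1 / ((m : ℝ) + 1)) := by
        simp only [sum_pk_avOn]
        rw [Finset.sum_comm]
        calc _ ≤ ∑ _a ∈ A, 51200 / ((m : ℝ) + 1) := by
              refine Finset.sum_le_sum fun a _ => le_trans (Finset.sum_le_sum fun i _ => ?_)
                (sum_pk_tail_le m (m + 1) y a)
              exact mul_le_of_le_one_right (pk_nonneg _ _ _) (av_le_one _ _ _)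
          _ = _ := by rw [Finset.sum_const, nsmul_eq_mul]; ring
      have h5 : (1 : ℝ) ≤ ∑ a ∈ A, gk m y a * av A m a + 51200 * A.card * (1 / ((m : ℝ) + 1)) := by
        linarith
      calc f y = f y * 1 := by ring
        _ ≤ f y * (∑ a ∈ A, gk m y a * av A m a + 51200 * A.card * (1 / ((m : ℝ) + 1))) :=
            mul_le_mul_of_nonneg_left h5 (hf y hy)
        _ = _ := by
            rw [mul_add, Finset.mul_sum]
            congr 1
            exact Finset.sum_congr rfl fun a _ => by ring
    calc S ≤ ∑ y ∈ A, ((∑ a ∈ A, gk m y a * f y * av A m a) +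
          f y * (51200 * A.card * (1 / ((m : ℝ) + 1)))) := Finset.sum_le_sum h1
      _ = ∑ a ∈ A, (∑ y ∈ A, gk m a y * f y) * av A m a +
          S * (51200 * A.card * (1 / ((m : ℝ) + 1))) := by
          rw [Finset.sum_add_distrib, ← Finset.sum_mul, Finset.sum_comm]
          congr 1
          refine Finset.sum_congr rfl fun a _ => ?_
          rw [Finset.sum_mul]
          exact Finset.sum_congr rfl fun y _ => by rw [gk_symm]
      _ ≤ ∑ a ∈ A, c * av A m a + S * (51200 * A.card * (1 / ((m : ℝ) + 1))) := by
          gcongr with a ha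
          · exact av_nonneg _ _ _
          · exact hG m a ha
      _ = _ := by rw [← Finset.mul_sum]; ring
  have hlim : Tendsto (fun m : ℕ => c * ∑ a ∈ A, av A m a +
      51200 * A.card * S * (1 / ((m : ℝ) + 1))) atTop
      (𝓝 (c * ∑ a ∈ A, escProb A a + 51200 * A.card * S * 0)) := by
    refine Tendsto.add (Tendsto.const_mul _ (tendsto_finsetSum _ fun a _ => tendsto_av _ a)) ?_
    exact Tendsto.const_mul _ tendsto_one_div_add_atTop_nhds_zero_nat
  have := ge_of_tendsto' hlim key
  rw [cap4_eq, ← Finset.mul_sum]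
  linarith

lemma sum_gk_escProb_le (A : Finset V4) (M : ℕ) (y : V4) :
    ∑ a ∈ A, gk M y a * escProb A a ≤ 1 := by
  rcases M with _ | M
  · simp [gk]
  refine le_trans ?_ (hitP_le_one (A : Set V4) M y)
  rw [hitP]
  simp only [sum_pk_avOn, gk, Finset.sum_mul]
  rw [Finset.sum_comm]
  exact Finset.sum_le_sum fun i _ => Finset.sum_le_sum fun a _ =>
    mul_le_mul_of_nonneg_left (escProb_le_av _ _ a) (pk_nonneg _ _ _)

lemma cap4_nonneg (A : Finset V4) : 0 ≤ cap4 A := by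
  rw [cap4_eq]; exact Finset.sum_nonneg fun a _ => mul_nonneg (by norm_num) (escProb_nonneg _ _)

lemma cap4_mono {A B : Finset V4} (h : A ⊆ B) : cap4 A ≤ cap4 B := by
  have h1 : ∀ M : ℕ, ∀ y, ∑ b ∈ B, gk M y b * (ind (b ∈ A) * escProb A b) =
      ∑ a ∈ A, gk M y a * escProb A a := fun M y => by
    rw [← Finset.sum_subset h fun b _ hb => by rw [ind_false hb]; ring]
    exact Finset.sum_congr rfl fun a ha => by rw [ind_true ha, one_mul]
  have h2 := le_cap4 (A := B) (f := fun b => ind (b ∈ A) * escProb A b) (c := 1)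
    (fun b _ => mul_nonneg (ind_nonneg _) (escProb_nonneg _ _))
    fun M y _ => (h1 M y).trans_le (sum_gk_escProb_le A M y)
  have h3 : ∑ b ∈ B, ind (b ∈ A) * escProb A b = ∑ a ∈ A, escProb A a := by
    rw [← Finset.sum_subset h fun b _ hb => by rw [ind_false hb]; ring]
    exact Finset.sum_congr rfl fun a ha => by rw [ind_true ha, one_mul]
  rw [h3, one_mul] at h2
  rwa [cap4_eq, ← Finset.mul_sum]

lemma cap4_singleton_ge (x : V4) : 8 / 51200 ≤ cap4 ((({x} : Finset V4)) : Set V4) := by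
  have h := le_cap4 (A := {x}) (f := fun _ => 1) (c := 51200) (fun _ _ => by norm_num) fun M y _ => by
    have := gk_le_add 0 M y x
    simpa [gk] using this
  simp only [Finset.sum_singleton] at h
  linarith

/-! ### The expected avoidance mass of a walk -/

lemma Es_window {n i w : ℕ} (h : i + w ≤ n) (F : List V4 → ℝ) :
    Es n (fun s => F ((s.drop i).take w)) = Es w F := by
  rw [Es_drop (show i ≤ n by omega) fun s => F (s.take w), Es_take (by omega)]

/-- The accumulated potential seen from time `i` over the next `w` steps. -/
def winPot (w : ℕ) (s : List V4) (i : ℕ) : ℝ := ∑ q ∈ Finset.range w, hs (walk (s.drop i) q)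

lemma Es_winPot_small {n i w : ℕ} (h : i + w ≤ n) (hw : 1 ≤ w) :
    Es n (fun s => ind (winPot w s i ≤ 1 / 4 * Real.log w)) ≤
      (4 + hsDecay) * (w : ℝ) ^ (-(1 / 4) : ℝ) := by
  refine le_trans (le_of_eq ?_) (Es_sum_hs_small w hw)
  rw [← Es_window h]
  congr 1; funext s
  have : ∑ q ∈ Finset.range w, hs (walk ((s.drop i).take w) q) = winPot w s i :=
    Finset.sum_congr rfl fun q hq => by rw [walk_take (Finset.mem_range.1 hq).le]
  rw [this]

lemma rpow_neg_quarter_le {x : ℝ} (hx : 1 < x) : x ^ (-(1 / 4) : ℝ) ≤ 4 / Real.log x := by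
  have hl := Real.log_pos hx
  have h := Real.log_le_rpow_div (x := x) (by linarith) (show (0 : ℝ) < 1 / 4 by norm_num)
  have hp : 0 < x ^ (1 / 4 : ℝ) := Real.rpow_pos_of_pos (by linarith) _
  rw [Real.rpow_neg (by linarith), inv_eq_one_div, div_le_div_iff₀ hp hl]
  linarith

/-- The points visited by the walk with step list `s` during `[0, n]`. -/
def trace (s : List V4) (n : ℕ) : Finset V4 := (Finset.range (n + 1)).image (walk s)

lemma mem_trace {s : List V4} {n : ℕ} {x : V4} : x ∈ trace s n ↔ ∃ i ≤ n, walk s i = x := by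
  simp [trace]

lemma sum_range_Pn_ks_translate (N : ℕ) (a z : V4) :
    ∑ i ∈ Finset.range (N + 1), Pn i (fun y => ks (y - z)) a =
      hs (a - z) - Pn (N + 1) hs (a - z) := by
  rw [← sum_Pn_ks]
  refine Finset.sum_congr rfl fun i _ => ?_
  simpa [sub_eq_add_neg] using Pn_translate i ks a (-z)

lemma sum_ks_translate_le (z : V4) (Λ : Finset V4) : ∑ y ∈ Λ, ks (y - z) ≤ ksMass := by
  rw [← Finset.sum_image (f := ks) (g := fun y => y - z) (s := Λ)
    (fun _ _ _ _ h => sub_left_injective h)]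
  exact sum_ks_le _

lemma avMass_trace_le {b w N : ℕ} {s : List V4} (hbN : b ≤ N) (hwb : w ≤ b)
    (hw : 8 * hsDecay ≤ Real.log w) (hw1 : 1 < w) :
    avMass (trace s b) N ≤ 8 / Real.log w * ((2 * N + 1) * ((b + w) * ksMass)) +
      (N + 1) * ∑ i ∈ Finset.range (b + 1), ind (winPot w s i ≤ 1 / 4 * Real.log w) := by
  set A := trace s b with hA
  have hl : 0 < Real.log w := Real.log_pos (by exact_mod_cast hw1)
  set m : V4 → ℝ := fun y => ∑ i ∈ Finset.range (b + w), ks (y - walk s i) with hm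
  have hm0 : ∀ y, 0 ≤ m y := fun y => Finset.sum_nonneg fun i _ => ks_nonneg _
  have hmK : ∀ Λ : Finset V4, ∑ y ∈ Λ, m y ≤ (b + w) * ksMass := fun Λ => by
    rw [hm, Finset.sum_comm]
    refine (Finset.sum_le_sum fun i _ => sum_ks_translate_le (walk s i) Λ).trans_eq ?_
    simp
  set pot : V4 → ℝ := fun a => ∑ i ∈ Finset.range (N + 1), Pn i m a with hpot
  have hpot0 : ∀ a, 0 ≤ pot a := fun a => Finset.sum_nonneg fun i _ => Pn_nonneg hm0 a
  have hdual := sum_potential_avSum_le A N hm0 hmK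
  have hgood : ∀ i ≤ b, 1 / 4 * Real.log w < winPot w s i → Real.log w / 8 ≤ pot (walk s i) := by
    intro i hi hg
    have h1 : pot (walk s i) = ∑ q ∈ Finset.range (b + w),
        (hs (walk s i - walk s q) - Pn (N + 1) hs (walk s i - walk s q)) := by
      simp only [hpot, hm, Pn_sum]
      rw [Finset.sum_comm]
      exact Finset.sum_congr rfl fun q _ => sum_range_Pn_ks_translate N _ _
    have h2 : ∑ q ∈ Finset.range w, (hs (walk s i - walk s (i + q)) -
        Pn (N + 1) hs (walk s i - walk s (i + q))) ≤ pot (walk s i) := by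
      rw [h1, ← Finset.sum_image (s := Finset.range w) (g := fun q => i + q)
        (f := fun q => hs (walk s i - walk s q) - Pn (N + 1) hs (walk s i - walk s q))
        (fun _ _ _ _ h => Nat.add_left_cancel h)]
      refine Finset.sum_le_sum_of_subset_of_nonneg ?_ fun q _ _ => ?_
      · intro q hq
        simp only [Finset.mem_image, Finset.mem_range] at hq ⊢
        omega
      · linarith [Pn_hs_le_hs (N + 1) (walk s i - walk s q)]
    have h3 : ∑ q ∈ Finset.range w, (hs (walk (s.drop i) q) - hsDecay / w) ≤
        ∑ q ∈ Finset.range w, (hs (walk s i - walk s (i + q)) -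
          Pn (N + 1) hs (walk s i - walk s (i + q))) := by
      refine Finset.sum_le_sum fun q _ => ?_
      have e : walk s i - walk s (i + q) = -walk (s.drop i) q := by rw [walk_add]; abel
      rw [e, hs_neg]
      have h4 := Pn_hs_le (N + 1) (-walk (s.drop i) q)
      have h5 : hsDecay / (((N + 1 : ℕ) : ℝ) + 1) ≤ hsDecay / w := by
        have := hsDecay_pos
        have : (w : ℝ) ≤ N := by exact_mod_cast hwb.trans hbN
        have : (0 : ℝ) < w := by exact_mod_cast (show 0 < w by omega)
        gcongr
        push_cast; linarith
      linarith
    rw [Finset.sum_sub_distrib, Finset.sum_const, Finset.card_range, nsmul_eq_mul,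
      mul_div_cancel₀ _ (by exact_mod_cast (show w ≠ 0 by omega))] at h3
    change winPot w s i - hsDecay ≤ _ at h3
    linarith
  have hpt : ∀ a ∈ A, avSum A N a ≤
      8 / Real.log w * (pot a * avSum A N a) + (N + 1) * ind (pot a < Real.log w / 8) := by
    intro a _
    have h0 := avSum_nonneg A N a
    by_cases hp : pot a < Real.log w / 8
    · rw [ind_true hp]
      have := avSum_le A N a
      have : 0 ≤ 8 / Real.log w * (pot a * avSum A N a) :=
        mul_nonneg (by positivity) (mul_nonneg (hpot0 a) h0)
      linarith
    · rw [ind_false hp, mul_zero, add_zero, ← mul_assoc]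
      refine le_mul_of_one_le_left h0 ?_
      rw [div_mul_eq_mul_div, le_div_iff₀ hl]
      linarith
  have hcard : ∑ a ∈ A, ind (pot a < Real.log w / 8) ≤
      ∑ i ∈ Finset.range (b + 1), ind (winPot w s i ≤ 1 / 4 * Real.log w) := by
    rw [sum_ind, sum_ind]
    refine Nat.cast_le.2 (Finset.card_le_card_of_surjOn (walk s) fun a ha => ?_)
    simp only [Finset.coe_filter, mem_ofPred_eq] at ha
    obtain ⟨i, hi, rfl⟩ := mem_trace.1 ha.1
    refine ⟨i, ?_, rfl⟩
    simp only [Finset.coe_filter, Finset.mem_range, mem_ofPred_eq]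
    refine ⟨by omega, ?_⟩
    by_contra hc
    linarith [hgood i hi (not_le.1 hc), ha.2]
  calc avMass A N ≤ ∑ a ∈ A, (8 / Real.log w * (pot a * avSum A N a) +
        (N + 1) * ind (pot a < Real.log w / 8)) := Finset.sum_le_sum hpt
    _ = 8 / Real.log w * ∑ a ∈ A, pot a * avSum A N a +
        (N + 1) * ∑ a ∈ A, ind (pot a < Real.log w / 8) := by
      rw [Finset.sum_add_distrib, Finset.mul_sum, Finset.mul_sum]
    _ ≤ _ := by
      gcongr

lemma log_sqrt_ge {b : ℕ} (hb : 16 ≤ b) : Real.log b / 4 ≤ Real.log (Nat.sqrt b) := by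
  have h4 : 4 ≤ Nat.sqrt b := Nat.le_sqrt.2 (by omega)
  have h1 : b ≤ Nat.sqrt b ^ 4 := by
    have := Nat.lt_succ_sqrt b
    have h3 : (Nat.sqrt b + 1) * (Nat.sqrt b + 1) ≤ Nat.sqrt b ^ 4 := by
      have : Nat.sqrt b + 1 ≤ Nat.sqrt b ^ 2 := by nlinarith
      calc _ ≤ Nat.sqrt b ^ 2 * Nat.sqrt b ^ 2 := Nat.mul_le_mul this this
        _ = _ := by ring
    exact (this.le).trans h3
  have h2 : Real.log b ≤ Real.log ((Nat.sqrt b : ℝ) ^ 4) :=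
    Real.log_le_log (by exact_mod_cast (show 0 < b by omega)) (by exact_mod_cast h1)
  rw [Real.log_pow] at h2
  push_cast at h2
  linarith

lemma tendsto_log_natCast : Tendsto (fun n : ℕ => Real.log n) atTop atTop :=
  Real.tendsto_log_atTop.comp tendsto_natCast_atTop_atTop

/-- The expected avoidance mass of a walk of length `b` is of order `b² / log b`. -/
lemma exists_Es_avMass_le : ∃ C : ℝ, 0 < C ∧ ∃ b₀ : ℕ, ∀ b ≥ b₀, ∀ N, b ≤ N → N ≤ 2 * b →
    Es b (fun s => avMass (trace s b) N) ≤ C * (b : ℝ) ^ 2 / Real.log b := by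
  obtain ⟨b₁, hb₁⟩ := eventually_atTop.1
    (tendsto_log_natCast.eventually_ge_atTop (32 * hsDecay))
  refine ⟨4 * (80 * ksMass + 24 * (4 + hsDecay)), by
    have := ksMass_pos; have := hsDecay_pos; positivity, max b₁ 16, fun b hb N h1 h2 => ?_⟩
  have hb16 : 16 ≤ b := le_trans (le_max_right _ _) hb
  have hlog := hb₁ b (le_trans (le_max_left _ _) hb)
  set w := Nat.sqrt b with hw
  have hwl := log_sqrt_ge hb16
  have hw1 : 1 < w := lt_of_lt_of_le (by norm_num) (Nat.le_sqrt.2 (show 4 * 4 ≤ b by omega))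
  have hwb : w ≤ b := Nat.sqrt_le_self b
  have hl : 0 < Real.log w := Real.log_pos (by exact_mod_cast hw1)
  have hK := ksMass_pos
  have hD := hsDecay_pos
  have e1 : Es b (fun s => avMass (trace s b) N) = Es (b + w) (fun s => avMass (trace s b) N) := by
    rw [← Es_take (Nat.le_add_right b w)]
    congr 1; funext s
    congr 1
    ext x
    simp only [mem_trace]
    exact exists_congr fun i => and_congr_right fun hi => by rw [walk_take hi]
  rw [e1]
  have e2 := Es_mono fun s (_ : IsSteps (b + w) s) =>
    avMass_trace_le (s := s) h1 hwb (by linarith) hw1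
  refine e2.trans ?_
  rw [Es_add, Es_const, Es_mul_left, Es_sum]
  have e3 : ∑ i ∈ Finset.range (b + 1),
      Es (b + w) (fun s => ind (winPot w s i ≤ 1 / 4 * Real.log w)) ≤
      (b + 1) * ((4 + hsDecay) * (4 / Real.log w)) := by
    calc _ ≤ ∑ _i ∈ Finset.range (b + 1), (4 + hsDecay) * (4 / Real.log w) := by
          refine Finset.sum_le_sum fun i hi => ?_
          refine (Es_winPot_small (by have := Finset.mem_range.1 hi; omega) hw1.le).trans ?_
          exact mul_le_mul_of_nonneg_left (rpow_neg_quarter_le (by exact_mod_cast hw1))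
            (by positivity)
      _ = _ := by simp
  have hN : (N : ℝ) ≤ 2 * b := by exact_mod_cast h2
  have hb1 : (16 : ℝ) ≤ b := by exact_mod_cast hb16
  have hwb' : (w : ℝ) ≤ b := by exact_mod_cast hwb
  have hlb : 0 < Real.log b := Real.log_pos (by linarith)
  calc 8 / Real.log w * ((2 * N + 1) * ((b + w) * ksMass)) + (N + 1) * ∑ i ∈ Finset.range (b + 1),
        Es (b + w) (fun s => ind (winPot w s i ≤ 1 / 4 * Real.log w))
      ≤ 8 / Real.log w * ((5 * b) * ((b + b) * ksMass)) +
        (3 * b) * ((2 * b) * ((4 + hsDecay) * (4 / Real.log w))) := by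
        have c0 : 0 ≤ (4 + hsDecay) * (4 / Real.log w) := by positivity
        refine add_le_add (mul_le_mul_of_nonneg_left ?_ (by positivity))
          ((mul_le_mul_of_nonneg_left (e3.trans ?_) (by positivity)).trans
            (mul_le_mul_of_nonneg_right ?_ (by positivity)))
        · gcongr
          linarith
        · exact mul_le_mul_of_nonneg_right (by linarith) c0
        · linarith
    _ = (80 * ksMass + 24 * (4 + hsDecay)) * (b : ℝ) ^ 2 / Real.log w := by ring
    _ ≤ (80 * ksMass + 24 * (4 + hsDecay)) * (b : ℝ) ^ 2 / (Real.log b / 4) := by gcongr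
    _ = _ := by field_simp

/-! ### Intersections of two well separated pieces of a walk -/

/-- The maximal inequality for nonnegative superharmonic functions. -/
lemma Es_exists_ge_le {f : V4 → ℝ} (hf : ∀ x, 0 ≤ f x) (hs : ∀ x, Pn 1 f x ≤ f x) {c : ℝ}
    (hc : 0 < c) (T : ℕ) (x : V4) :
    Es T (fun s => ind (∃ j ≤ T, c ≤ f (x + walk s j))) ≤ f x / c := by
  induction T generalizing x with
  | zero =>
    rw [Es_zero]
    by_cases h : c ≤ f x
    · exact (ind_le_one _).trans ((one_le_div hc).2 h)
    · rw [ind_false (by simpa [walk_zero] using h)]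
      exact div_nonneg (hf x) hc.le
  | succ T ih =>
    by_cases h : c ≤ f x
    · exact (Es_le_const fun _ _ => ind_le_one _).trans ((one_le_div hc).2 h)
    · rw [Es_succ]
      have e : ∀ d ∈ dirs, Es T (fun s => ind (∃ j ≤ T + 1, c ≤ f (x + walk (d :: s) j))) ≤
          f (x + d) / c := fun d _ => by
        refine le_trans (Es_mono fun s _ => ind_mono ?_) (ih (x + d))
        rintro ⟨j, hj, hcj⟩
        cases j with
        | zero => exact absurd (by simpa [walk_zero] using hcj) h
        | succ j => exact ⟨j, by omega, by rwa [walk_cons_succ, ← add_assoc] at hcj⟩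
      calc _ ≤ (∑ d ∈ dirs, f (x + d) / c) / 8 := by gcongr with d hd; exact e d hd
        _ = Pn 1 f x / c := by rw [Pn_one, ← Finset.sum_div]; ring
        _ ≤ _ := by gcongr; exact hs x

lemma winPot_append {m i : ℕ} {p : List V4} (q : List V4) (h : i + m ≤ p.length) :
    winPot m (p ++ q) i = winPot m p i := by
  refine Finset.sum_congr rfl fun k hk => ?_
  have hk := Finset.mem_range.1 hk
  rw [List.drop_append_of_le_length (by omega), walk_append_left _ (by simp; omega)]

lemma Es_winPot_small_return {n i j m : ℕ} (hm : 1 ≤ m) (hij : i + m ≤ j) (hj : j ≤ n) :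
    Es n (fun s => ind (winPot m s i ≤ 1 / 4 * Real.log m) * ind (walk s i = walk s j)) ≤
      (4 + hsDecay) * (m : ℝ) ^ (-(1 / 4) : ℝ) * (25600 / (((j - i - m : ℕ) : ℝ) + 1) ^ 2) := by
  set r := j - i - m with hr
  have e : Es n (fun s => ind (winPot m s i ≤ 1 / 4 * Real.log m) * ind (walk s i = walk s j)) =
      Es (m + r) (fun t => ind (winPot m t 0 ≤ 1 / 4 * Real.log m) * ind (t.sum = 0)) := by
    rw [← Es_window (i := i) (n := n) (w := m + r) (by omega)]
    congr 1; funext s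
    have e1 : winPot m ((s.drop i).take (m + r)) 0 = winPot m s i := by
      refine Finset.sum_congr rfl fun q hq => ?_
      rw [List.drop_zero, walk_take (by have := Finset.mem_range.1 hq; omega)]
    have e2 : walk s j = walk s i + ((s.drop i).take (m + r)).sum := by
      rw [show j = i + (m + r) by omega, walk_add]; rfl
    rw [e1, e2]
    congr 2
    rw [left_eq_add]
  rw [e, Es_append]
  calc _ ≤ Es m (fun p => ind (winPot m p 0 ≤ 1 / 4 * Real.log m) *
        (25600 / ((r : ℝ) + 1) ^ 2)) := by
        refine Es_mono fun p hp => ?_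
        calc _ = Es r (fun q => ind (winPot m p 0 ≤ 1 / 4 * Real.log m) *
              ind (p.sum + q.sum = 0)) := by
              congr 1; funext q
              rw [winPot_append q (by simp [hp.1]), List.sum_append]
          _ = ind (winPot m p 0 ≤ 1 / 4 * Real.log m) * pk r p.sum 0 := Es_mul_left _ _ _
          _ ≤ _ := mul_le_mul_of_nonneg_left (pk_le _ _ _) (ind_nonneg _)
    _ ≤ _ := by
        rw [Es_mul_right]
        have := Es_winPot_small (n := m) (i := 0) (by omega) hm
        gcongr

lemma sum_inv_le_log {a n : ℕ} (ha : 1 ≤ a) :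
    ∑ i ∈ Finset.range n, 1 / ((a : ℝ) + i + 1) ≤ Real.log ((a + n) / a) := by
  have ha0 : (0 : ℝ) < a := by exact_mod_cast ha
  induction n with
  | zero => simp [ha0.ne']
  | succ n ih =>
    rw [Finset.sum_range_succ]
    have h1 : (0 : ℝ) < a + n := by positivity
    have h2 : (0 : ℝ) < a + n + 1 := by positivity
    have h3 := Real.one_sub_inv_le_log_of_pos (show 0 < ((a : ℝ) + n + 1) / (a + n) by positivity)
    have h4 : 1 - (((a : ℝ) + n + 1) / (a + n))⁻¹ = 1 / (a + n + 1) := by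
      field_simp; ring
    have h5 : Real.log (((a : ℝ) + (n + 1 : ℕ)) / a) =
        Real.log ((a + n) / a) + Real.log ((a + n + 1) / (a + n)) := by
      rw [← Real.log_mul (by positivity) (by positivity)]
      congr 1; field_simp; push_cast; ring
    rw [h5]
    linarith

/-- The potential at `y` of the walk with steps `p` up to time `n`. -/
def walkPot (n : ℕ) (p : List V4) (y : V4) : ℝ := ∑ i ∈ Finset.range n, hs (y - walk p i)

lemma walkPot_nonneg (n : ℕ) (p : List V4) (y : V4) : 0 ≤ walkPot n p y :=
  Finset.sum_nonneg fun _ _ => hs_nonneg _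

lemma Pn_walkPot_le (n : ℕ) (p : List V4) (y : V4) : Pn 1 (walkPot n p) y ≤ walkPot n p y := by
  unfold walkPot
  rw [Pn_sum]
  refine Finset.sum_le_sum fun i _ => ?_
  have := Pn_translate 1 hs y (-walk p i)
  simp only [← sub_eq_add_neg] at this
  rw [this]
  exact Pn_hs_le_hs _ _

lemma Es_walkPot_le {m u : ℕ} (hm : 1 ≤ m) :
    Es (u + 2 * m) (fun p => walkPot (u + m) p p.sum) ≤
      hsDecay * Real.log ((u + 2 * m) / m) := by
  have hD := hsDecay_pos
  simp only [walkPot]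
  rw [Es_sum]
  calc _ ≤ ∑ i ∈ Finset.range (u + m), hsDecay / (((u + 2 * m - i : ℕ) : ℝ) + 1) := by
        refine Finset.sum_le_sum fun i hi => ?_
        have hi := Finset.mem_range.1 hi
        have e : (fun p : List V4 => hs (p.sum - walk p i)) = fun p => hs (0 + (p.drop i).sum) := by
          funext p
          rw [sum_take_append p i]; congr 1; abel
        rw [e, Es_drop (by omega) fun t : List V4 => hs (0 + t.sum)]
        exact Pn_hs_le _ _
    _ = ∑ i ∈ Finset.range (u + m), hsDecay * (1 / ((m : ℝ) + i + 1 + 1)) := by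
        rw [← Finset.sum_range_reflect]
        refine Finset.sum_congr rfl fun i hi => ?_
        have hi := Finset.mem_range.1 hi
        rw [show u + 2 * m - (u + m - 1 - i) = m + i + 1 by omega]
        push_cast; ring
    _ ≤ ∑ i ∈ Finset.range (u + m), hsDecay * (1 / ((m : ℝ) + i + 1)) := by
        refine Finset.sum_le_sum fun i _ => mul_le_mul_of_nonneg_left
          (one_div_le_one_div_of_le (by positivity) (by linarith)) hD.le
    _ ≤ _ := by
        rw [← Finset.mul_sum]
        refine mul_le_mul_of_nonneg_left ((sum_inv_le_log hm).trans_eq ?_) hD.le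
        congr 2; push_cast; ring

lemma winPot_le_walkPot {m u i : ℕ} (p : List V4) (hi : i ≤ u) :
    winPot m p i ≤ walkPot (u + m) p (walk p i) := by
  have : winPot m p i = ∑ q ∈ (Finset.range m).image (fun q => i + q),
      hs (walk p i - walk p q) := by
    rw [Finset.sum_image fun _ _ _ _ h => Nat.add_left_cancel h]
    refine Finset.sum_congr rfl fun q _ => ?_
    rw [walk_add, ← hs_neg]; congr 1; abel
  rw [this]
  refine Finset.sum_le_sum_of_subset_of_nonneg ?_ fun q _ _ => hs_nonneg _
  intro q hq
  simp only [Finset.mem_image, Finset.mem_range] at hq ⊢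
  omega

lemma Es_cross_le {m : ℕ} (hm : 2 ≤ m) (u T : ℕ) :
    Es (u + 2 * m + T) (fun s => ind (∃ i ≤ u, ∃ j ≤ T, walk s i = walk s (u + 2 * m + j))) ≤
      4 * hsDecay * Real.log ((u + 2 * m) / m) / Real.log m +
        (u + 1) * ((4 + hsDecay) * (m : ℝ) ^ (-(1 / 4) : ℝ) * (51200 / (m + 1))) := by
  have hl : 0 < Real.log m := Real.log_pos (by exact_mod_cast (show 1 < m by omega))
  have hD := hsDecay_pos
  have h0 : 0 ≤ (4 + hsDecay) * (m : ℝ) ^ (-(1 / 4) : ℝ) := by positivity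
  set c := 1 / 4 * Real.log m with hc
  have hc0 : 0 < c := by positivity
  have hdom : ∀ s : List V4, ind (∃ i ≤ u, ∃ j ≤ T, walk s i = walk s (u + 2 * m + j)) ≤
      ind (∃ j ≤ T, c ≤ walkPot (u + m) s (walk s (u + 2 * m + j))) +
      ∑ i ∈ Finset.range (u + 1), ∑ j ∈ Finset.range (T + 1),
        ind (winPot m s i ≤ c) * ind (walk s i = walk s (u + 2 * m + j)) := by
    intro s
    have hn : 0 ≤ ∑ i ∈ Finset.range (u + 1), ∑ j ∈ Finset.range (T + 1),
        ind (winPot m s i ≤ c) * ind (walk s i = walk s (u + 2 * m + j)) :=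
      Finset.sum_nonneg fun i _ => Finset.sum_nonneg fun j _ =>
        mul_nonneg (ind_nonneg _) (ind_nonneg _)
    by_cases h : ∃ i ≤ u, ∃ j ≤ T, walk s i = walk s (u + 2 * m + j)
    · obtain ⟨i, hi, j, hj, hij⟩ := id h
      by_cases hw : winPot m s i ≤ c
      · have h1 : 1 ≤ ∑ i ∈ Finset.range (u + 1), ∑ j ∈ Finset.range (T + 1),
            ind (winPot m s i ≤ c) * ind (walk s i = walk s (u + 2 * m + j)) := by
          refine le_trans ?_ (Finset.single_le_sum (fun i _ => Finset.sum_nonneg fun j _ =>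
            mul_nonneg (ind_nonneg _) (ind_nonneg _)) (Finset.mem_range.2 (Nat.lt_succ_of_le hi)))
          refine le_trans ?_ (Finset.single_le_sum (fun j _ =>
            mul_nonneg (ind_nonneg _) (ind_nonneg _)) (Finset.mem_range.2 (Nat.lt_succ_of_le hj)))
          rw [ind_true hw, ind_true hij, one_mul]
        linarith [ind_le_one (∃ i ≤ u, ∃ j ≤ T, walk s i = walk s (u + 2 * m + j)),
          ind_nonneg (∃ j ≤ T, c ≤ walkPot (u + m) s (walk s (u + 2 * m + j)))]
      · have h1 : ∃ j ≤ T, c ≤ walkPot (u + m) s (walk s (u + 2 * m + j)) :=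
          ⟨j, hj, (not_le.1 hw).le.trans (hij ▸ winPot_le_walkPot s hi)⟩
        rw [ind_true h, ind_true h1]
        linarith
    · rw [ind_false h]
      linarith [ind_nonneg (∃ j ≤ T, c ≤ walkPot (u + m) s (walk s (u + 2 * m + j)))]
  refine (Es_mono fun s _ => hdom s).trans ?_
  rw [Es_add]
  refine add_le_add ?_ ?_
  · rw [Es_append]
    calc _ ≤ Es (u + 2 * m) (fun p => walkPot (u + m) p p.sum / c) := by
          refine Es_mono fun p hp => le_trans (le_of_eq ?_) (Es_exists_ge_le
            (walkPot_nonneg (u + m) p) (Pn_walkPot_le (u + m) p) hc0 T p.sum)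
          congr 1; funext q
          have e1 : walkPot (u + m) (p ++ q) = walkPot (u + m) p := by
            funext y
            refine Finset.sum_congr rfl fun i hi => ?_
            rw [walk_append_left q (by have := Finset.mem_range.1 hi; have := hp.1; omega)]
          have e2 : ∀ j, walk (p ++ q) (u + 2 * m + j) = p.sum + walk q j := fun j => by
            rw [← hp.1, walk_append_right]
          simp only [e1, e2]
      _ ≤ hsDecay * Real.log ((u + 2 * m) / m) / c := by
          rw [Es_div]
          gcongr
          exact Es_walkPot_le (by omega)
      _ = _ := by rw [hc]; field_simp
  · rw [Es_sum]
    calc _ ≤ ∑ i ∈ Finset.range (u + 1),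
          (4 + hsDecay) * (m : ℝ) ^ (-(1 / 4) : ℝ) * (51200 / (m + 1)) := by
          refine Finset.sum_le_sum fun i hi => ?_
          have hi := Finset.mem_range.1 hi
          rw [Es_sum]
          calc _ ≤ ∑ j ∈ Finset.range (T + 1), (4 + hsDecay) * (m : ℝ) ^ (-(1 / 4) : ℝ) *
                25600 * (1 / ((m : ℝ) + j + 1) ^ 2) := by
                refine Finset.sum_le_sum fun j hj => ?_
                have hj := Finset.mem_range.1 hj
                refine (Es_winPot_small_return (by omega) (by omega) (by omega)).trans ?_
                rw [mul_assoc _ (25600 : ℝ), mul_one_div]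
                refine mul_le_mul_of_nonneg_left ?_ h0
                have : (m : ℝ) + j ≤ ((u + 2 * m + j - i - m : ℕ) : ℝ) := by
                  exact_mod_cast (by omega : m + j ≤ u + 2 * m + j - i - m)
                gcongr
            _ ≤ (4 + hsDecay) * (m : ℝ) ^ (-(1 / 4) : ℝ) * 25600 * (2 / (m + 1)) := by
                rw [← Finset.mul_sum]
                exact mul_le_mul_of_nonneg_left (sum_inv_sq_le _ _) (by positivity)
            _ = _ := by ring
      _ = _ := by simp

/-- Two pieces of a walk of lengths at most `m * R` separated by a gap `2 * m` intersect with
probability of order `(1 + log R) / log m`. -/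
lemma exists_Es_cross_le : ∃ C : ℝ, 0 < C ∧ ∀ m : ℕ, 2 ≤ m → ∀ R : ℝ, 1 ≤ R →
    R ≤ (m : ℝ) ^ (1 / 8 : ℝ) → ∀ u : ℕ, (u : ℝ) ≤ m * R → ∀ T : ℕ,
    Es (u + 2 * m + T) (fun s => ind (∃ i ≤ u, ∃ j ≤ T, walk s i = walk s (u + 2 * m + j))) ≤
      C * (1 + Real.log R) / Real.log m := by
  have hD := hsDecay_pos
  refine ⟨8 * hsDecay + (4 + hsDecay) * 51200 * 8, by positivity, fun m hm R hR hRm u hu T => ?_⟩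
  refine (Es_cross_le hm u T).trans ?_
  have hm1 : (1 : ℝ) < m := by exact_mod_cast (show 1 < m by omega)
  have hl : 0 < Real.log m := Real.log_pos hm1
  have hlR : 0 ≤ Real.log R := Real.log_nonneg hR
  have h3 : Real.log ((u + 2 * m) / m) ≤ 2 * (1 + Real.log R) := by
    have : ((u : ℝ) + 2 * m) / m ≤ 3 * R := by
      rw [div_le_iff₀ (by linarith)]; nlinarith
    calc _ ≤ Real.log (3 * R) := Real.log_le_log (by positivity) this
      _ = Real.log 3 + Real.log R := Real.log_mul (by norm_num) (by linarith)
      _ ≤ _ := by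
        have : Real.log 3 ≤ 2 := by
          have := Real.log_le_sub_one_of_pos (show (0:ℝ) < 3 by norm_num); linarith
        linarith
  have h4 : (m : ℝ) ^ (-(1 / 4) : ℝ) * R ≤ 8 / Real.log m := by
    have hp : 0 < (m : ℝ) ^ (1 / 8 : ℝ) := by positivity
    have h5 := Real.log_le_rpow_div (x := m) (by linarith) (show (0 : ℝ) < 1 / 8 by norm_num)
    calc (m : ℝ) ^ (-(1 / 4) : ℝ) * R ≤ (m : ℝ) ^ (-(1 / 4) : ℝ) * (m : ℝ) ^ (1 / 8 : ℝ) := by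
          gcongr
      _ = ((m : ℝ) ^ (1 / 8 : ℝ))⁻¹ := by
          rw [← Real.rpow_add (by linarith), ← Real.rpow_neg (by linarith)]; norm_num
      _ ≤ _ := by
          rw [inv_eq_one_div, div_le_div_iff₀ hp hl]
          linarith
  have h6 : ((u : ℝ) + 1) / (m + 1) ≤ R := by
    rw [div_le_iff₀ (by linarith)]; nlinarith
  calc _ = 4 * hsDecay * Real.log ((u + 2 * m) / m) / Real.log m +
        (4 + hsDecay) * 51200 * ((m : ℝ) ^ (-(1 / 4) : ℝ) * (((u : ℝ) + 1) / (m + 1))) := by ring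
    _ ≤ 4 * hsDecay * (2 * (1 + Real.log R)) / Real.log m +
        (4 + hsDecay) * 51200 * (8 / Real.log m) := by
        have h7 : (m : ℝ) ^ (-(1 / 4) : ℝ) * (((u : ℝ) + 1) / (m + 1)) ≤ 8 / Real.log m :=
          le_trans (by gcongr) h4
        gcongr
    _ ≤ _ := by
        rw [← mul_div_assoc, ← add_div]
        gcongr
        nlinarith [mul_nonneg hD.le hlR]

/-! ### Chronological loop erasure -/

/-- The loop erasure of the path `f` run up to time `k`, as a list. -/
def lew (f : ℕ → V4) : ℕ → List V4
  | 0 => [f 0]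
  | k + 1 => (lew f k).takeWhile (· ≠ f (k + 1)) ++ [f (k + 1)]

lemma mem_lew_self (f : ℕ → V4) (k : ℕ) : f k ∈ lew f k := by
  cases k <;> simp [lew]

lemma exists_of_mem_lew {f : ℕ → V4} {k : ℕ} {v : V4} (h : v ∈ lew f k) : ∃ i ≤ k, f i = v := by
  induction k with
  | zero => exact ⟨0, le_rfl, by simpa [lew, eq_comm] using h⟩
  | succ k ih =>
    rw [lew, List.mem_append, List.mem_singleton] at h
    rcases h with h | h
    · obtain ⟨i, hi, hv⟩ := ih ((List.takeWhile_prefix _).subset h)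
      exact ⟨i, by omega, hv⟩
    · exact ⟨k + 1, le_rfl, h.symm⟩

lemma lew_congr {f g : ℕ → V4} {k : ℕ} (h : ∀ i ≤ k, f i = g i) : lew f k = lew g k := by
  induction k with
  | zero => simp [lew, h 0 le_rfl]
  | succ k ih => rw [lew, lew, ih fun i hi => h i (by omega), h (k + 1) le_rfl]

lemma prefix_takeWhile {l L : List V4} {x : V4} (h : l <+: L) (hx : x ∉ l) :
    l <+: L.takeWhile (· ≠ x) := by
  obtain ⟨t, rfl⟩ := h
  rw [List.takeWhile_append_of_pos fun y hy => by
    simpa using fun e : y = x => hx (e ▸ hy)]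
  exact List.prefix_append _ _

lemma prefix_lew {f : ℕ → V4} {l : List V4} {k T : ℕ} (hkT : k ≤ T) (h : l <+: lew f k)
    (hl : ∀ r, k < r → r ≤ T → f r ∉ l) : l <+: lew f T := by
  induction T, hkT using Nat.le_induction with
  | base => exact h
  | succ T hT ih =>
    exact (prefix_takeWhile (ih fun r h1 h2 => hl r h1 (by omega))
      (hl (T + 1) (by omega) le_rfl)).trans (List.prefix_append _ _)

lemma prefix_concat_lew {f : ℕ → V4} {l : List V4} {v : V4} {k T : ℕ} (hkT : k ≤ T)
    (h : l ++ [v] <+: lew f k) (hl : ∀ r, k < r → r ≤ T → f r ∉ l) :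
    l ++ [v] <+: lew f T := by
  induction T, hkT using Nat.le_induction with
  | base => exact h
  | succ T hT ih =>
    have ih := ih fun r h1 h2 => hl r h1 (by omega)
    have hx := hl (T + 1) (by omega) le_rfl
    by_cases hv : f (T + 1) = v
    · obtain ⟨t, ht⟩ := ih
      rw [lew, ← ht, List.append_assoc, List.takeWhile_append_of_pos fun y hy => by
        simpa using fun e : y = f (T + 1) => hx (e ▸ hy)]
      simp [hv]
    · exact (prefix_takeWhile ih (by simp [hx, hv])).trans (List.prefix_append _ _)

/-! ### Two-sided avoidance -/

lemma Es_two_sided (A : Set V4) (x : V4) (j m : ℕ) :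
    Es (j + m) (fun σ => ind (∀ i ≤ j + m, i ≠ j → x + (walk σ i - walk σ j) ∉ A)) =
      av A j x * av A m x := by
  rw [Es_append]
  have e : ∀ p, IsSteps j p → ∀ q, IsSteps m q →
      ind (∀ i ≤ j + m, i ≠ j → x + (walk (p ++ q) i - walk (p ++ q) j) ∉ A) =
      ind (∀ i, 1 ≤ i → i ≤ j → x + walk (p.reverse.map fun d => -d) i ∉ A) *
        ind (∀ i, 1 ≤ i → i ≤ m → x + walk q i ∉ A) := by
    intro p hp q hq
    have e1 : ∀ i ≤ j, walk (p ++ q) i - walk (p ++ q) j =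
        walk (p.reverse.map fun d => -d) (j - i) := fun i hi => by
      rw [walk_append_left q (by rw [hp.1]; exact hi), walk_append_left q (by rw [hp.1]),
        walk_map_neg, walk_reverse hp.1, show j - (j - i) = i by omega, ← hp.1, walk_length]
      abel
    have e2 : ∀ i, walk (p ++ q) (j + i) - walk (p ++ q) j = walk q i := fun i => by
      have := walk_append_right p q 0
      rw [← hp.1, walk_append_right]
      rw [add_zero, walk_zero] at this
      rw [this]; abel
    rw [← ind_and]
    refine ind_congr ⟨fun h => ⟨fun i h1 h2 => ?_, fun i h1 h2 => ?_⟩, fun h i hi hij => ?_⟩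
    · have := h (j - i) (by omega) (by omega)
      rwa [e1 _ (by omega), show j - (j - i) = i by omega] at this
    · have := h (j + i) (by omega) (by omega)
      rwa [e2] at this
    · rcases Nat.lt_or_gt_of_ne hij with hlt | hgt
      · rw [e1 i hlt.le]; exact h.1 _ (by omega) (by omega)
      · obtain ⟨r, rfl⟩ := Nat.exists_eq_add_of_le hgt.le
        rw [e2]; exact h.2 _ (by omega) (by omega)
  calc _ = Es j (fun p => ind (∀ i, 1 ≤ i → i ≤ j →
        x + walk (p.reverse.map fun d => -d) i ∉ A) * av A m x) := by
        refine Es_congr fun p hp => ?_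
        rw [av, ← Es_mul_left]
        exact Es_congr fun q hq => e p hp q hq
    _ = _ := by
        rw [Es_mul_right, av]
        congr 1
        rw [Es_reverse j fun p => ind (∀ i, 1 ≤ i → i ≤ j → x + walk (p.map fun d => -d) i ∉ A),
          Es_map_neg j fun p => ind (∀ i, 1 ≤ i → i ≤ j → x + walk p i ∉ A)]
        rfl

/-! ### Survivors of the loop erasure -/

/-- The path `f` avoids its loop erasure at time `k` during `(k, t]`. -/
def Survives (f : ℕ → V4) (k t : ℕ) : Prop := ∀ r, k < r → r ≤ t → f r ∉ lew f k

lemma Survives.isPrefix {f : ℕ → V4} {k t : ℕ} (h : Survives f k t) (hkt : k ≤ t) :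
    lew f k <+: lew f t := prefix_lew hkt List.prefix_rfl h

lemma Survives.mono {f : ℕ → V4} {k t t' : ℕ} (h : Survives f k t) (ht : t' ≤ t) :
    Survives f k t' := fun r h1 h2 => h r h1 (h2.trans ht)

/-- A time `k` surviving until `t`, together with an increment of an independent walk with steps
`σ` from its position which avoids the loop erasure at time `k`. -/
def SurvPair (f : ℕ → V4) (σ : List V4) (t N k j : ℕ) : Prop :=
  Survives f k t ∧ ∀ i ≤ N, i ≠ j → f k + (walk σ i - walk σ j) ∉ lew f k

lemma SurvPair.injective {f : ℕ → V4} {σ : List V4} {t N k k' j j' : ℕ} (hk : k ≤ t)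
    (hk' : k' ≤ t) (hj : j ≤ N) (hj' : j' ≤ N) (h : SurvPair f σ t N k j)
    (h' : SurvPair f σ t N k' j') (e : f k - walk σ j = f k' - walk σ j') : k = k' ∧ j = j' := by
  wlog hkk : k ≤ k' generalizing k k' j j'
  · obtain ⟨h1, h2⟩ := this hk' hk hj' hj h' h e.symm (by omega)
    exact ⟨h1.symm, h2.symm⟩
  rcases hkk.eq_or_lt with rfl | hlt
  · refine ⟨rfl, by_contra fun hjj => h.2 j' hj' (Ne.symm hjj) ?_⟩
    rw [← sub_right_injective e, sub_self, add_zero]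
    exact mem_lew_self f k
  · exfalso
    by_cases hjj : j = j'
    · subst hjj
      exact h.1 k' hlt hk' (sub_left_injective e ▸ mem_lew_self f k)
    · refine h'.2 j hj hjj ?_
      have : f k' + (walk σ j - walk σ j') = f k := by
        have := congrArg (· + walk σ j) e
        simp only [sub_add_cancel] at this
        rw [this]; abel
      rw [this]
      exact ((h.1.mono hk').isPrefix hkk).subset (mem_lew_self f k)

lemma sum_survPair_le (f : ℕ → V4) (σ : List V4) (N s b : ℕ) {A : Finset V4} (x : V4)
    (hA : ∀ k ≤ b, f (s + k) - x ∈ A) :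
    ∑ k ∈ Finset.range b, ∑ j ∈ Finset.range (N + 1),
      ind (SurvPair f σ (s + b) N (s + k) j) ≤ (diffSet A N σ).card := by
  rw [← Finset.sum_product', sum_ind (Finset.range b ×ˢ Finset.range (N + 1))
    fun q => SurvPair f σ (s + b) N (s + q.1) q.2]
  refine Nat.cast_le.2 (Finset.card_le_card_of_injOn (fun q => f (s + q.1) - x - walk σ q.2) ?_ ?_)
  · intro q hq
    simp only [Finset.coe_filter, Finset.mem_product, Finset.mem_range, mem_ofPred_eq] at hq
    exact mem_diffSet.2 ⟨q.2, by omega, by simpa using hA q.1 (by omega)⟩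
  · intro q hq q' hq' e
    simp only [Finset.coe_filter, Finset.mem_product, Finset.mem_range, mem_ofPred_eq] at hq hq'
    have e' : f (s + q.1) - walk σ q.2 = f (s + q'.1) - walk σ q'.2 := by
      dsimp only at e
      rw [sub_right_comm, sub_right_comm (f (s + q'.1))] at e
      exact sub_left_injective e
    have := SurvPair.injective (by omega) (by omega) (by omega) (by omega) hq.2 hq'.2 e'
    exact Prod.ext (by omega) this.2

/-- The set of vertices of the loop erasure of the whole walk with steps `u`. -/
def lewSet (u : List V4) : Set V4 := {v | v ∈ lew (walk u) u.length}

lemma lew_append (u q : List V4) {k : ℕ} (hk : k ≤ u.length) :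
    lew (walk (u ++ q)) k = lew (walk u) k :=
  lew_congr fun _ hi => walk_append_left q (hi.trans hk)

lemma survives_append {u q : List V4} {m : ℕ} :
    Survives (walk (u ++ q)) u.length (u.length + m) ↔
      ∀ i, 1 ≤ i → i ≤ m → u.sum + walk q i ∉ lewSet u := by
  constructor
  · intro h i _ h2
    have := h (u.length + i) (by omega) (by omega)
    rwa [lew_append u q le_rfl, walk_append_right] at this
  · intro h r h1 h2
    obtain ⟨i, rfl⟩ := Nat.exists_eq_add_of_le h1.le
    rw [lew_append u q le_rfl, walk_append_right]
    exact h i (by omega) (by omega)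

lemma Es_survives (u : List V4) (m : ℕ) :
    Es m (fun q => ind (Survives (walk (u ++ q)) u.length (u.length + m))) =
      av (lewSet u) m u.sum := by
  simp only [survives_append]; rfl

lemma Es_survPair (u : List V4) (m N : ℕ) {j : ℕ} (hj : j ≤ N) (hm : m ≤ N) :
    av (lewSet u) N u.sum ^ 3 ≤ Es m (fun q => Es N fun σ =>
      ind (SurvPair (walk (u ++ q)) σ (u.length + m) N u.length j)) := by
  set Y := av (lewSet u) N u.sum with hY
  have h0 : 0 ≤ Y := av_nonneg _ _ _
  obtain ⟨r, rfl⟩ := Nat.exists_eq_add_of_le hj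
  have e : ∀ q, Es (j + r) (fun σ =>
      ind (SurvPair (walk (u ++ q)) σ (u.length + m) (j + r) u.length j)) =
      ind (Survives (walk (u ++ q)) u.length (u.length + m)) *
        (av (lewSet u) j u.sum * av (lewSet u) r u.sum) := fun q => by
    rw [← Es_two_sided, ← Es_mul_left]
    congr 1; funext σ
    rw [SurvPair, ind_and, lew_append u q le_rfl, walk_append_left q le_rfl, walk_length]
    rfl
  simp only [e]
  rw [Es_mul_right, Es_survives]
  have h1 : Y ≤ av (lewSet u) j u.sum := av_antitone_time _ (by omega) _
  have h2 : Y ≤ av (lewSet u) r u.sum := av_antitone_time _ (by omega) _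
  have h3 : Y ≤ av (lewSet u) m u.sum := av_antitone_time _ hm _
  calc Y ^ 3 = Y * (Y * Y) := by ring
    _ ≤ _ := mul_le_mul h3 (mul_le_mul h1 h2 h0 (h0.trans h1)) (mul_nonneg h0 h0) (h0.trans h3)

/-- Third moments of the survival probabilities along a block are controlled by the avoidance
mass of the block. -/
lemma sum_Es_av_cube_le (p : List V4) (b : ℕ) :
    (b + 1) * ∑ k ∈ Finset.range b, Es k (fun q => av (lewSet (p ++ q)) b (p ++ q).sum ^ 3) ≤
      Es b (fun q => avMass (trace q b) b) := by
  calc _ = ∑ k ∈ Finset.range b, ∑ _j ∈ Finset.range (b + 1),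
        Es k (fun q => av (lewSet (p ++ q)) b (p ++ q).sum ^ 3) := by
        rw [Finset.mul_sum]; simp
    _ ≤ ∑ k ∈ Finset.range b, ∑ j ∈ Finset.range (b + 1), Es b (fun q => Es b fun σ =>
        ind (SurvPair (walk (p ++ q)) σ (p.length + b) b (p.length + k) j)) := by
        refine Finset.sum_le_sum fun k hk => Finset.sum_le_sum fun j hj => ?_
        have hk := Finset.mem_range.1 hk
        have hj := Finset.mem_range.1 hj
        obtain ⟨m, hm⟩ := Nat.exists_eq_add_of_le hk.le
        have e := Es_append k m fun q => Es b fun σ =>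
          ind (SurvPair (walk (p ++ q)) σ (p.length + b) b (p.length + k) j)
        rw [← hm] at e
        rw [e]
        refine Es_mono fun q hq => (Es_survPair (p ++ q) m b (j := j) (by omega) (by omega)).trans_eq ?_
        simp only [List.append_assoc, List.length_append, hq.1, hm, add_assoc]
    _ = Es b (fun q => Es b fun σ => ∑ k ∈ Finset.range b, ∑ j ∈ Finset.range (b + 1),
        ind (SurvPair (walk (p ++ q)) σ (p.length + b) b (p.length + k) j)) := by
        simp only [Es_sum]
    _ ≤ _ := by
        refine Es_mono fun q _ => (Es_mono fun σ _ => ?_).trans (Es_card_diffSet_le (trace q b) b)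
        refine sum_survPair_le _ σ b p.length b p.sum fun k hk => ?_
        rw [walk_append_right, add_sub_cancel_left]
        exact mem_trace.2 ⟨k, hk, rfl⟩

/-- The proportion of times in the block `[s, s + b)` surviving for `b` steps. -/
def survFrac (b : ℕ) (f : ℕ → V4) (s : ℕ) : ℝ :=
  (∑ k ∈ Finset.range b, ind (Survives f (s + k) (s + k + b))) / b

lemma survFrac_nonneg (b : ℕ) (f : ℕ → V4) (s : ℕ) : 0 ≤ survFrac b f s :=
  div_nonneg (Finset.sum_nonneg fun _ _ => ind_nonneg _) (Nat.cast_nonneg _)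

lemma survFrac_le_one (b : ℕ) (f : ℕ → V4) (s : ℕ) : survFrac b f s ≤ 1 := by
  refine div_le_one_of_le₀ ?_ (Nat.cast_nonneg _)
  exact (Finset.sum_le_sum fun _ _ => ind_le_one _).trans_eq (by simp)

lemma Es_survFrac_eq (p : List V4) (b : ℕ) :
    Es (2 * b) (fun q => survFrac b (walk (p ++ q)) p.length) =
      (∑ k ∈ Finset.range b, Es k (fun q => av (lewSet (p ++ q)) b (p ++ q).sum)) / b := by
  simp only [survFrac]
  rw [Es_div, Es_sum]
  congr 1
  refine Finset.sum_congr rfl fun k hk => ?_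
  have hk := Finset.mem_range.1 hk
  obtain ⟨m, hm⟩ : ∃ m, 2 * b = k + (b + m) := ⟨b - k, by omega⟩
  rw [hm, Es_append]
  refine Es_congr fun q hq => ?_
  rw [← Es_survives, ← Es_take (show b ≤ b + m by omega)]
  congr 1; funext q'
  rw [← List.append_assoc, show p.length + k = (p ++ q).length by simp [hq.1]]
  rw [survives_append, survives_append]
  refine ind_congr (forall_congr' fun i => forall_congr' fun _ => forall_congr' fun hi => ?_)
  rw [walk_take hi]

lemma le_add_cube {y α : ℝ} (hy : 0 ≤ y) (hα : 0 < α) : y ≤ α + y ^ 3 / α ^ 2 := by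
  rcases le_total y α with h | h
  · have : 0 ≤ y ^ 3 / α ^ 2 := by positivity
    linarith
  · have : y ≤ y ^ 3 / α ^ 2 := by
      rw [le_div_iff₀ (by positivity)]
      nlinarith [mul_le_mul h h hα.le hy, mul_nonneg hy hy]
    linarith

/-- Uniformly over the past, the expected proportion of surviving times in a block of length `b`
is at most of order `(log b)^{-1/3}`. -/
lemma exists_Es_survFrac_le : ∃ C : ℝ, 1 ≤ C ∧ ∃ b₀ : ℕ, ∀ b ≥ b₀, ∀ p : List V4,
    Es (2 * b) (fun q => survFrac b (walk (p ++ q)) p.length) ≤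
      C * Real.log b ^ (-(1 / 3) : ℝ) := by
  obtain ⟨C, hC, b₀, h⟩ := exists_Es_avMass_le
  refine ⟨1 + C, by linarith, max b₀ 2, fun b hb p => ?_⟩
  have hb2 : 2 ≤ b := (le_max_right _ _).trans hb
  have hA := h b ((le_max_left _ _).trans hb) b le_rfl (by omega)
  have hl : 0 < Real.log b := Real.log_pos (by exact_mod_cast (show 1 < b by omega))
  have hb0 : (0 : ℝ) < b := by exact_mod_cast (show 0 < b by omega)
  set α : ℝ := Real.log b ^ (-(1 / 3) : ℝ) with hα
  have hα0 : 0 < α := Real.rpow_pos_of_pos hl _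
  have hα3 : α ^ 3 = 1 / Real.log b := by
    rw [hα, ← Real.rpow_natCast, ← Real.rpow_mul hl.le]
    norm_num [Real.rpow_neg_one]
  have hcube := (sum_Es_av_cube_le p b).trans hA
  set S := ∑ k ∈ Finset.range b, Es k (fun q => av (lewSet (p ++ q)) b (p ++ q).sum ^ 3) with hS
  have hS0 : 0 ≤ S := Finset.sum_nonneg fun k _ => Es_nonneg fun q _ =>
    pow_nonneg (av_nonneg _ _ _) 3
  have hSb : S ≤ C * b * α ^ 3 := by
    have h1 : b * S ≤ b * (C * b * α ^ 3) := by
      calc b * S ≤ (b + 1) * S := by nlinarith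
        _ ≤ _ := hcube
        _ = _ := by rw [hα3]; ring
    exact le_of_mul_le_mul_left h1 hb0
  rw [Es_survFrac_eq, div_le_iff₀ hb0]
  calc _ ≤ ∑ k ∈ Finset.range b, (α + Es k (fun q =>
        av (lewSet (p ++ q)) b (p ++ q).sum ^ 3) / α ^ 2) := by
        refine Finset.sum_le_sum fun k _ => ?_
        rw [← Es_div, ← Es_const k α, ← Es_add, Es_const]
        exact Es_mono fun q _ => le_add_cube (av_nonneg _ _ _) hα0
    _ = b * α + S / α ^ 2 := by
        rw [Finset.sum_add_distrib, Finset.sum_const, Finset.card_range, nsmul_eq_mul,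
          ← Finset.sum_div]
    _ ≤ b * α + C * b * α ^ 3 / α ^ 2 := by gcongr
    _ = _ := by field_simp

/-! ### Exponential moments along blocks -/

lemma Es_prod_blocks_le {L : ℕ} {G : List V4 → List V4 → ℝ} {c : ℝ} (hc : 0 ≤ c)
    (hG : ∀ p q, 0 ≤ G p q) (h : ∀ p, Es L (G p) ≤ c) (o B : ℕ) :
    Es (o + B * L) (fun s => ∏ i ∈ Finset.range B,
      G (s.take (o + i * L)) ((s.drop (o + i * L)).take L)) ≤ c ^ B := by
  induction B with
  | zero => simp [Es_const]
  | succ B ih =>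
    rw [Nat.succ_mul, ← add_assoc, Es_append, pow_succ]
    calc _ = Es (o + B * L) (fun p => (∏ i ∈ Finset.range B,
          G (p.take (o + i * L)) ((p.drop (o + i * L)).take L)) * Es L (G p)) := by
          refine Es_congr fun p hp => ?_
          rw [← Es_mul_left]
          refine Es_congr fun q hq => ?_
          rw [Finset.prod_range_succ]
          congr 1
          · refine Finset.prod_congr rfl fun i hi => ?_
            have hi := Finset.mem_range.1 hi
            have : i * L + L ≤ B * L := by nlinarith
            rw [List.take_append_of_le_length (by rw [hp.1]; omega),
              List.drop_append_of_le_length (by rw [hp.1]; omega),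
              List.take_append_of_le_length (by rw [List.length_drop, hp.1]; omega)]
          · rw [← hp.1, List.take_left, List.drop_left, ← hq.1, List.take_length]
      _ ≤ Es (o + B * L) (fun p => (∏ i ∈ Finset.range B,
          G (p.take (o + i * L)) ((p.drop (o + i * L)).take L)) * c) :=
          Es_mono fun p _ => mul_le_mul_of_nonneg_left (h p)
            (Finset.prod_nonneg fun i _ => hG _ _)
      _ ≤ _ := by
          rw [Es_mul_right]
          exact mul_le_mul_of_nonneg_right ih hc

lemma exp_le_one_add_two_mul {z : ℝ} (h0 : 0 ≤ z) (h1 : z ≤ 1) : Real.exp z ≤ 1 + 2 * z := by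
  have h := convexOn_exp.2 (Set.mem_univ (0 : ℝ)) (Set.mem_univ (1 : ℝ))
    (show 0 ≤ 1 - z by linarith) h0 (by ring)
  simp only [smul_eq_mul, mul_zero, mul_one, zero_add, Real.exp_zero] at h
  nlinarith [Real.exp_one_lt_d9]

/-- An upper deviation bound for sums of block variables with small conditional means. -/
lemma Es_block_sum_ge_le {L : ℕ} {z : List V4 → List V4 → ℝ} {γ : ℝ}
    (hz0 : ∀ p q, 0 ≤ z p q) (hz1 : ∀ p q, z p q ≤ 1) (h : ∀ p, Es L (z p) ≤ γ) (o B : ℕ) :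
    Es (o + B * L) (fun s => ind (3 * γ * B ≤ ∑ i ∈ Finset.range B,
      z (s.take (o + i * L)) ((s.drop (o + i * L)).take L))) ≤ Real.exp (-(γ * B)) := by
  have h1 : ∀ p, Es L (fun q => Real.exp (z p q)) ≤ Real.exp (2 * γ) := fun p => by
    calc _ ≤ Es L (fun q => 1 + 2 * z p q) :=
          Es_mono fun q _ => exp_le_one_add_two_mul (hz0 p q) (hz1 p q)
      _ = 1 + 2 * Es L (z p) := by rw [Es_add, Es_const, Es_mul_left]
      _ ≤ 2 * γ + 1 := by linarith [h p]
      _ ≤ _ := Real.add_one_le_exp _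
  have h2 := Es_prod_blocks_le (Real.exp_nonneg _) (fun p q => (Real.exp_nonneg (z p q))) h1 o B
  simp only [← Real.exp_sum] at h2
  calc _ ≤ Es (o + B * L) (fun s => Real.exp (∑ i ∈ Finset.range B,
        z (s.take (o + i * L)) ((s.drop (o + i * L)).take L)) / Real.exp (3 * γ * B)) := by
        refine Es_mono fun s _ => ?_
        by_cases hp : 3 * γ * B ≤ ∑ i ∈ Finset.range B,
            z (s.take (o + i * L)) ((s.drop (o + i * L)).take L)
        · rw [ind_true hp, one_le_div (Real.exp_pos _)]
          exact Real.exp_le_exp.2 hp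
        · rw [ind_false hp]; positivity
    _ ≤ Real.exp (2 * γ) ^ B / Real.exp (3 * γ * B) := by
        rw [Es_div]; gcongr
    _ = _ := by
        rw [← Real.exp_nat_mul, ← Real.exp_sub]; congr 1; ring

lemma survFrac_take_append {b n : ℕ} {s : List V4} (h : n + 2 * b ≤ s.length) :
    survFrac b (walk (s.take n ++ (s.drop n).take (2 * b))) (s.take n).length =
      survFrac b (walk s) n := by
  have e : s.take n ++ (s.drop n).take (2 * b) = s.take (n + 2 * b) := by
    rw [List.take_add]
  rw [e, List.length_take, min_eq_left (by omega), survFrac, survFrac]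
  congr 1
  refine Finset.sum_congr rfl fun k hk => ind_congr ?_
  have hk := Finset.mem_range.1 hk
  have e1 : lew (walk (s.take (n + 2 * b))) (n + k) = lew (walk s) (n + k) :=
    lew_congr fun i hi => walk_take (by omega)
  unfold Survives
  rw [e1]
  refine forall_congr' fun r => forall_congr' fun _ => forall_congr' fun hr => ?_
  rw [walk_take (by omega)]

lemma sum_survives_eq {b : ℕ} (hb : 0 < b) (f : ℕ → V4) (B : ℕ) :
    ∑ k ∈ Finset.range (B * (2 * b)), ind (Survives f k (k + b)) =
      b * ((∑ i ∈ Finset.range B, survFrac b f (0 + i * (2 * b))) +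
        ∑ i ∈ Finset.range B, survFrac b f (b + i * (2 * b))) := by
  have hb0 : (b : ℝ) ≠ 0 := by exact_mod_cast hb.ne'
  induction B with
  | zero => simp
  | succ B ih =>
    have e1 : ∀ s, ∑ k ∈ Finset.range b, ind (Survives f (s + k) (s + k + b)) =
        b * survFrac b f s := fun s => by rw [survFrac]; field_simp
    have e2 : ∑ k ∈ Finset.range (2 * b),
        ind (Survives f (B * (2 * b) + k) (B * (2 * b) + k + b)) =
        b * survFrac b f (B * (2 * b)) + b * survFrac b f (B * (2 * b) + b) := by
      rw [two_mul b, Finset.sum_range_add, e1]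
      simp only [← add_assoc]
      rw [e1]
    rw [Finset.sum_range_succ _ B, Finset.sum_range_succ _ B, Nat.succ_mul, Finset.sum_range_add,
      ih, e2, zero_add, add_comm b (B * (2 * b))]
    ring

/-- The number of surviving times is of order at most `B b (log b)^{-1/3}`. -/
lemma exists_Es_survivors_le : ∃ K : ℝ, 0 < K ∧ ∃ b₀ : ℕ, ∀ b ≥ b₀, ∀ B : ℕ,
    Es (b + B * (2 * b)) (fun s => ind (K * B * b * Real.log b ^ (-(1 / 3) : ℝ) ≤
      ∑ k ∈ Finset.range (B * (2 * b)), ind (Survives (walk s) k (k + b)))) ≤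
      2 * Real.exp (-(B * Real.log b ^ (-(1 / 3) : ℝ))) := by
  obtain ⟨C, hC, b₀, h⟩ := exists_Es_survFrac_le
  refine ⟨6 * C, by linarith, max b₀ 2, fun b hb B => ?_⟩
  have hb2 : 2 ≤ b := (le_max_right _ _).trans hb
  have h := h b ((le_max_left _ _).trans hb)
  have hl : 0 < Real.log b := Real.log_pos (by exact_mod_cast (show 1 < b by omega))
  set α : ℝ := Real.log b ^ (-(1 / 3) : ℝ) with hα
  have hα0 : 0 < α := Real.rpow_pos_of_pos hl _
  have hblock := Es_block_sum_ge_le (z := fun p q => survFrac b (walk (p ++ q)) p.length)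
    (fun _ _ => survFrac_nonneg _ _ _) (fun _ _ => survFrac_le_one _ _ _) h
  have key : ∀ o ≤ b, Es (b + B * (2 * b)) (fun s => ind (3 * (C * α) * B ≤
      ∑ i ∈ Finset.range B, survFrac b (walk s) (o + i * (2 * b)))) ≤ Real.exp (-(B * α)) := by
    intro o ho
    have h1 := hblock o B
    rw [← Es_take (show o + B * (2 * b) ≤ b + B * (2 * b) by omega)] at h1
    refine le_trans (le_of_eq (Es_congr fun s hs => ?_)) (h1.trans (Real.exp_le_exp.2 ?_))
    · congr 2
      refine Finset.sum_congr rfl fun i hi => ?_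
      have hi := Finset.mem_range.1 hi
      have hiB : i * (2 * b) + 2 * b ≤ B * (2 * b) := by nlinarith
      rw [survFrac_take_append (by rw [List.length_take, hs.1]; omega), survFrac, survFrac]
      congr 1
      refine Finset.sum_congr rfl fun k hk => ind_congr ?_
      have hk := Finset.mem_range.1 hk
      have e1 : lew (walk (s.take (o + B * (2 * b)))) (o + i * (2 * b) + k) =
          lew (walk s) (o + i * (2 * b) + k) := lew_congr fun i hi => walk_take (by omega)
      unfold Survives
      rw [e1]
      refine forall_congr' fun r => forall_congr' fun _ => forall_congr' fun hr => ?_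
      rw [walk_take (by omega)]
    · have : B * α ≤ C * α * B := by
        have : 0 ≤ (B : ℝ) * α := by positivity
        nlinarith
      linarith
  have hb0 : (0 : ℝ) < b := by exact_mod_cast (show 0 < b by omega)
  calc _ ≤ Es (b + B * (2 * b)) (fun s =>
        ind (3 * (C * α) * B ≤ ∑ i ∈ Finset.range B, survFrac b (walk s) (0 + i * (2 * b))) +
        ind (3 * (C * α) * B ≤ ∑ i ∈ Finset.range B, survFrac b (walk s) (b + i * (2 * b)))) := by
        refine Es_mono fun s _ => (ind_mono fun hs => ?_).trans (ind_or_le _ _)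
        rw [sum_survives_eq (by omega)] at hs
        by_contra! hcon
        have : b * ((∑ i ∈ Finset.range B, survFrac b (walk s) (0 + i * (2 * b))) +
            ∑ i ∈ Finset.range B, survFrac b (walk s) (b + i * (2 * b))) <
            b * (3 * (C * α) * B + 3 * (C * α) * B) :=
          mul_lt_mul_of_pos_left (add_lt_add hcon.1 hcon.2) hb0
        linarith
    _ ≤ _ := by
        rw [Es_add, two_mul (Real.exp _)]
        exact add_le_add (key 0 (by omega)) (key b le_rfl)

/-! ### Fresh stable points of the loop erasure in a block -/

/-- Points first visited by `f` during `[s, s + 2a]` which lie on the loop erasure at time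
`s + 2a`, and whose predecessors there are not revisited before time `s + 4a`. -/
def freshPts (a : ℕ) (f : ℕ → V4) (s : ℕ) : Finset V4 :=
  ((Finset.Icc s (s + 2 * a)).image f).filter fun v => (∀ i < s, f i ≠ v) ∧
    ∃ l, l ++ [v] <+: lew f (s + 2 * a) ∧ ∀ r, s + 2 * a < r → r ≤ s + 4 * a → f r ∉ l

/-- From the position at time `s + k`, the increments of `σ` after time `j` reach a fresh point
of the loop erasure, before which `f` does not hit the loop erasure until time `s + 4a`. -/
def FreshPair (a : ℕ) (f : ℕ → V4) (s : ℕ) (σ : List V4) (k j : ℕ) : Prop :=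
  ∃ l v, l ++ [v] <+: lew f (s + k) ∧ (∀ i < s, f i ≠ v) ∧
    (∀ r, s + k < r → r ≤ s + 4 * a → f r ∉ l) ∧
    ∃ i ≤ 4 * a - k, v = f (s + k) + (walk σ (j + i) - walk σ j)

lemma FreshPair.mem_diffSet {a : ℕ} {f : ℕ → V4} {s : ℕ} {σ : List V4} {k j : ℕ}
    (h : FreshPair a f s σ k j) (hk : k ≤ 2 * a) (hj : j ≤ 4 * a) :
    f (s + k) - walk σ j ∈ diffSet (freshPts a f s) (8 * a) σ := by
  obtain ⟨l, v, hl, hv, hr, i, hi, e⟩ := h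
  refine _root_.mem_diffSet.2 ⟨j + i, by omega, ?_⟩
  have e' : f (s + k) - walk σ j + walk σ (j + i) = v := by rw [e]; abel
  rw [e', freshPts, Finset.mem_filter, Finset.mem_image]
  refine ⟨?_, hv, l, prefix_concat_lew (by omega) hl fun r h1 h2 => hr r h1 (by omega),
    fun r h1 h2 => hr r (by omega) h2⟩
  obtain ⟨t, ht, hfv⟩ := exists_of_mem_lew (hl.subset (by simp) : v ∈ lew f (s + k))
  refine ⟨t, Finset.mem_Icc.2 ⟨?_, by omega⟩, hfv⟩
  by_contra hlt
  exact hv t (by omega) hfv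

lemma exists_first_split {α : Type*} (P : α → Prop) {L : List α} (h : ∃ x ∈ L, P x) :
    ∃ l v, l ++ [v] <+: L ∧ P v ∧ ∀ y ∈ l, ¬P y := by
  induction L with
  | nil => simp at h
  | cons x L ih =>
    by_cases hx : P x
    · exact ⟨[], x, by simp, hx, by simp⟩
    · obtain ⟨l, v, hl, hv, hn⟩ := ih (by
        obtain ⟨y, hy, hp⟩ := h
        rcases List.mem_cons.1 hy with rfl | hy
        · exact absurd hp hx
        · exact ⟨y, hy, hp⟩)
      exact ⟨x :: l, v, by simpa using hl, hv, by simpa [hx] using hn⟩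

/-- The path `g` avoids the part of the list `L` preceding a point outside `H` visited by `g'`. -/
def Reaches (L : List V4) (H : Set V4) (n : ℕ) (g g' : ℕ → V4) : Prop :=
  ∃ l v, l ++ [v] <+: L ∧ v ∉ H ∧ (∀ i, 1 ≤ i → i ≤ n → g i ∉ l) ∧ ∃ i ≤ n, v = g' i

lemma reaches_or {L : List V4} (H : Set V4) (n : ℕ) {g : ℕ → V4} (g' : ℕ → V4) (h : g 0 ∈ L) :
    (Reaches L H n g g' ∨ Reaches L H n g' g) ∨ ((∃ i ≤ n, g i ∈ H) ∨ ∃ i ≤ n, g' i ∈ H) := by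
  obtain ⟨l, v, hl, ⟨i, hi, hv⟩, hn⟩ := exists_first_split
    (fun v => ∃ i ≤ n, g i = v ∨ g' i = v) ⟨g 0, h, 0, Nat.zero_le _, Or.inl rfl⟩
  have h1 : ∀ r, 1 ≤ r → r ≤ n → g r ∉ l := fun r _ h2 h3 => hn _ h3 ⟨r, h2, Or.inl rfl⟩
  have h2 : ∀ r, 1 ≤ r → r ≤ n → g' r ∉ l := fun r _ h2 h3 => hn _ h3 ⟨r, h2, Or.inr rfl⟩
  by_cases hH : v ∈ H
  · rcases hv with rfl | rfl
    · exact Or.inr (Or.inl ⟨i, hi, hH⟩)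
    · exact Or.inr (Or.inr ⟨i, hi, hH⟩)
  · rcases hv with rfl | rfl
    · exact Or.inl (Or.inr ⟨l, g i, hl, hH, h2, i, hi, rfl⟩)
    · exact Or.inl (Or.inl ⟨l, g' i, hl, hH, h1, i, hi, rfl⟩)

lemma Es_reaches_ge {L : List V4} (H : Set V4) (n : ℕ) {x : V4} (hx : x ∈ L) :
    1 / 2 - Es n (fun q => ind (∃ i ≤ n, x + walk q i ∈ H)) ≤
      Es n (fun q => Es n fun q' => ind (Reaches L H n (fun i => x + walk q i)
        (fun i => x + walk q' i))) := by
  set V := fun q q' : List V4 => ind (Reaches L H n (fun i => x + walk q i)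
    (fun i => x + walk q' i)) with hV
  set h := fun q : List V4 => ind (∃ i ≤ n, x + walk q i ∈ H) with hh
  have h1 : ∀ q q' : List V4, 1 ≤ (V q q' + V q' q) + (h q + h q') := fun q q' => by
    have e := reaches_or H n (g := fun i => x + walk q i) (fun i => x + walk q' i)
      (by simpa [walk_zero] using hx)
    calc (1 : ℝ) = ind _ := (ind_true e).symm
      _ ≤ _ := (ind_or_le _ _).trans (add_le_add (ind_or_le _ _) (ind_or_le _ _))
  have h2 : (1 : ℝ) ≤ Es n fun q => Es n fun q' => (V q q' + V q' q) + (h q + h q') :=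
    const_le_Es fun q _ => const_le_Es fun q' _ => h1 q q'
  have h3 : (Es n fun q => Es n fun q' => (V q q' + V q' q) + (h q + h q')) =
      2 * (Es n fun q => Es n fun q' => V q q') + 2 * Es n h := by
    simp only [Es_add, Es_const]
    rw [Es_comm n n fun q q' => V q' q]
    ring
  change 1 / 2 - Es n h ≤ Es n fun q => Es n fun q' => V q q'
  linarith

lemma Es_freshPair_ge {a : ℕ} (p : List V4) {k j : ℕ} (hk : k ≤ 4 * a) (hj : j ≤ 4 * a) :
    1 / 2 - Es (4 * a) (fun q => ind (∃ i < p.length, ∃ r ≤ 4 * a - k,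
        walk (p ++ q) i = walk (p ++ q) (p.length + k + r))) ≤
      Es (4 * a) (fun q => Es (8 * a) fun σ =>
        ind (FreshPair a (walk (p ++ q)) p.length σ k j)) := by
  obtain ⟨n, hn⟩ := Nat.exists_eq_add_of_le hk
  have hn' : 4 * a - k = n := by omega
  rw [hn', show Es (4 * a) = Es (k + n) by rw [hn], Es_append, Es_append, ← Es_const k (1 / 2 : ℝ),
    ← Es_sub]
  refine Es_mono fun q hq => ?_
  set u := p ++ q with hu
  have hul : u.length = p.length + k := by simp [hu, hq.1]
  set H : Set V4 := {v | ∃ i < p.length, walk p i = v} with hH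
  have hw : ∀ q' : List V4, ∀ i < p.length, walk (u ++ q') i = walk p i := fun q' i hi => by
    rw [hu, List.append_assoc, walk_append_left _ hi.le]
  have hw2 : ∀ q' : List V4, ∀ r, walk (u ++ q') (p.length + k + r) = u.sum + walk q' r :=
    fun q' r => by rw [← hul, walk_append_right]
  have hw3 : ∀ q' : List V4, walk (u ++ q') (p.length + k) = u.sum := fun q' => by
    simpa [walk_zero] using hw2 q' 0
  have hlew : ∀ q' : List V4, lew (walk (u ++ q')) (p.length + k) = lew (walk u) u.length :=
    fun q' => by rw [← hul, lew_append u q' le_rfl]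
  have key := Es_reaches_ge (L := lew (walk u) u.length) H n (x := u.sum)
    (by rw [← walk_length]; exact mem_lew_self _ _)
  refine le_trans (le_of_eq ?_) (key.trans_eq ?_)
  · congr 2; funext q'
    refine ind_congr ⟨?_, ?_⟩
    · rintro ⟨i, hi, r, hr, e⟩
      rw [← List.append_assoc] at e
      exact ⟨r, hr, i, hi, by rw [← hw2, ← hw q' i hi]; exact e⟩
    · rintro ⟨r, hr, i, hi, e⟩
      refine ⟨i, hi, r, hr, ?_⟩
      rw [← List.append_assoc, ← hu, hw q' i hi, hw2]; exact e
  · congr 1; funext q'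
    rw [← Es_window (i := j) (n := 8 * a) (w := n) (by omega)]
    congr 1; funext σ
    have hσ : ∀ i ≤ n, walk ((σ.drop j).take n) i = walk σ (j + i) - walk σ j := fun i hi => by
      rw [walk_take hi, walk_add]; abel
    rw [FreshPair, Reaches, ← List.append_assoc, ← hu]
    refine ind_congr (exists_congr fun l => exists_congr fun v => ?_)
    rw [hlew]
    refine and_congr_right fun _ => and_congr ?_ (and_congr ?_ ?_)
    · refine ⟨fun h i hi e => h ⟨i, hi, by rw [← hw q' i hi]; exact e⟩, ?_⟩
      rintro h ⟨i, hi, e⟩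
      exact h i hi (by rw [hw q' i hi]; exact e)
    · constructor
      · intro h r h1 h2
        obtain ⟨t, rfl⟩ := Nat.exists_eq_add_of_le h1.le
        rw [hw2]; exact h t (by omega) (by omega)
      · intro h r h1 h2
        rw [← hw2]; exact h _ (by omega) (by omega)
    · rw [hn']
      refine exists_congr fun i => and_congr_right fun hi => ?_
      rw [hw3, hσ i hi]

/-- The conditional probability, given past steps `p`, that the walk during the times
`[a, 4a]` of the next block meets its past. -/
def meetPast (a : ℕ) (p : List V4) : ℝ :=
  Es (4 * a) fun q => ind (∃ i ≤ p.length, ∃ r ≤ 3 * a,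
    walk (p ++ q) i = walk (p ++ q) (p.length + a + r))

lemma Es_sum_freshPair_ge {a : ℕ} {p : List V4} (hp : meetPast a p ≤ 1 / 4) :
    (a + 1) * (4 * a + 1) / 4 ≤ Es (4 * a) (fun q => Es (8 * a) fun σ =>
      ∑ k ∈ Finset.range (a + 1), ∑ j ∈ Finset.range (4 * a + 1),
        ind (FreshPair a (walk (p ++ q)) p.length σ (a + k) j)) := by
  simp only [Es_sum]
  calc ((a : ℝ) + 1) * (4 * a + 1) / 4 = ∑ k ∈ Finset.range (a + 1),
        ∑ j ∈ Finset.range (4 * a + 1), (1 / 4 : ℝ) := by simp; ring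
    _ ≤ _ := by
      refine Finset.sum_le_sum fun k hk => Finset.sum_le_sum fun j hj => ?_
      have hk := Finset.mem_range.1 hk
      have hj := Finset.mem_range.1 hj
      refine le_trans ?_ (Es_freshPair_ge p (by omega) (by omega))
      have : Es (4 * a) (fun q => ind (∃ i < p.length, ∃ r ≤ 4 * a - (a + k),
          walk (p ++ q) i = walk (p ++ q) (p.length + (a + k) + r))) ≤ meetPast a p := by
        refine Es_mono fun q _ => ind_mono ?_
        rintro ⟨i, hi, r, hr, e⟩
        exact ⟨i, hi.le, k + r, by omega, by rw [e]; congr 1; omega⟩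
      linarith

/-! ### Counting coincidences -/

lemma card_ge_of_weights {ι : Type*} (T : Finset ι) (φ : ι → V4) (P : ι → Prop) (S : Finset V4)
    (h : ∀ x ∈ T, P x → φ x ∈ S) {β : ℝ} (hβ : 0 < β) :
    2 / β * ∑ x ∈ T, ind (P x) - 1 / β ^ 2 * ∑ x ∈ T, ∑ y ∈ T, ind (φ x = φ y) ≤ S.card := by
  set n : V4 → ℝ := fun z => ∑ x ∈ T, ind (P x) * ind (φ x = z) with hn
  have e1 : ∀ x ∈ T, ∀ c : V4 → ℝ,
      ∑ z ∈ S, ind (P x) * ind (φ x = z) * c z = ind (P x) * c (φ x) := by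
    intro x hx c
    by_cases hP : P x
    · rw [Finset.sum_eq_single (φ x)]
      · rw [ind_true rfl, mul_one]
      · intro z _ hz
        rw [ind_false hz.symm, mul_zero, zero_mul]
      · exact fun hz => absurd (h x hx hP) hz
    · simp [ind_false hP]
  have h1 : ∑ z ∈ S, n z = ∑ x ∈ T, ind (P x) := by
    rw [hn, Finset.sum_comm]
    exact Finset.sum_congr rfl fun x hx => by simpa using e1 x hx fun _ => 1
  have h2 : ∑ z ∈ S, n z ^ 2 ≤ ∑ x ∈ T, ∑ y ∈ T, ind (φ x = φ y) := by
    calc ∑ z ∈ S, n z ^ 2 = ∑ x ∈ T, ∑ z ∈ S, ind (P x) * ind (φ x = z) * n z := by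
          rw [Finset.sum_comm]
          exact Finset.sum_congr rfl fun z _ => by rw [sq, ← Finset.sum_mul]
      _ = ∑ x ∈ T, ind (P x) * n (φ x) := Finset.sum_congr rfl fun x hx => e1 x hx n
      _ ≤ _ := by
          refine Finset.sum_le_sum fun x _ => ?_
          rw [hn, Finset.mul_sum]
          refine Finset.sum_le_sum fun y _ => ?_
          calc _ ≤ 1 * (1 * ind (φ y = φ x)) := by
                gcongr
                · exact mul_nonneg (ind_nonneg _) (ind_nonneg _)
                · exact ind_le_one _
                · exact ind_nonneg _
                · exact ind_le_one _
            _ = _ := by rw [one_mul, one_mul]; exact ind_congr eq_comm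
  have h3 : 0 ≤ ∑ z ∈ S, (1 - n z / β) ^ 2 := Finset.sum_nonneg fun z _ => sq_nonneg _
  have h4 : ∑ z ∈ S, (1 - n z / β) ^ 2 =
      S.card - 2 / β * ∑ z ∈ S, n z + 1 / β ^ 2 * ∑ z ∈ S, n z ^ 2 := by
    have hc : (S.card : ℝ) = ∑ _z ∈ S, (1 : ℝ) := by simp
    rw [hc, Finset.mul_sum, Finset.mul_sum, ← Finset.sum_sub_distrib, ← Finset.sum_add_distrib]
    exact Finset.sum_congr rfl fun z _ => by ring
  have h5 := mul_le_mul_of_nonneg_left h2 (show 0 ≤ 1 / β ^ 2 by positivity)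
  rw [h1] at h4
  linarith

lemma sum_dist_le {n k : ℕ} (hk : k < n) {f : ℕ → ℝ} (hf : ∀ i, 0 ≤ f i) :
    ∑ i ∈ Finset.range n, f ((k - i) + (i - k)) ≤ 2 * ∑ d ∈ Finset.range n, f d := by
  rw [← Finset.sum_fiberwise_of_maps_to (g := fun i => (k - i) + (i - k))
    (t := Finset.range n), Finset.mul_sum]
  · refine Finset.sum_le_sum fun d _ => ?_
    rw [Finset.sum_congr rfl fun i hi => by rw [(Finset.mem_filter.1 hi).2], Finset.sum_const,
      nsmul_eq_mul]
    refine mul_le_mul_of_nonneg_right ?_ (hf d)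
    have h : ((Finset.range n).filter fun i => (k - i) + (i - k) = d) ⊆ {k - d, k + d} := by
      intro i hi
      have := (Finset.mem_filter.1 hi).2
      simp only [Finset.mem_insert, Finset.mem_singleton]
      omega
    exact_mod_cast (Finset.card_le_card h).trans Finset.card_le_two
  · intro i hi
    have := Finset.mem_range.1 hi
    simp only [Finset.mem_range]
    omega

lemma Es_walk_sub_eq_le {n k k' : ℕ} (hk : k ≤ n) (hk' : k' ≤ n) (z : V4) :
    Es n (fun q => ind (walk q k - walk q k' = z)) ≤
      25600 / ((((k - k') + (k' - k) : ℕ) : ℝ) + 1) ^ 2 := by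
  rcases le_total k' k with h | h
  · have e : Es n (fun q => ind (walk q k - walk q k' = z)) = pk (k - k') 0 z := by
      rw [pk, Pn, ← Es_window (i := k') (w := k - k') (n := n) (by omega)]
      refine Es_congr fun q _ => ind_congr ?_
      have := walk_add q k' (k - k')
      rw [Nat.add_sub_cancel' h] at this
      rw [this, walk]
      simp [walk]
    rw [e, show (k - k') + (k' - k) = k - k' by omega]
    exact pk_le _ _ _
  · have e : Es n (fun q => ind (walk q k - walk q k' = z)) = pk (k' - k) 0 (-z) := by
      rw [pk, Pn, ← Es_window (i := k) (w := k' - k) (n := n) (by omega)]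
      refine Es_congr fun q _ => ind_congr ?_
      have := walk_add q k (k' - k)
      rw [Nat.add_sub_cancel' h] at this
      rw [this, walk]
      simp only [walk, sub_add_cancel_left, zero_add]
      exact neg_eq_iff_eq_neg
    rw [e, show (k - k') + (k' - k) = k' - k by omega]
    exact pk_le _ _ _

lemma Es_quad_le {n N : ℕ} {k k' j j' : ℕ} (hk : k ≤ n) (hk' : k' ≤ n) (hj : j ≤ N)
    (hj' : j' ≤ N) (x : V4) :
    Es n (fun q => Es N fun σ => ind (x + walk q k - walk σ j = x + walk q k' - walk σ j')) ≤
      102400 / ((((k - k') + (k' - k) : ℕ) : ℝ) + (((j - j') + (j' - j) : ℕ) : ℝ) + 1) ^ 2 := by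
  set κ : ℕ := (k - k') + (k' - k) with hκ
  set ι : ℕ := (j - j') + (j' - j) with hι
  have h1 : Es n (fun q => Es N fun σ =>
      ind (x + walk q k - walk σ j = x + walk q k' - walk σ j')) ≤ 25600 / ((ι : ℝ) + 1) ^ 2 := by
    refine Es_le_const fun q _ => ?_
    refine le_trans (Es_mono fun σ _ => ind_mono ?_)
      (Es_walk_sub_eq_le hj hj' (walk q k - walk q k'))
    intro h
    rw [sub_eq_sub_iff_add_eq_add] at h ⊢
    have : x + (walk q k + walk σ j') = x + (walk q k' + walk σ j) := by
      rw [← add_assoc, ← add_assoc]; exact h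
    rw [add_comm (walk σ j), add_left_cancel this, add_comm]
  have h2 : Es n (fun q => Es N fun σ =>
      ind (x + walk q k - walk σ j = x + walk q k' - walk σ j')) ≤ 25600 / ((κ : ℝ) + 1) ^ 2 := by
    rw [Es_comm]
    refine Es_le_const fun σ _ => ?_
    refine le_trans (Es_mono fun q _ => ind_mono ?_)
      (Es_walk_sub_eq_le hk hk' (walk σ j - walk σ j'))
    intro h
    rw [sub_eq_sub_iff_add_eq_add] at h ⊢
    have : x + (walk q k + walk σ j') = x + (walk q k' + walk σ j) := by
      rw [← add_assoc, ← add_assoc]; exact h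
    rw [add_left_cancel this, add_comm]
  have key : ∀ u v : ℝ, 0 ≤ v → v ≤ u →
      25600 / (u + 1) ^ 2 ≤ 102400 / (u + v + 1) ^ 2 := fun u v hv huv => by
    have hu : 0 ≤ u := hv.trans huv
    rw [div_le_div_iff₀ (by positivity) (by positivity)]
    nlinarith [mul_self_nonneg (u - v)]
  rcases le_total κ ι with h | h
  · have hc : (κ : ℝ) ≤ ι := by exact_mod_cast h
    have := key ι κ (Nat.cast_nonneg _) hc
    rw [add_comm (κ : ℝ)]
    exact h1.trans this
  · have hc : (ι : ℝ) ≤ κ := by exact_mod_cast h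
    exact h2.trans (key κ ι (Nat.cast_nonneg _) hc)

lemma sum_inv_succ_le (n : ℕ) :
    ∑ i ∈ Finset.range (n + 1), 1 / ((i : ℝ) + 1) ≤ 1 + Real.log (n + 1) := by
  rw [Finset.sum_range_succ']
  have h := sum_inv_le_log (a := 1) (n := n) le_rfl
  have e : ∑ i ∈ Finset.range n, 1 / (((i + 1 : ℕ) : ℝ) + 1) =
      ∑ i ∈ Finset.range n, 1 / (((1 : ℕ) : ℝ) + (i : ℝ) + 1) :=
    Finset.sum_congr rfl fun i _ => by push_cast; ring
  rw [e]
  simp only [Nat.cast_one, Nat.cast_zero, zero_add, div_one, add_comm (n : ℝ)] at h ⊢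
  linarith

lemma sum_quad_le (m n : ℕ) :
    ∑ k ∈ Finset.range (m + 1), ∑ j ∈ Finset.range n,
      ∑ k' ∈ Finset.range (m + 1), ∑ j' ∈ Finset.range n,
        102400 / ((((k - k') + (k' - k) : ℕ) : ℝ) + (((j - j') + (j' - j) : ℕ) : ℝ) + 1) ^ 2 ≤
      ((m : ℝ) + 1) * n * (819200 * (1 + Real.log (m + 1))) := by
  have h1 : ∀ (κ j : ℕ), j < n → ∑ j' ∈ Finset.range n,
      102400 / ((κ : ℝ) + (((j - j') + (j' - j) : ℕ) : ℝ) + 1) ^ 2 ≤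
        409600 * (1 / ((κ : ℝ) + 1)) := by
    intro κ j hj
    refine (sum_dist_le (f := fun ι : ℕ => 102400 / ((κ : ℝ) + (ι : ℝ) + 1) ^ 2) hj
      fun i => by positivity).trans ?_
    have := sum_inv_sq_le κ n
    calc _ = 204800 * ∑ i ∈ Finset.range n, 1 / ((κ : ℝ) + i + 1) ^ 2 := by
          rw [Finset.mul_sum, Finset.mul_sum]
          exact Finset.sum_congr rfl fun i _ => by ring
      _ ≤ 204800 * (2 / ((κ : ℝ) + 1)) := by gcongr
      _ = _ := by ring
  have h2 : ∀ k j : ℕ, k < m + 1 → j < n → ∑ k' ∈ Finset.range (m + 1), ∑ j' ∈ Finset.range n,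
        102400 / ((((k - k') + (k' - k) : ℕ) : ℝ) + (((j - j') + (j' - j) : ℕ) : ℝ) + 1) ^ 2 ≤
      819200 * (1 + Real.log (m + 1)) := by
    intro k j hk hj
    refine (Finset.sum_le_sum fun k' _ => h1 _ j hj).trans ?_
    refine (sum_dist_le (f := fun d : ℕ => 409600 * (1 / ((d : ℝ) + 1))) hk
      fun i => by positivity).trans ?_
    rw [← Finset.mul_sum]
    linarith [sum_inv_succ_le m]
  calc _ ≤ ∑ k ∈ Finset.range (m + 1), ∑ j ∈ Finset.range n,
        819200 * (1 + Real.log (m + 1)) :=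
        Finset.sum_le_sum fun k hk => Finset.sum_le_sum fun j hj =>
          h2 k j (Finset.mem_range.1 hk) (Finset.mem_range.1 hj)
    _ = _ := by simp; ring

lemma log_add_one_le {a : ℕ} (ha : 3 ≤ a) :
    1 ≤ Real.log a ∧ 1 + Real.log ((a : ℝ) + 1) ≤ 3 * Real.log a := by
  have h3 : (3 : ℝ) ≤ a := by exact_mod_cast ha
  have h1 : 1 ≤ Real.log a := by
    rw [Real.le_log_iff_exp_le (by linarith)]
    linarith [Real.exp_one_lt_d9]
  refine ⟨h1, ?_⟩
  have : Real.log ((a : ℝ) + 1) ≤ Real.log ((a : ℝ) ^ 2) :=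
    Real.log_le_log (by linarith) (by nlinarith)
  rw [Real.log_pow] at this
  push_cast at this
  linarith

/-- The mass of the fresh points of a block, normalised and truncated. -/
def blockMass (a : ℕ) (p q : List V4) : ℝ :=
  min 1 (avMass (freshPts a (walk (p ++ q)) p.length) (8 * a) /
    ((1 / 1228800) * ((a : ℝ) ^ 2 / Real.log a)))

lemma blockMass_le_one (a : ℕ) (p q : List V4) : blockMass a p q ≤ 1 := min_le_left _ _

lemma blockMass_nonneg (a : ℕ) (p q : List V4) : 0 ≤ blockMass a p q :=
  le_min zero_le_one (div_nonneg (avMass_nonneg _ _) (mul_nonneg (by norm_num)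
    (div_nonneg (sq_nonneg _) (Real.log_natCast_nonneg _))))

lemma Es_blockMass_ge {a : ℕ} (ha : 3 ≤ a) {p : List V4} (hp : meetPast a p ≤ 1 / 4) :
    1 / 8 ≤ Es (4 * a) (blockMass a p) := by
  obtain ⟨hl, hl2⟩ := log_add_one_le ha
  have ha0 : (3 : ℝ) ≤ a := by exact_mod_cast ha
  set l := Real.log a with hldef
  set n : ℝ := ((a : ℝ) + 1) * (4 * a + 1) with hn
  have hn0 : 0 < n := by positivity
  set β : ℝ := 9830400 * l with hβ
  have hβ0 : 0 < β := by positivity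
  set T := Finset.range (a + 1) ×ˢ Finset.range (4 * a + 1) with hT
  set V : List V4 → List V4 → ℝ := fun q σ =>
    ∑ x ∈ T, ind (FreshPair a (walk (p ++ q)) p.length σ (a + x.1) x.2) with hV
  set Q : List V4 → List V4 → ℝ := fun q σ => ∑ x ∈ T, ∑ y ∈ T,
    ind (p.sum + walk q (a + x.1) - walk σ x.2 = p.sum + walk q (a + y.1) - walk σ y.2) with hQ
  have hTcard : (T.card : ℝ) = n := by rw [hT, Finset.card_product]; simp [hn]
  have hVle : ∀ q σ, V q σ ≤ n := fun q σ => by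
    rw [← hTcard, hV]
    exact (Finset.sum_le_sum fun x _ => ind_le_one _).trans_eq (by simp)
  have hQ0 : ∀ q σ, 0 ≤ Q q σ := fun q σ =>
    Finset.sum_nonneg fun x _ => Finset.sum_nonneg fun y _ => ind_nonneg _
  have hcard : ∀ q σ : List V4, 2 / β * V q σ - 1 / β ^ 2 * Q q σ ≤
      (diffSet (freshPts a (walk (p ++ q)) p.length) (8 * a) σ).card := by
    intro q σ
    refine card_ge_of_weights T (fun x => p.sum + walk q (a + x.1) - walk σ x.2) _ _ ?_ hβ0
    rintro ⟨k, j⟩ hx hP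
    rw [hT, Finset.mem_product, Finset.mem_range, Finset.mem_range] at hx
    rw [← walk_append_right]
    exact hP.mem_diffSet (by omega) (by omega)
  have hEV : n / 4 ≤ Es (4 * a) fun q => Es (8 * a) fun σ => V q σ := by
    refine (Es_sum_freshPair_ge hp).trans_eq ?_
    simp only [hV, hT, Finset.sum_product]
  have hEQ : (Es (4 * a) fun q => Es (8 * a) fun σ => Q q σ) ≤ n * (2457600 * l) := by
    have h1 : (Es (4 * a) fun q => Es (8 * a) fun σ => Q q σ) ≤
        ∑ k ∈ Finset.range (a + 1), ∑ j ∈ Finset.range (4 * a + 1),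
        ∑ k' ∈ Finset.range (a + 1), ∑ j' ∈ Finset.range (4 * a + 1),
        102400 / ((((k - k') + (k' - k) : ℕ) : ℝ) + (((j - j') + (j' - j) : ℕ) : ℝ) + 1) ^ 2 := by
      simp only [hQ, hT, Finset.sum_product, Es_sum]
      refine Finset.sum_le_sum fun k hk => Finset.sum_le_sum fun j hj =>
        Finset.sum_le_sum fun k' hk' => Finset.sum_le_sum fun j' hj' => ?_
      rw [Finset.mem_range] at hk hj hk' hj'
      refine (Es_quad_le (by omega) (by omega) (by omega) (by omega) _).trans_eq ?_
      rw [Nat.add_sub_add_left, Nat.add_sub_add_left]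
    refine h1.trans ((sum_quad_le a (4 * a + 1)).trans ?_)
    push_cast
    refine mul_le_mul_of_nonneg_left ?_ hn0.le
    linarith
  have hD : 0 < 2 * n / β := by positivity
  have hpt : ∀ q : List V4,
      (Es (8 * a) fun σ => 2 / β * V q σ - 1 / β ^ 2 * Q q σ) / (2 * n / β) ≤ blockMass a p q := by
    intro q
    refine le_min ?_ ?_
    · rw [div_le_one hD]
      refine Es_le_const fun σ _ => ?_
      have h1 : 0 ≤ 1 / β ^ 2 * Q q σ := mul_nonneg (by positivity) (hQ0 q σ)
      have h2 : 2 / β * V q σ ≤ 2 / β * n := mul_le_mul_of_nonneg_left (hVle q σ) (by positivity)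
      have h3 : 2 * n / β = 2 / β * n := by ring
      linarith
    · have h1 := (Es_mono fun σ _ => hcard q σ).trans
        (Es_card_diffSet_le (freshPts a (walk (p ++ q)) p.length) (8 * a))
      refine (div_le_div_of_nonneg_right h1 hD.le).trans
        (div_le_div_of_nonneg_left (avMass_nonneg _ _) (by positivity) ?_)
      rw [hβ, hn, ← mul_div_assoc, div_le_div_iff₀ (by positivity) (by positivity)]
      nlinarith
  have hmean : 1 / 8 ≤
      Es (4 * a) fun q => (Es (8 * a) fun σ => 2 / β * V q σ - 1 / β ^ 2 * Q q σ) / (2 * n / β) := by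
    simp only [Es_div, Es_sub, Es_mul_left]
    rw [le_div_iff₀ hD]
    have h1 := mul_le_mul_of_nonneg_left hEV (show 0 ≤ 2 / β by positivity)
    have h2 := mul_le_mul_of_nonneg_left hEQ (show 0 ≤ 1 / β ^ 2 by positivity)
    have h3 : 1 / β ^ 2 * (n * (2457600 * l)) = n / (4 * β) := by
      rw [hβ]; field_simp; norm_num
    have h4 : 1 / 8 * (2 * n / β) = 2 / β * (n / 4) - n / (4 * β) := by field_simp; norm_num
    linarith
  exact hmean.trans (Es_mono fun q _ => hpt q)

/-! ### Mutual energy of the potentials of two sets -/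

/-- The mutual energy of the densities `avSum A N` and `avSum B N` for the kernel `gk M`. -/
def energy (M N : ℕ) (A B : Finset V4) : ℝ :=
  ∑ x ∈ A, avSum A N x * ∑ y ∈ B, gk M x y * avSum B N y

lemma energy_symm (M N : ℕ) (A B : Finset V4) : energy M N A B = energy M N B A := by
  simp only [energy, Finset.mul_sum]
  rw [Finset.sum_comm]
  exact Finset.sum_congr rfl fun x _ => Finset.sum_congr rfl fun y _ => by
    rw [gk_symm M y x]; ring

lemma energy_nonneg (M N : ℕ) (A B : Finset V4) : 0 ≤ energy M N A B :=
  Finset.sum_nonneg fun _ _ => mul_nonneg (avSum_nonneg _ _ _)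
    (Finset.sum_nonneg fun _ _ => mul_nonneg (gk_nonneg _ _ _) (avSum_nonneg _ _ _))

lemma energy_mono_right {B B' : Finset V4} (h : B ⊆ B') (M N : ℕ) (A : Finset V4) :
    energy M N A B ≤ energy (M + N) N A B' :=
  Finset.sum_le_sum fun x _ =>
    mul_le_mul_of_nonneg_left (sum_gk_avSum_mono h M N x) (avSum_nonneg _ _ _)

lemma energy_mono {A A' B B' : Finset V4} (hA : A ⊆ A') (hB : B ⊆ B') (M N : ℕ) :
    energy M N A B ≤ energy (M + N + N) N A' B' := by
  refine (energy_mono_right hB M N A).trans ?_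
  rw [energy_symm, energy_symm _ _ A']
  exact energy_mono_right hA _ _ _

lemma av_image_add (A : Finset V4) (n : ℕ) (c x : V4) :
    av ((A.image (c + ·) : Finset V4) : Set V4) n (c + x) = av A n x := by
  refine Es_congr fun s _ => ind_congr ?_
  simp [add_assoc]

lemma avSum_image_add (A : Finset V4) (N : ℕ) (c x : V4) :
    avSum ((A.image (c + ·) : Finset V4) : Set V4) N (c + x) = avSum A N x :=
  Finset.sum_congr rfl fun _ _ => av_image_add _ _ _ _

lemma energy_image_add (M N : ℕ) (A B : Finset V4) (c d : V4) :
    energy M N (A.image (c + ·)) (B.image (d + ·)) =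
      ∑ x ∈ A, avSum A N x * ∑ y ∈ B, gk M (c + x) (d + y) * avSum B N y := by
  have hinj : ∀ (c : V4) (A : Finset V4), Set.InjOn (c + ·) (A : Set V4) :=
    fun c A => (add_right_injective c).injOn
  rw [energy, Finset.sum_image (hinj c A)]
  refine Finset.sum_congr rfl fun x _ => ?_
  rw [avSum_image_add, Finset.sum_image (hinj d B)]
  simp only [avSum_image_add]

lemma Es_gk_le (g M : ℕ) (a b : V4) :
    Es g (fun r => gk M a (b + r.sum)) ≤ 51200 / ((g : ℝ) + 1) := by
  have h : ∀ t, Es g (fun r => pk t a (b + r.sum)) = pk (g + t) b a := fun t => by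
    simp only [pk_symm t a]
    exact (Pn_add g t (fun y => ind (y = a)) b).symm
  simp only [gk, Es_sum, h]
  calc _ ≤ ∑ t ∈ Finset.range M, 25600 * (1 / ((g : ℝ) + t + 1) ^ 2) :=
        Finset.sum_le_sum fun t _ => (pk_le _ _ _).trans_eq (by push_cast; ring)
    _ ≤ 25600 * (2 / ((g : ℝ) + 1)) := by
        rw [← Finset.mul_sum]; exact mul_le_mul_of_nonneg_left (sum_inv_sq_le g M) (by norm_num)
    _ = _ := by ring

/-- The points visited by `s` in the time window `[u, u + w]`. -/
def winTrace (s : List V4) (u w : ℕ) : Finset V4 := (Finset.Icc u (u + w)).image (walk s)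

lemma winTrace_append {p q : List V4} (r : List V4) {w : ℕ} (hq : w ≤ q.length) :
    winTrace (p ++ (q ++ r)) p.length w = (trace q w).image (p.sum + ·) := by
  ext x
  simp only [winTrace, trace, Finset.mem_image, Finset.mem_Icc, Finset.mem_range]
  constructor
  · rintro ⟨i, hi, rfl⟩
    obtain ⟨j, rfl⟩ := Nat.exists_eq_add_of_le hi.1
    exact ⟨_, ⟨j, by omega, rfl⟩, by
      rw [walk_append_right, walk_append_left r (show j ≤ q.length by omega)]⟩
  · rintro ⟨_, ⟨j, hj, rfl⟩, rfl⟩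
    exact ⟨p.length + j, by omega, by
      rw [walk_append_right, walk_append_left r (show j ≤ q.length by omega)]⟩

lemma Es_energy_winTrace_le (u w g M N : ℕ) :
    Es (u + (w + (g + w))) (fun s => energy M N (winTrace s u w) (winTrace s (u + w + g) w)) ≤
      51200 / ((g : ℝ) + 1) * Es w (fun q => avMass (trace q w) N) ^ 2 := by
  rw [Es_append]
  refine Es_le_const fun p hp => ?_
  rw [Es_append]
  calc _ ≤ Es w (fun q => Es w fun q' =>
        51200 / ((g : ℝ) + 1) * (avMass (trace q w) N * avMass (trace q' w) N)) := by
        refine Es_mono fun q hq => ?_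
        rw [Es_append, Es_comm]
        refine Es_mono fun q' hq' => ?_
        have e : ∀ r, IsSteps g r → energy M N (winTrace (p ++ (q ++ (r ++ q'))) u w)
            (winTrace (p ++ (q ++ (r ++ q'))) (u + w + g) w) =
            ∑ x ∈ trace q w, avSum (trace q w) N x * ∑ y ∈ trace q' w,
              gk M (p.sum + x) (p.sum + q.sum + y + r.sum) * avSum (trace q' w) N y := by
          intro r hr
          have e1 := winTrace_append (p := p) (r ++ q') hq.1.ge
          have e2 := winTrace_append (p := p ++ q ++ r) [] hq'.1.ge
          rw [List.append_nil] at e2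
          have e3 : (p ++ q ++ r).length = u + w + g := by simp [hp.1, hq.1, hr.1, add_assoc]
          rw [e3] at e2
          rw [hp.1] at e1
          rw [e1, show p ++ (q ++ (r ++ q')) = p ++ q ++ r ++ q' by simp, e2, energy_image_add]
          refine Finset.sum_congr rfl fun x _ => ?_
          congr 1
          refine Finset.sum_congr rfl fun y _ => ?_
          congr 2
          simp only [List.sum_append]
          abel
        rw [Es_congr e]
        simp only [Es_sum, Es_mul_left, Es_mul_right]
        calc _ ≤ ∑ x ∈ trace q w, avSum (trace q w) N x * ∑ y ∈ trace q' w,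
              51200 / ((g : ℝ) + 1) * avSum (trace q' w) N y := by
              refine Finset.sum_le_sum fun x _ =>
                mul_le_mul_of_nonneg_left ?_ (avSum_nonneg _ _ _)
              exact Finset.sum_le_sum fun y _ =>
                mul_le_mul_of_nonneg_right (Es_gk_le _ _ _ _) (avSum_nonneg _ _ _)
          _ = _ := by
              rw [avMass, avMass, ← Finset.mul_sum, ← Finset.sum_mul]; ring
    _ = _ := by simp only [Es_mul_left, Es_mul_right]; ring

lemma sum_offDiag_le (B : ℕ) {f : ℕ → ℝ} (hf : ∀ i, 0 ≤ f i) :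
    ∑ i ∈ Finset.range B, ∑ j ∈ (Finset.range B).filter (· ≠ i), f ((i - j) + (j - i)) ≤
      2 * B * ∑ d ∈ (Finset.range B).filter (· ≠ 0), f d := by
  have h : ∀ i ∈ Finset.range B, ∑ j ∈ (Finset.range B).filter (· ≠ i), f ((i - j) + (j - i)) ≤
      2 * ∑ d ∈ (Finset.range B).filter (· ≠ 0), f d := by
    intro i hi
    rw [Finset.sum_filter, Finset.sum_filter]
    refine le_trans (Finset.sum_le_sum fun j _ => ?_)
      (sum_dist_le (f := fun d => if d ≠ 0 then f d else 0) (Finset.mem_range.1 hi) fun d => ?_)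
    · by_cases hj : j = i
      · simp [hj]
      · have : (i - j) + (j - i) ≠ 0 := by omega
        exact ((if_pos hj).trans (if_pos this).symm).le
    · split_ifs
      exacts [hf d, le_rfl]
  refine (Finset.sum_le_sum h).trans_eq ?_
  rw [Finset.sum_const, Finset.card_range, nsmul_eq_mul]
  ring

lemma sum_inv_le_one_add_log {B : ℕ} (hB : 1 ≤ B) :
    ∑ d ∈ (Finset.range B).filter (· ≠ 0), 1 / (d : ℝ) ≤ 1 + Real.log B := by
  obtain ⟨b, rfl⟩ := Nat.exists_eq_add_of_le' hB
  rw [Finset.sum_filter, Finset.sum_range_succ']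
  have h := sum_inv_succ_le b
  have hm : ∑ i ∈ Finset.range b, 1 / ((i : ℝ) + 1) ≤ ∑ i ∈ Finset.range (b + 1), 1 / ((i : ℝ) + 1) :=
    Finset.sum_le_sum_of_subset_of_nonneg (Finset.range_mono (by omega)) fun i _ _ => by positivity
  simp only [ne_eq, Nat.add_eq_zero_iff, one_ne_zero, and_false, not_false_eq_true, if_true,
    not_true_eq_false, if_false, add_zero, Nat.cast_add, Nat.cast_one]
  linarith

/-- The total mutual energy of distinct blocks of length `4a`, spaced by `8a`. -/
lemma exists_Es_sum_energy_le : ∃ C : ℝ, 0 < C ∧ ∃ a₀ : ℕ, ∀ a ≥ a₀, ∀ B : ℕ, 1 ≤ B →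
    ∀ M n : ℕ, 8 * a * B ≤ n → Es n (fun s => ∑ i ∈ Finset.range B,
      ∑ j ∈ (Finset.range B).filter (· ≠ i), energy M (8 * a)
        (winTrace s (8 * a * i) (4 * a)) (winTrace s (8 * a * j) (4 * a))) ≤
      C * ((a : ℝ) ^ 3 * B * (1 + Real.log B) / Real.log a ^ 2) := by
  obtain ⟨C, hC, b₀, h⟩ := exists_Es_avMass_le
  refine ⟨25600 * (16 * C) ^ 2, by positivity, max b₀ 3, fun a ha B hB M n hn => ?_⟩
  have ha0 : b₀ ≤ a := (le_max_left _ _).trans ha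
  have ha3 : 3 ≤ a := (le_max_right _ _).trans ha
  have har : (3 : ℝ) ≤ a := by exact_mod_cast ha3
  have hl := (log_add_one_le ha3).1
  set l := Real.log a with hldef
  have hmass : Es (4 * a) (fun q => avMass (trace q (4 * a)) (8 * a)) ≤ 16 * C * a ^ 2 / l := by
    refine (h (4 * a) (by omega) (8 * a) (by omega) (by omega)).trans ?_
    push_cast
    rw [show C * (4 * (a : ℝ)) ^ 2 = 16 * C * a ^ 2 by ring]
    refine div_le_div_of_nonneg_left (by positivity) (by linarith)
      (Real.log_le_log (by linarith) (by linarith))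
  have hmass0 : 0 ≤ Es (4 * a) (fun q => avMass (trace q (4 * a)) (8 * a)) :=
    Es_nonneg fun _ _ => avMass_nonneg _ _
  have hlt : ∀ i j, i < j → j < B → Es n (fun s => energy M (8 * a)
      (winTrace s (8 * a * i) (4 * a)) (winTrace s (8 * a * j) (4 * a))) ≤
      51200 / (4 * a * (j - i : ℕ)) * (16 * C * a ^ 2 / l) ^ 2 := by
    intro i j hij hj
    obtain ⟨d, rfl⟩ := Nat.exists_eq_add_of_lt hij
    set g := 8 * a * d + 4 * a with hg
    have hle : 8 * a * i + (4 * a + (g + 4 * a)) ≤ n := by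
      have : 8 * a * (i + d + 1 + 1) ≤ 8 * a * B := Nat.mul_le_mul_left _ (by omega)
      rw [hg]; linarith
    have e : 8 * a * (i + d + 1) = 8 * a * i + 4 * a + g := by rw [hg]; ring
    rw [e]
    have h1 := Es_energy_winTrace_le (8 * a * i) (4 * a) g M (8 * a)
    rw [← Es_take hle] at h1
    have e2 : ∀ s : List V4, ∀ u w, u + w ≤ 8 * a * i + (4 * a + (g + 4 * a)) →
        winTrace (s.take (8 * a * i + (4 * a + (g + 4 * a)))) u w = winTrace s u w := by
      intro s u w h
      exact Finset.image_congr fun t ht => walk_take ((Finset.mem_Icc.1 ht).2.trans h)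
    simp only [e2 _ (8 * a * i) (4 * a) (by omega),
      e2 _ (8 * a * i + 4 * a + g) (4 * a) (by omega)] at h1
    refine h1.trans ?_
    have hd : ((i + d + 1 - i : ℕ) : ℝ) = d + 1 := by
      rw [show i + d + 1 - i = d + 1 by omega]; push_cast; ring
    rw [hd]
    refine mul_le_mul ?_ (pow_le_pow_left₀ hmass0 hmass 2) (sq_nonneg _) (by positivity)
    refine div_le_div_of_nonneg_left (by norm_num) (by positivity) ?_
    rw [hg]; push_cast
    nlinarith [Nat.cast_nonneg (α := ℝ) d]
  have hne : ∀ i j, i ≠ j → i < B → j < B → Es n (fun s => energy M (8 * a)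
      (winTrace s (8 * a * i) (4 * a)) (winTrace s (8 * a * j) (4 * a))) ≤
      (12800 / a * (16 * C * a ^ 2 / l) ^ 2) * (1 / ((i - j) + (j - i) : ℕ)) := by
    intro i j hij hi hj
    rcases lt_or_gt_of_ne hij with h | h
    · refine (hlt i j h hj).trans_eq ?_
      rw [show (i - j) + (j - i) = j - i by omega]
      have : ((j - i : ℕ) : ℝ) ≠ 0 := by exact_mod_cast (show j - i ≠ 0 by omega)
      field_simp; norm_num
    · simp only [energy_symm _ _ (winTrace _ (8 * a * i) _)]
      refine (hlt j i h hi).trans_eq ?_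
      rw [show (i - j) + (j - i) = i - j by omega]
      have : ((i - j : ℕ) : ℝ) ≠ 0 := by exact_mod_cast (show i - j ≠ 0 by omega)
      field_simp; norm_num
  set K := 12800 / a * (16 * C * a ^ 2 / l) ^ 2 with hK
  have hK0 : 0 ≤ K := by positivity
  simp only [Es_sum]
  calc _ ≤ ∑ i ∈ Finset.range B, ∑ j ∈ (Finset.range B).filter (· ≠ i),
        K * (1 / (((i - j) + (j - i) : ℕ) : ℝ)) := by
        refine Finset.sum_le_sum fun i hi => Finset.sum_le_sum fun j hj => ?_
        have hj := Finset.mem_filter.1 hj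
        exact hne i j hj.2.symm (Finset.mem_range.1 hi) (Finset.mem_range.1 hj.1)
    _ ≤ 2 * B * ∑ d ∈ (Finset.range B).filter (· ≠ 0), K * (1 / (d : ℝ)) :=
        sum_offDiag_le B (f := fun d : ℕ => K * (1 / (d : ℝ))) fun d => by positivity
    _ ≤ 2 * B * (K * (1 + Real.log B)) := by
        rw [← Finset.mul_sum]
        exact mul_le_mul_of_nonneg_left (mul_le_mul_of_nonneg_left (sum_inv_le_one_add_log hB) hK0)
          (by positivity)
    _ = _ := by rw [hK]; field_simp; ring

/-! ### Most blocks carry mass -/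

lemma freshPts_congr {a : ℕ} {f g : ℕ → V4} {s : ℕ} (h : ∀ i ≤ s + 4 * a, f i = g i) :
    freshPts a f s = freshPts a g s := by
  have h1 : (Finset.Icc s (s + 2 * a)).image f = (Finset.Icc s (s + 2 * a)).image g :=
    Finset.image_congr fun i hi => h i (by have := (Finset.mem_Icc.1 hi).2; omega)
  rw [freshPts, freshPts, h1, lew_congr fun i hi => h i (show i ≤ s + 4 * a by omega)]
  refine Finset.filter_congr fun v _ => and_congr ?_ ?_
  · exact forall₂_congr fun i hi => by rw [h i (by omega)]
  · exact exists_congr fun l => and_congr_right fun _ =>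
      forall₃_congr fun r _ hr => by rw [h r hr]

lemma freshPts_subset_winTrace (a : ℕ) (s : List V4) (u : ℕ) :
    freshPts a (walk s) u ⊆ winTrace s u (4 * a) := fun _ hx =>
  Finset.image_subset_image (Finset.Icc_subset_Icc_right (by omega)) (Finset.mem_filter.1 hx).1

lemma card_freshPts_le (a : ℕ) (f : ℕ → V4) (u : ℕ) : (freshPts a f u).card ≤ 2 * a + 1 :=
  (Finset.card_filter_le _ _).trans (Finset.card_image_le.trans (by simp; omega))

/-- The normalised mass of the fresh points of the `i`-th block. -/
def blkMass (a : ℕ) (s : List V4) (i : ℕ) : ℝ :=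
  min 1 (avMass (freshPts a (walk s) (8 * a * i)) (8 * a) /
    ((1 / 1228800) * ((a : ℝ) ^ 2 / Real.log a)))

/-- The indicator that the `i`-th block is likely to meet its past. -/
def blkBad (a : ℕ) (s : List V4) (i : ℕ) : ℝ := ind (1 / 4 < meetPast a (s.take (8 * a * i)))

lemma exp_neg_le {z : ℝ} (h0 : 0 ≤ z) (h1 : z ≤ 1) : Real.exp (-z) ≤ 1 - z / 2 := by
  rw [Real.exp_neg]
  have h := Real.add_one_le_exp z
  rw [inv_le_iff_one_le_mul₀ (Real.exp_pos z)]
  nlinarith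

lemma Es_exp_blockMass_le {a : ℕ} (ha : 3 ≤ a) (p : List V4) :
    Es (8 * a) (fun q => Real.exp (-(blockMass a p (q.take (4 * a)) +
      ind (1 / 4 < meetPast a p)))) ≤ Real.exp (-(1 / 16)) := by
  by_cases hp : 1 / 4 < meetPast a p
  · refine Es_le_const fun q _ => Real.exp_le_exp.2 ?_
    rw [ind_true hp]
    linarith [blockMass_nonneg a p (q.take (4 * a))]
  · simp only [ind_false hp, add_zero]
    rw [Es_take (show 4 * a ≤ 8 * a by omega) fun q => Real.exp (-blockMass a p q)]
    calc _ ≤ Es (4 * a) (fun q => 1 - blockMass a p q / 2) :=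
          Es_mono fun q _ => exp_neg_le (blockMass_nonneg a p q) (blockMass_le_one a p q)
      _ = 1 - Es (4 * a) (blockMass a p) / 2 := by rw [Es_sub, Es_const, Es_div]
      _ ≤ -(1 / 16) + 1 := by linarith [Es_blockMass_ge ha (not_lt.1 hp)]
      _ ≤ _ := Real.add_one_le_exp _

lemma Es_blkMass_sum_lt_le {a : ℕ} (ha : 3 ≤ a) (B : ℕ) {n : ℕ} (hn : 8 * a * B ≤ n) :
    Es n (fun s => ind (∑ i ∈ Finset.range B, (blkMass a s i + blkBad a s i) < (B : ℝ) / 32)) ≤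
      Real.exp (-((B : ℝ) / 32)) := by
  set z : List V4 → List V4 → ℝ := fun p q =>
    blockMass a p (q.take (4 * a)) + ind (1 / 4 < meetPast a p) with hz
  have h2 := Es_prod_blocks_le (Real.exp_nonneg _)
    (fun p q => (Real.exp_nonneg (-z p q))) (Es_exp_blockMass_le ha) 0 B
  have hB : 0 + B * (8 * a) ≤ n := by linarith
  rw [← Es_take hB] at h2
  have key : ∀ s, IsSteps n s → ∑ i ∈ Finset.range B, (blkMass a s i + blkBad a s i) =
      ∑ i ∈ Finset.range B, z ((s.take (0 + B * (8 * a))).take (0 + i * (8 * a)))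
        (((s.take (0 + B * (8 * a))).drop (0 + i * (8 * a))).take (8 * a)) := by
    intro s hs
    refine Finset.sum_congr rfl fun i hi => ?_
    have hi := Finset.mem_range.1 hi
    have hle : i * (8 * a) + 8 * a ≤ B * (8 * a) := by
      calc i * (8 * a) + 8 * a = (i + 1) * (8 * a) := by ring
        _ ≤ _ := Nat.mul_le_mul_right _ hi
    have e0 : 8 * a * i = i * (8 * a) := by ring
    have hlen : (s.take (i * (8 * a))).length = i * (8 * a) := by
      rw [List.length_take, hs.1]; omega
    have e1 : (s.take (0 + B * (8 * a))).take (0 + i * (8 * a)) = s.take (i * (8 * a)) := by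
      rw [List.take_take]; congr 1; omega
    have e2 : (((s.take (0 + B * (8 * a))).drop (0 + i * (8 * a))).take (8 * a)).take (4 * a) =
        (s.drop (i * (8 * a))).take (4 * a) := by
      simp only [zero_add, List.take_take, List.drop_take]; congr 1; omega
    rw [hz, blkMass, blkBad]
    simp only [e1, e2, blockMass, e0, hlen]
    rw [← List.take_add, freshPts_congr (f := walk (s.take _)) (g := walk s)
      fun i hi => walk_take hi]
  calc _ ≤ Es n (fun s => (∏ i ∈ Finset.range B,
          Real.exp (-z ((s.take (0 + B * (8 * a))).take (0 + i * (8 * a)))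
        (((s.take (0 + B * (8 * a))).drop (0 + i * (8 * a))).take (8 * a)))) *
          Real.exp ((B : ℝ) / 32)) := by
        refine Es_mono fun s hs => ?_
        by_cases hp : ∑ i ∈ Finset.range B, (blkMass a s i + blkBad a s i) < (B : ℝ) / 32
        · rw [ind_true hp, ← Real.exp_sum, ← Real.exp_add, Finset.sum_neg_distrib, ← key s hs]
          exact Real.one_le_exp (by linarith)
        · rw [ind_false hp]
          exact mul_nonneg (Finset.prod_nonneg fun _ _ => Real.exp_nonneg _) (Real.exp_nonneg _)
    _ ≤ Real.exp (-(1 / 16)) ^ B * Real.exp ((B : ℝ) / 32) := by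
        rw [Es_mul_right]
        exact mul_le_mul_of_nonneg_right h2 (Real.exp_nonneg _)
    _ = _ := by rw [← Real.exp_nat_mul, ← Real.exp_add]; congr 1; ring

/-- The path returns after time `8ai + 4a` to a point visited before time `8ai + 2a`. -/
def Returns (a : ℕ) (f : ℕ → V4) (T i : ℕ) : Prop :=
  ∃ u ≤ 8 * a * i + 2 * a, ∃ j ≤ T, f u = f (8 * a * i + 4 * a + j)

/-- There is a constant bounding the expected numbers of bad and returning blocks. -/
lemma exists_Es_blkBad_le : ∃ C : ℝ, 0 < C ∧ ∀ m : ℕ, 2 ≤ m → ∀ B : ℕ, 1 ≤ B →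
    16 * (B : ℝ) ≤ (m : ℝ) ^ (1 / 8 : ℝ) → ∀ T n : ℕ, 8 * (2 * m) * B + T ≤ n →
    Es n (fun s => ∑ i ∈ Finset.range B, blkBad (2 * m) s i) ≤
        C * (B * (1 + Real.log (16 * B)) / Real.log m) ∧
    Es n (fun s => ∑ i ∈ Finset.range B, ind (Returns (2 * m) (walk s) T i)) ≤
        C * (B * (1 + Real.log (16 * B)) / Real.log m) := by
  obtain ⟨C, hC, h⟩ := exists_Es_cross_le
  refine ⟨4 * C, by positivity, fun m hm B hB hBm T n hn => ?_⟩
  have hB1 : (1 : ℝ) ≤ B := by exact_mod_cast hB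
  have hm1 : (1 : ℝ) < m := by exact_mod_cast (show 1 < m by omega)
  have hl : 0 < Real.log m := Real.log_pos hm1
  have hl2 : 0 ≤ Real.log (16 * B) := Real.log_nonneg (by linarith)
  have hu : ∀ i < B, ((8 * (2 * m) * i + 4 * m : ℕ) : ℝ) ≤ m * (16 * B) := fun i hi => by
    have h1 : (i : ℝ) + 1 ≤ B := by exact_mod_cast hi
    push_cast
    nlinarith
  have hn' : ∀ i < B, 8 * (2 * m) * i + 16 * m + T ≤ n := fun i hi => by
    have : 8 * (2 * m) * (i + 1) ≤ 8 * (2 * m) * B := Nat.mul_le_mul_left _ hi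
    linarith
  set K := C * (1 + Real.log (16 * B)) / Real.log m with hK
  have hK0 : 0 ≤ K := by positivity
  have hsum : ∀ F : ℕ → ℝ, (∀ i < B, F i ≤ 4 * K) →
      ∑ i ∈ Finset.range B, F i ≤ 4 * C * (B * (1 + Real.log (16 * B)) / Real.log m) := by
    intro F hF
    refine (Finset.sum_le_sum fun i hi => hF i (Finset.mem_range.1 hi)).trans_eq ?_
    simp [hK]; ring
  simp only [Es_sum]
  refine ⟨hsum _ fun i hi => ?_, hsum _ fun i hi => ?_⟩
  · have hle : 8 * (2 * m) * i + 4 * (2 * m) ≤ n := by have := hn' i hi; omega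
    calc _ ≤ Es n (fun s => 4 * meetPast (2 * m) (s.take (8 * (2 * m) * i))) := by
          refine Es_mono fun s _ => ?_
          by_cases hp : 1 / 4 < meetPast (2 * m) (s.take (8 * (2 * m) * i))
          · rw [blkBad, ind_true hp]; linarith
          · rw [blkBad, ind_false hp]
            exact mul_nonneg (by norm_num) (Es_nonneg fun _ _ => ind_nonneg _)
      _ = 4 * Es (8 * (2 * m) * i + 4 * (2 * m)) (fun s => ind (∃ i' ≤ 8 * (2 * m) * i,
            ∃ r ≤ 3 * (2 * m), walk s i' = walk s (8 * (2 * m) * i + 2 * m + r))) := by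
          rw [Es_mul_left, Es_take (show 8 * (2 * m) * i ≤ n by omega), Es_append]
          congr 1
          refine Es_congr fun p hp => ?_
          rw [meetPast, hp.1]
      _ ≤ 4 * K := by
          have := h m hm (16 * B) (by linarith) hBm (8 * (2 * m) * i)
            (le_trans (by exact_mod_cast Nat.le_add_right _ _) (hu i hi)) (3 * (2 * m))
          rw [show 8 * (2 * m) * i + 2 * m + 3 * (2 * m) = 8 * (2 * m) * i + 4 * (2 * m) by ring]
            at this
          linarith
  · have hle : 8 * (2 * m) * i + 4 * m + 2 * m + (2 * m + T) ≤ n := by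
      have := hn' i hi; omega
    have := h m hm (16 * B) (by linarith) hBm _ (hu i hi) (2 * m + T)
    rw [← Es_take hle] at this
    refine le_trans (Es_mono fun s hs => ind_mono ?_) (this.trans (by linarith))
    rintro ⟨u, hu, j, hj, e⟩
    refine ⟨u, by omega, 2 * m + j, by omega, ?_⟩
    rw [walk_take (by omega), walk_take (by omega), e]
    congr 1
    ring

/-! ### Capacity of a union of weakly interacting sets -/

lemma sum_biUnion_ind {J : Finset ℕ} {G : ℕ → Finset V4} (φ : V4 → ℝ) (F : ℕ → V4 → ℝ) :
    ∑ x ∈ J.biUnion G, φ x * ∑ i ∈ J, ind (x ∈ G i) * F i x =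
      ∑ i ∈ J, ∑ x ∈ G i, φ x * F i x := by
  simp only [Finset.mul_sum]
  rw [Finset.sum_comm]
  refine Finset.sum_congr rfl fun i hi => ?_
  rw [← Finset.sum_subset (Finset.subset_biUnion_of_mem G hi) fun x _ hx => by
    rw [ind_false hx]; ring]
  exact Finset.sum_congr rfl fun x hx => by rw [ind_true hx]; ring

lemma cap4_biUnion_ge {J : Finset ℕ} {A : ℕ → Finset V4} {N M : ℕ} {t μ Θ : ℝ} (ht : 0 < t)
    (hcard : ∀ i ∈ J, (A i).card ≤ N + 1) (hμ : μ ≤ ∑ i ∈ J, avMass (A i) N)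
    (hΘ : ∑ i ∈ J, avMass (A i) N ≤ Θ)
    (hE : ∑ i ∈ J, ∑ j ∈ J.filter (· ≠ i), energy M N (A i) (A j) ≤ t * (μ / 2)) :
    4 * μ ≤ (51202 * ((N : ℝ) + 1) + t + 51200 / ((M : ℝ) + 1) * Θ) *
      cap4 (J.biUnion A : Finset V4) := by
  set cross : ℕ → V4 → ℝ := fun i y =>
    ∑ j ∈ J.filter (· ≠ i), ∑ x ∈ A j, gk M y x * avSum (A j) N x with hcross
  set G : ℕ → Finset V4 := fun i => (A i).filter fun y => cross i y ≤ t with hG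
  set f : V4 → ℝ := fun x => ∑ i ∈ J, ind (x ∈ G i) * avSum (A i) N x with hf
  have hGA : ∀ i, G i ⊆ A i := fun i => Finset.filter_subset _ _
  have hcross0 : ∀ i y, 0 ≤ cross i y := fun i y => Finset.sum_nonneg fun j _ =>
    Finset.sum_nonneg fun x _ => mul_nonneg (gk_nonneg _ _ _) (avSum_nonneg _ _ _)
  have hf0 : ∀ x, 0 ≤ f x := fun x => Finset.sum_nonneg fun i _ =>
    mul_nonneg (ind_nonneg _) (avSum_nonneg _ _ _)
  have hfsum : ∑ x ∈ J.biUnion G, f x = ∑ i ∈ J, ∑ x ∈ G i, avSum (A i) N x := by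
    have := sum_biUnion_ind (J := J) (G := G) (fun _ => 1) fun i x => avSum (A i) N x
    simpa using this
  have hpot : ∀ M', ∀ y ∈ J.biUnion G, ∑ x ∈ J.biUnion G, gk M' y x * f x ≤
      51202 * ((N : ℝ) + 1) + t + 51200 / ((M : ℝ) + 1) * Θ := by
    intro M' y hy
    obtain ⟨i, hi, hyi⟩ := Finset.mem_biUnion.1 hy
    have h1 : ∑ x ∈ J.biUnion G, gk M y x * f x ≤ 51202 * ((N : ℝ) + 1) + t := by
      rw [hf, sum_biUnion_ind, ← Finset.add_sum_erase J _ hi]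
      refine add_le_add ?_ ?_
      · exact (Finset.sum_le_sum_of_subset_of_nonneg (hGA i) fun x _ _ =>
          mul_nonneg (gk_nonneg _ _ _) (avSum_nonneg _ _ _)).trans
          (sum_gk_avSum_le (hcard i hi) M y)
      · refine le_trans ?_ (Finset.mem_filter.1 hyi).2
        have e : J.erase i = J.filter (· ≠ i) := by
          ext j; simp [Finset.mem_erase, and_comm]
        rw [e]
        exact Finset.sum_le_sum fun j _ => Finset.sum_le_sum_of_subset_of_nonneg (hGA j)
          fun x _ _ => mul_nonneg (gk_nonneg _ _ _) (avSum_nonneg _ _ _)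
    have h2 : ∑ x ∈ J.biUnion G, f x ≤ Θ := by
      rw [hfsum]
      refine le_trans (Finset.sum_le_sum fun i _ => ?_) hΘ
      exact Finset.sum_le_sum_of_subset_of_nonneg (hGA i) fun x _ _ => avSum_nonneg _ _ _
    calc _ ≤ ∑ x ∈ J.biUnion G, (gk M y x + 51200 / ((M : ℝ) + 1)) * f x :=
          Finset.sum_le_sum fun x _ => mul_le_mul_of_nonneg_right (gk_le_add M M' y x) (hf0 x)
      _ = ∑ x ∈ J.biUnion G, gk M y x * f x +
            51200 / ((M : ℝ) + 1) * ∑ x ∈ J.biUnion G, f x := by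
          simp only [add_mul, Finset.sum_add_distrib, Finset.mul_sum]
      _ ≤ _ := add_le_add h1 (mul_le_mul_of_nonneg_left h2 (by positivity))
  have hmass : μ / 2 ≤ ∑ x ∈ J.biUnion G, f x := by
    rw [hfsum]
    have h1 : ∀ i ∈ J, avMass (A i) N - (∑ j ∈ J.filter (· ≠ i), energy M N (A i) (A j)) / t ≤
        ∑ x ∈ G i, avSum (A i) N x := by
      intro i _
      have e : ∑ j ∈ J.filter (· ≠ i), energy M N (A i) (A j) =
          ∑ x ∈ A i, avSum (A i) N x * cross i x := by
        simp only [hcross, energy]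
        rw [Finset.sum_comm]
        simp only [Finset.mul_sum]
      rw [e, Finset.sum_div, avMass, ← Finset.sum_sub_distrib, hG, Finset.sum_filter]
      refine Finset.sum_le_sum fun x _ => ?_
      have h0 := avSum_nonneg (A i) N x
      split_ifs with hx
      · have := div_nonneg (mul_nonneg h0 (hcross0 i x)) ht.le
        linarith
      · rw [sub_nonpos, le_div_iff₀ ht]
        exact mul_le_mul_of_nonneg_left (not_le.1 hx).le h0
    have h2 := Finset.sum_le_sum h1
    rw [Finset.sum_sub_distrib, ← Finset.sum_div] at h2
    have h3 := div_le_div_of_nonneg_right hE ht.le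
    rw [mul_div_cancel_left₀ _ ht.ne'] at h3
    linarith
  have hc := le_cap4 (fun x _ => hf0 x) hpot
  have hsub : J.biUnion G ⊆ J.biUnion A := Finset.biUnion_mono fun i _ => hGA i
  have hΘ0 : 0 ≤ Θ := (Finset.sum_nonneg fun i _ => avMass_nonneg _ _).trans hΘ
  have := mul_le_mul_of_nonneg_left (cap4_mono hsub)
    (show 0 ≤ 51202 * ((N : ℝ) + 1) + t + 51200 / ((M : ℝ) + 1) * Θ by positivity)
  linarith

/-- The fresh points of the first `B` blocks to whose past the path does not return. -/
def stablePts (a B : ℕ) (f : ℕ → V4) (T : ℕ) : Finset V4 :=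
  ((Finset.range B).filter fun i => ¬Returns a f T i).biUnion fun i => freshPts a f (8 * a * i)

lemma avMass_freshPts_le (a : ℕ) (ha : 1 ≤ a) (f : ℕ → V4) (u : ℕ) :
    avMass (freshPts a f u) (8 * a) ≤ 27 * (a : ℝ) ^ 2 := by
  have ha1 : (1 : ℝ) ≤ a := by exact_mod_cast ha
  have hc : ((freshPts a f u).card : ℝ) ≤ 2 * a + 1 := by exact_mod_cast card_freshPts_le a f u
  calc avMass (freshPts a f u) (8 * a) ≤ ∑ x ∈ freshPts a f u, (((8 * a : ℕ) : ℝ) + 1) :=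
        Finset.sum_le_sum fun x _ => avSum_le _ _ _
    _ = (freshPts a f u).card * (8 * a + 1) := by simp; ring
    _ ≤ (2 * a + 1) * (8 * a + 1) := mul_le_mul_of_nonneg_right hc (by positivity)
    _ ≤ _ := by nlinarith

/-- If most blocks carry mass, few of them are bad or return, and the mutual energy is small,
then the stable points have large capacity. -/
lemma cap4_stablePts_ge {a B T : ℕ} (ha : 3 ≤ a) (hB : 1 ≤ B) {s : List V4}
    (h1 : (B : ℝ) / 32 ≤ ∑ i ∈ Finset.range B, (blkMass a s i + blkBad a s i))
    (h2 : ∑ i ∈ Finset.range B, blkBad a s i ≤ (B : ℝ) / 128)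
    (h3 : ∑ i ∈ Finset.range B, ind (Returns a (walk s) T i) ≤ (B : ℝ) / 128)
    (h4 : ∑ i ∈ Finset.range B, ∑ j ∈ (Finset.range B).filter (· ≠ i),
      energy (a * B + 8 * a + 8 * a) (8 * a) (winTrace s (8 * a * i) (4 * a))
        (winTrace s (8 * a * j) (4 * a)) ≤ (a : ℝ) ^ 3 * B / Real.log a / 157286400) :
    (a : ℝ) * B / Real.log a ≤ 10 ^ 14 * cap4 (stablePts a B (walk s) T : Finset V4) := by
  have ha1 : (3 : ℝ) ≤ a := by exact_mod_cast ha
  have hB1 : (1 : ℝ) ≤ B := by exact_mod_cast hB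
  have hl := (log_add_one_le ha).1
  set l := Real.log a with hldef
  set J := (Finset.range B).filter fun i => ¬Returns a (walk s) T i with hJ
  set A : ℕ → Finset V4 := fun i => freshPts a (walk s) (8 * a * i) with hA
  have hw : 0 < 1 / 1228800 * ((a : ℝ) ^ 2 / l) := by positivity
  have hmass : (B : ℝ) / 64 * (1 / 1228800 * ((a : ℝ) ^ 2 / l)) ≤
      ∑ i ∈ J, avMass (A i) (8 * a) := by
    have hJsum : (B : ℝ) / 64 ≤ ∑ i ∈ J, blkMass a s i := by
      rw [hJ, Finset.sum_filter]
      have : ∑ i ∈ Finset.range B, (blkMass a s i - ind (Returns a (walk s) T i)) ≤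
          ∑ i ∈ Finset.range B, if ¬Returns a (walk s) T i then blkMass a s i else 0 := by
        refine Finset.sum_le_sum fun i _ => ?_
        have hle : blkMass a s i ≤ 1 := min_le_left _ _
        split_ifs with h
        · rw [ind_true h]; linarith
        · rw [ind_false h, sub_zero]
      rw [Finset.sum_sub_distrib] at this
      rw [Finset.sum_add_distrib] at h1
      linarith
    refine (mul_le_mul_of_nonneg_right hJsum hw.le).trans ?_
    rw [Finset.sum_mul]
    refine Finset.sum_le_sum fun i _ => ?_
    rw [← le_div_iff₀ hw]
    exact min_le_right _ _
  have hΘ : ∑ i ∈ J, avMass (A i) (8 * a) ≤ 27 * (a : ℝ) ^ 2 * B := by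
    calc _ ≤ ∑ i ∈ J, 27 * (a : ℝ) ^ 2 :=
          Finset.sum_le_sum fun i _ => avMass_freshPts_le a (by omega) _ _
      _ ≤ ∑ i ∈ Finset.range B, 27 * (a : ℝ) ^ 2 :=
          Finset.sum_le_sum_of_subset_of_nonneg (Finset.filter_subset _ _)
            fun _ _ _ => by positivity
      _ = _ := by simp; ring
  have hE : ∑ i ∈ J, ∑ j ∈ J.filter (· ≠ i), energy (a * B) (8 * a) (A i) (A j) ≤
      a * ((B : ℝ) / 64 * (1 / 1228800 * ((a : ℝ) ^ 2 / l)) / 2) := by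
    calc _ ≤ ∑ i ∈ J, ∑ j ∈ J.filter (· ≠ i), energy (a * B + 8 * a + 8 * a) (8 * a)
            (winTrace s (8 * a * i) (4 * a)) (winTrace s (8 * a * j) (4 * a)) :=
          Finset.sum_le_sum fun i _ => Finset.sum_le_sum fun j _ =>
            energy_mono (freshPts_subset_winTrace _ _ _) (freshPts_subset_winTrace _ _ _) _ _
      _ ≤ ∑ i ∈ Finset.range B, ∑ j ∈ (Finset.range B).filter (· ≠ i),
            energy (a * B + 8 * a + 8 * a) (8 * a)
            (winTrace s (8 * a * i) (4 * a)) (winTrace s (8 * a * j) (4 * a)) := by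
          refine (Finset.sum_le_sum fun i _ => Finset.sum_le_sum_of_subset_of_nonneg
            (Finset.filter_subset_filter _ (Finset.filter_subset _ _))
            fun _ _ _ => energy_nonneg _ _ _ _).trans
            (Finset.sum_le_sum_of_subset_of_nonneg (Finset.filter_subset _ _)
            fun _ _ _ => Finset.sum_nonneg fun _ _ => energy_nonneg _ _ _ _)
      _ ≤ _ := h4
      _ = _ := by ring
  have hcap := cap4_biUnion_ge (J := J) (A := A) (N := 8 * a) (M := a * B)
    (t := a) (by linarith) (fun i _ => (card_freshPts_le _ _ _).trans (by omega)) hmass hΘ hE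
  have hcap0 : 0 ≤ cap4 (J.biUnion A : Finset V4) := cap4_nonneg _
  have hc : 51202 * (((8 * a : ℕ) : ℝ) + 1) + a +
      51200 / (((a * B : ℕ) : ℝ) + 1) * (27 * (a : ℝ) ^ 2 * B) ≤ 2000000 * a := by
    have : 51200 / (((a * B : ℕ) : ℝ) + 1) * (27 * (a : ℝ) ^ 2 * B) ≤ 1382400 * a := by
      rw [div_mul_eq_mul_div, div_le_iff₀ (by positivity)]
      push_cast
      nlinarith
    push_cast at this ⊢
    linarith
  have h5 := hcap.trans (mul_le_mul_of_nonneg_right hc hcap0)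
  change _ ≤ 10 ^ 14 * cap4 (J.biUnion A : Finset V4)
  have h6 : 4 * ((B : ℝ) / 64 * (1 / 1228800 * ((a : ℝ) ^ 2 / l))) =
      a * (a * B / l / 19660800) := by ring
  rw [h6, show 2000000 * (a : ℝ) * cap4 (J.biUnion A : Finset V4) =
    a * (2000000 * cap4 (J.biUnion A : Finset V4)) by ring] at h5
  have h7 := le_of_mul_le_mul_left h5 (by linarith)
  linarith

lemma exists_Es_cap4_stablePts_le : ∃ c : ℝ, 0 < c ∧ ∃ C : ℝ, 0 < C ∧ ∃ m₀ : ℕ, ∀ m ≥ m₀, ∀ B : ℕ,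
    1 ≤ B → 16 * (B : ℝ) ≤ (m : ℝ) ^ (1 / 8 : ℝ) → ∀ T n : ℕ, 16 * m * B + T ≤ n →
    Es n (fun s => ind ((cap4 (stablePts (2 * m) B (walk s) T : Finset V4)) <
        c * (m * B / Real.log m))) ≤
      C * ((1 + Real.log (16 * B)) / Real.log m) + Real.exp (-((B : ℝ) / 32)) := by
  obtain ⟨C₁, hC₁, a₀, henergy⟩ := exists_Es_sum_energy_le
  obtain ⟨C₂, hC₂, hbad⟩ := exists_Es_blkBad_le
  refine ⟨1 / 10 ^ 14, by norm_num, 256 * C₂ + 157286400 * C₁, by positivity, max a₀ 3,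
    fun m hm B hB hBm T n hn => ?_⟩
  have hm3 : 3 ≤ m := (le_max_right _ _).trans hm
  have hm0 : a₀ ≤ m := (le_max_left _ _).trans hm
  have hB1 : (1 : ℝ) ≤ B := by exact_mod_cast hB
  have hmr : (3 : ℝ) ≤ m := by exact_mod_cast hm3
  have hn8 : 8 * (2 * m) * B + T ≤ n := by linarith
  have hlm := (log_add_one_le hm3).1
  have hlm2 : Real.log m ≤ Real.log (2 * m : ℕ) :=
    Real.log_le_log (by linarith) (by push_cast; linarith)
  have hl2m : Real.log (2 * m : ℕ) ≤ 2 * Real.log m := by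
    have : Real.log (2 * m : ℕ) ≤ Real.log ((m : ℝ) ^ 2) :=
      Real.log_le_log (by push_cast; linarith) (by push_cast; nlinarith)
    rwa [Real.log_pow] at this
  have hlB : Real.log B ≤ Real.log (16 * B) := Real.log_le_log (by linarith) (by linarith)
  have hlB0 : 0 ≤ Real.log B := Real.log_nonneg hB1
  obtain ⟨hb1, hb2⟩ := hbad m (by omega) B hB hBm T n hn8
  have hen := henergy (2 * m) (by omega) B hB (2 * m * B + 8 * (2 * m) + 8 * (2 * m)) n (by omega)
  set F₂ : List V4 → ℝ := fun s => ∑ i ∈ Finset.range B, blkBad (2 * m) s i with hF₂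
  set F₃ : List V4 → ℝ := fun s => ∑ i ∈ Finset.range B, ind (Returns (2 * m) (walk s) T i)
    with hF₃
  set F₄ : List V4 → ℝ := fun s => ∑ i ∈ Finset.range B, ∑ j ∈ (Finset.range B).filter (· ≠ i),
    energy (2 * m * B + 8 * (2 * m) + 8 * (2 * m)) (8 * (2 * m))
      (winTrace s (8 * (2 * m) * i) (4 * (2 * m))) (winTrace s (8 * (2 * m) * j) (4 * (2 * m)))
    with hF₄
  set E : ℝ := ((2 * m : ℕ) : ℝ) ^ 3 * B / Real.log (2 * m : ℕ) / 157286400 with hE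
  set L : ℝ := (1 + Real.log (16 * B)) / Real.log m with hL
  have hE0 : 0 < E := by
    have : 0 < Real.log (2 * m : ℕ) := by linarith
    rw [hE]; push_cast at this ⊢; positivity
  have hp2 : Es n (fun s => ind ((B : ℝ) / 128 ≤ F₂ s)) ≤ 128 * C₂ * L := by
    refine (Es_markov (by positivity) fun s _ => Finset.sum_nonneg fun i _ => ind_nonneg _).trans ?_
    rw [div_le_iff₀ (by positivity)]
    refine hb1.trans_eq ?_
    rw [hL]; ring
  have hp3 : Es n (fun s => ind ((B : ℝ) / 128 ≤ F₃ s)) ≤ 128 * C₂ * L := by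
    refine (Es_markov (by positivity) fun s _ => Finset.sum_nonneg fun i _ => ind_nonneg _).trans ?_
    rw [div_le_iff₀ (by positivity)]
    refine hb2.trans_eq ?_
    rw [hL]; ring
  have hp4 : Es n (fun s => ind (E ≤ F₄ s)) ≤ 157286400 * C₁ * L := by
    refine (Es_markov hE0 fun s _ => Finset.sum_nonneg fun i _ =>
      Finset.sum_nonneg fun j _ => energy_nonneg _ _ _ _).trans ?_
    rw [div_le_iff₀ hE0]
    refine hen.trans ?_
    have h0 : 0 < Real.log (2 * m : ℕ) := by linarith
    have h1 : (1 + Real.log B) / Real.log (2 * m : ℕ) ≤ L := by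
      rw [hL]; exact div_le_div₀ (by linarith) (by linarith) (by linarith) (by linarith)
    calc C₁ * (((2 * m : ℕ) : ℝ) ^ 3 * B * (1 + Real.log B) / Real.log (2 * m : ℕ) ^ 2)
        = 157286400 * C₁ * ((1 + Real.log B) / Real.log (2 * m : ℕ)) * E := by
          rw [hE]; field_simp
      _ ≤ _ := by gcongr
  have hpt : ∀ s, IsSteps n s → ind ((cap4 (stablePts (2 * m) B (walk s) T : Finset V4)) <
        1 / 10 ^ 14 * (m * B / Real.log m)) ≤
      ind (∑ i ∈ Finset.range B, (blkMass (2 * m) s i + blkBad (2 * m) s i) < (B : ℝ) / 32) +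
        (ind ((B : ℝ) / 128 ≤ F₂ s) + (ind ((B : ℝ) / 128 ≤ F₃ s) + ind (E ≤ F₄ s))) := by
    intro s _
    refine le_trans (ind_mono ?_) ((ind_or_le _ _).trans (add_le_add le_rfl
      ((ind_or_le _ _).trans (add_le_add le_rfl (ind_or_le _ _)))))
    intro hlt
    by_contra hno
    push Not at hno
    obtain ⟨n1, n2, n3, n4⟩ := hno
    have := cap4_stablePts_ge (T := T) (show 3 ≤ 2 * m by omega) hB n1 n2.le n3.le n4.le
    have h0 : 0 < Real.log (2 * m : ℕ) := by linarith
    have h5 : (m : ℝ) * B / Real.log m ≤ ((2 * m : ℕ) : ℝ) * B / Real.log (2 * m : ℕ) := by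
      rw [div_le_div_iff₀ (by linarith) h0]
      push_cast at hl2m ⊢
      have : 0 ≤ (m : ℝ) * B := by positivity
      nlinarith
    linarith
  refine (Es_mono hpt).trans ?_
  simp only [Es_add]
  have hp1 := Es_blkMass_sum_lt_le (show 3 ≤ 2 * m by omega) B (n := n) (by omega)
  linarith

/-! ### The loop erasure of a transient path -/

/-- A path visiting every point finitely often. -/
def IsTransient (f : ℕ → V4) : Prop := ∀ v, {k | f k = v}.Finite

/-- The last visit of `f` to the `i`-th point of its loop erasure. -/
def lastVisit (f : ℕ → V4) (i : ℕ) : ℕ := sSup {k | f k = f (ell f i)}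

lemma ell_succ (f : ℕ → V4) (i : ℕ) : ell f (i + 1) = lastVisit f i + 1 := rfl

namespace IsTransient

variable {f : ℕ → V4}

lemma apply_lastVisit (h : IsTransient f) (i : ℕ) : f (lastVisit f i) = f (ell f i) :=
  Nat.sSup_mem (s := {k | f k = f (ell f i)}) ⟨ell f i, rfl⟩ (h _).bddAbove

lemma le_lastVisit (h : IsTransient f) {i k : ℕ} (hk : f k = f (ell f i)) : k ≤ lastVisit f i :=
  le_csSup (h _).bddAbove hk

lemma strictMono_lastVisit (h : IsTransient f) : StrictMono (lastVisit f) :=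
  strictMono_nat_of_lt_succ fun i => (Nat.lt_succ_self _).trans_le
    ((ell_succ f i).symm.trans_le (h.le_lastVisit rfl))

end IsTransient

lemma lew_eq_of_isPrefix {f : ℕ → V4} {l : List V4} {T : ℕ} (h : l ++ [f T] <+: lew f T) :
    lew f T = l ++ [f T] := by
  obtain ⟨M, hM, hT⟩ : ∃ M : List V4, lew f T = M ++ [f T] ∧ f T ∉ M := by
    cases T with
    | zero => exact ⟨[], by simp [lew]⟩
    | succ T =>
      refine ⟨_, rfl, fun hm => ?_⟩
      simpa using List.mem_takeWhile_imp hm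
  rw [hM] at h ⊢
  rcases List.prefix_concat_iff.1 h with h | h
  · exact h.symm
  · exact absurd (h.subset (by simp)) hT

namespace IsTransient

variable {f : ℕ → V4}

lemma lew_lastVisit (h : IsTransient f) (i : ℕ) :
    lew f (lastVisit f i) = (List.range (i + 1)).map (fun j => f (ell f j)) ∧
      ∀ t, Survives f (lastVisit f i) t := by
  induction i with
  | zero =>
    have h1 : lew f (lastVisit f 0) = [f 0] := by
      have e : f (lastVisit f 0) = f 0 := h.apply_lastVisit 0
      have := prefix_concat_lew (f := f) (l := []) (v := f 0) (Nat.zero_le (lastVisit f 0))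
        (by simp [lew]) (by simp)
      rw [← e] at this ⊢
      exact lew_eq_of_isPrefix this
    refine ⟨by simpa [ell] using h1, fun t r hr _ hm => ?_⟩
    rw [h1, List.mem_singleton] at hm
    exact absurd (h.le_lastVisit (i := 0) hm) (by omega)
  | succ i ih =>
    obtain ⟨ih1, ih2⟩ := ih
    have e := h.apply_lastVisit (i + 1)
    have hlt : lastVisit f i < lastVisit f (i + 1) := h.strictMono_lastVisit (Nat.lt_succ_self i)
    have h1 : lew f (lastVisit f (i + 1)) = lew f (lastVisit f i) ++ [f (ell f (i + 1))] := by
      have := prefix_concat_lew (f := f) (l := lew f (lastVisit f i)) (v := f (ell f (i + 1)))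
        (k := lastVisit f i + 1) (T := lastVisit f (i + 1)) hlt ?_
        fun r h1 h2 => ih2 _ r (by omega) h2
      · rw [← e] at this ⊢
        exact lew_eq_of_isPrefix this
      · rw [lew, ell_succ]
        obtain h2 := prefix_takeWhile (List.prefix_rfl (l := lew f (lastVisit f i)))
          (ih2 _ (lastVisit f i + 1) (by omega) le_rfl)
        rw [← h2.eq_of_length_le (List.takeWhile_prefix _).length_le]
    refine ⟨by rw [h1, ih1, List.range_succ (n := i + 1)]; simp, fun t r hr ht hm => ?_⟩
    rw [h1, List.mem_append, List.mem_singleton] at hm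
    rcases hm with hm | hm
    · exact ih2 t r (by omega) ht hm
    · exact absurd (h.le_lastVisit hm) (by omega)

lemma mem_leSet_of_mem_lew (h : IsTransient f) {n : ℕ} {v : V4} (hv : v ∈ lew f (lastVisit f n)) :
    v ∈ leSet f n := by
  rw [(h.lew_lastVisit n).1, List.mem_map] at hv
  obtain ⟨j, hj, rfl⟩ := hv
  exact ⟨j, by have := List.mem_range.1 hj; omega, rfl⟩

lemma le_lastVisit_of_survivors (h : IsTransient f) {n S b : ℕ}
    (hs : ∑ k ∈ Finset.range S, ind (Survives f k (k + b)) < n + 1) : S ≤ lastVisit f n := by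
  by_contra! hlt
  rw [sum_ind] at hs
  have h1 : ((Finset.range (n + 1)).image (lastVisit f)).card = n + 1 := by
    rw [Finset.card_image_of_injective _ h.strictMono_lastVisit.injective, Finset.card_range]
  have h2 : (Finset.range (n + 1)).image (lastVisit f) ⊆
      (Finset.range S).filter fun k => Survives f k (k + b) := by
    intro k hk
    obtain ⟨i, hi, rfl⟩ := Finset.mem_image.1 hk
    refine Finset.mem_filter.2 ⟨Finset.mem_range.2 ?_, (h.lew_lastVisit i).2 _⟩
    exact (h.strictMono_lastVisit.monotone (by have := Finset.mem_range.1 hi; omega)).trans_lt hlt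
  have h3 := Finset.card_le_card h2
  rw [h1] at h3
  have : (n : ℝ) + 1 ≤ (((Finset.range S).filter fun k => Survives f k (k + b)).card : ℝ) := by
    exact_mod_cast h3
  linarith

end IsTransient

lemma Returns.mono {a i T T' : ℕ} {f : ℕ → V4} (h : Returns a f T i) (hT : T ≤ T') :
    Returns a f T' i := by
  obtain ⟨u, hu, j, hj, e⟩ := h
  exact ⟨u, hu, j, hj.trans hT, e⟩

lemma stablePts_anti (a B : ℕ) (f : ℕ → V4) {T T' : ℕ} (hT : T ≤ T') :
    stablePts a B f T' ⊆ stablePts a B f T :=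
  Finset.biUnion_subset_biUnion_of_subset_left _
    (Finset.monotone_filter_right _ fun _ _ h hr => h (hr.mono hT))

lemma stablePts_congr {a B T : ℕ} {f g : ℕ → V4} (h : ∀ i ≤ 8 * a * B + T, f i = g i) :
    stablePts a B f T = stablePts a B g T := by
  have hb : ∀ i < B, 8 * a * i + 8 * a ≤ 8 * a * B := fun i hi => by
    calc 8 * a * i + 8 * a = 8 * a * (i + 1) := by ring
      _ ≤ _ := Nat.mul_le_mul_left _ hi
  unfold stablePts
  have e1 : (Finset.range B).filter (fun i => ¬Returns a f T i) =
      (Finset.range B).filter fun i => ¬Returns a g T i := by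
    refine Finset.filter_congr fun i hi => not_congr ?_
    have := hb i (Finset.mem_range.1 hi)
    unfold Returns
    refine exists_congr fun u => and_congr_right fun hu => exists_congr fun j =>
      and_congr_right fun hj => ?_
    rw [h u (by omega), h _ (by omega)]
  rw [e1]
  refine Finset.biUnion_congr rfl fun i hi => freshPts_congr fun k hk => h k ?_
  have := hb i (Finset.mem_range.1 (Finset.mem_filter.1 hi).1)
  omega

lemma IsTransient.exists_stablePts_subset {f : ℕ → V4} (h : IsTransient f) {a B n : ℕ}
    (hn : 8 * a * B ≤ lastVisit f n) : ∃ T, (stablePts a B f T : Set V4) ⊆ leSet f n := by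
  have hT : ∀ i, ∃ T, (∃ T', Returns a f T' i) → Returns a f T i := fun i => by
    by_cases hi : ∃ T', Returns a f T' i
    · obtain ⟨T', h'⟩ := hi
      exact ⟨T', fun _ => h'⟩
    · exact ⟨0, fun h => absurd h hi⟩
  choose T hT using hT
  refine ⟨(Finset.range B).sup T, fun v hv => ?_⟩
  obtain ⟨i, hi, hv⟩ := Finset.mem_biUnion.1 (Finset.mem_coe.1 hv)
  obtain ⟨hiB, hi⟩ := Finset.mem_filter.1 hi
  have hno : ∀ T', ¬Returns a f T' i := fun T' hr =>
    hi ((hT i ⟨T', hr⟩).mono (Finset.le_sup hiB))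
  obtain ⟨-, -, l, hl, hr⟩ := Finset.mem_filter.1 hv
  have hb : 8 * a * i + 8 * a ≤ 8 * a * B := by
    calc 8 * a * i + 8 * a = 8 * a * (i + 1) := by ring
      _ ≤ _ := Nat.mul_le_mul_left _ (Finset.mem_range.1 hiB)
  refine h.mem_leSet_of_mem_lew ((prefix_concat_lew (T := lastVisit f n) (by omega) hl
    fun r h1 h2 hm => ?_).subset (by simp))
  by_cases h4 : r ≤ 8 * a * i + 4 * a
  · exact hr r h1 h4 hm
  · obtain ⟨u, hu, e⟩ := exists_of_mem_lew (hl.subset (List.mem_append_left _ hm))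
    refine hno (r - (8 * a * i + 4 * a)) ⟨u, hu, _, le_rfl, ?_⟩
    rw [e]; congr 1; omega

lemma leSet_eq_coe (f : ℕ → V4) (n : ℕ) :
    leSet f n = (((Finset.range (n + 1)).image fun i => f (ell f i) : Finset V4) : Set V4) := by
  ext z
  simp [leSet, eq_comm]

/-! ### Cylinder events -/

namespace IsSRW4

variable {μ : V4 → Measure (ℕ → V4)}

lemma measure_cylinder_le (hμ : IsSRW4 μ) (n : ℕ) (γ : ℕ → V4) :
    μ 0 {ω | ∀ k ≤ n, ω k = γ k} ≤ (8 : ℝ≥0∞)⁻¹ ^ n := by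
  rw [hμ.2]
  calc _ ≤ 1 * ∏ _k ∈ Finset.range n, (8 : ℝ≥0∞)⁻¹ := by
        refine mul_le_mul' (by split_ifs <;> simp) (Finset.prod_le_prod' fun k _ => ?_)
        split_ifs <;> simp
    _ = _ := by simp

lemma measure_exists_steps_le (hμ : IsSRW4 μ) (n : ℕ) :
    ∀ (m : ℕ) (p : List V4) (Q : List V4 → Prop), p.length = m →
      μ 0 {ω | ∃ s, IsSteps n s ∧ Q s ∧ ∀ k ≤ m + n, ω k = walk (p ++ s) k} ≤
        ENNReal.ofReal ((1 / 8) ^ m * Es n fun s => ind (Q s)) := by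
  induction n with
  | zero =>
    intro m p Q hp
    rw [Es_zero]
    by_cases hQ : Q []
    · rw [ind_true hQ, mul_one, ENNReal.ofReal_pow (by norm_num), one_div,
        ENNReal.ofReal_inv_of_pos (by norm_num), ENNReal.ofReal_ofNat]
      refine (measure_mono ?_).trans (hμ.measure_cylinder_le m (walk p))
      rintro ω ⟨s, hs, -, h⟩ k hk
      rw [h k hk, walk_append_left s (hp ▸ hk)]
    · rw [show {ω : ℕ → V4 | ∃ s, IsSteps 0 s ∧ Q s ∧ ∀ k ≤ m + 0, ω k = walk (p ++ s) k} = ∅ from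
        Set.eq_empty_of_forall_notMem ?_]
      · simp
      · rintro ω ⟨s, hs, hs', -⟩
        exact hQ (List.length_eq_zero_iff.1 hs.1 ▸ hs')
  | succ n ih =>
    intro m p Q hp
    have hsub : {ω : ℕ → V4 | ∃ s, IsSteps (n + 1) s ∧ Q s ∧
        ∀ k ≤ m + (n + 1), ω k = walk (p ++ s) k} ⊆
        ⋃ d ∈ dirs, {ω | ∃ s, IsSteps n s ∧ Q (d :: s) ∧
          ∀ k ≤ (m + 1) + n, ω k = walk ((p ++ [d]) ++ s) k} := by
      rintro ω ⟨s, hs, hQ, h⟩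
      obtain _ | ⟨d, s⟩ := s
      · simp [IsSteps] at hs
      · refine Set.mem_biUnion (hs.2 d (by simp)) ⟨s, ⟨by simpa using hs.1, fun e he =>
          hs.2 e (by simp [he])⟩, hQ, fun k hk => ?_⟩
        rw [h k (by omega)]; simp
    refine (measure_mono hsub).trans ((measure_biUnion_finset_le _ _).trans ?_)
    refine (Finset.sum_le_sum fun d _ =>
      ih (m + 1) (p ++ [d]) (fun s => Q (d :: s)) (by simp [hp])).trans_eq ?_
    rw [← ENNReal.ofReal_sum_of_nonneg fun d _ =>
      mul_nonneg (by positivity) (Es_nonneg fun _ _ => ind_nonneg _), Es_succ, ← Finset.mul_sum]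
    congr 1
    ring

end IsSRW4

lemma mem_dirs_of_latAdj {x y : V4} (h : latAdj x y) : y - x ∈ dirs := by
  have hn : ∀ j, |x j - y j| ≤ 1 := fun j =>
    (Finset.single_le_sum (f := fun i => |x i - y i|) (fun i _ => abs_nonneg _)
      (Finset.mem_univ j)).trans_eq h
  obtain ⟨z, hz⟩ : ∃ z : V4, z = y - x := ⟨_, rfl⟩
  have hs : ∑ i, |z i| = 1 := by
    rw [← h]; exact Finset.sum_congr rfl fun i _ => by rw [hz, Pi.sub_apply, abs_sub_comm]
  have hb : ∀ j, z j = -1 ∨ z j = 0 ∨ z j = 1 := fun j => by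
    have := abs_le.1 (hn j)
    rw [hz, Pi.sub_apply]; omega
  rw [← hz, dirs_eq, Finset.mem_image]
  have hex : ∃ j, z j ≠ 0 := by
    by_contra! h0
    simp [h0] at hs
  obtain ⟨j, hj⟩ := hex
  refine ⟨(j, decide (z j = 1)), Finset.mem_univ _, ?_⟩
  rw [← Finset.add_sum_erase _ _ (Finset.mem_univ j)] at hs
  have h1 : |z j| = 1 := by rcases hb j with e | e | e <;> simp_all
  have h0 : ∑ i ∈ Finset.univ.erase j, |z i| = 0 := by omega
  rw [Finset.sum_eq_zero_iff_of_nonneg fun i _ => abs_nonneg _] at h0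
  funext i
  by_cases hi : i = j
  · subst hi
    rcases hb i with e | e | e <;> simp_all
  · have := abs_eq_zero.1 (h0 i (by simp [hi]))
    simp [hi, this]

lemma exists_steps_of_latAdj (n : ℕ) {γ : ℕ → V4} (h0 : γ 0 = 0)
    (h : ∀ k < n, latAdj (γ k) (γ (k + 1))) :
    ∃ s, IsSteps n s ∧ ∀ k ≤ n, γ k = walk s k := by
  induction n with
  | zero => exact ⟨[], isSteps_nil, fun k hk => by rw [Nat.le_zero.1 hk, walk_zero, h0]⟩
  | succ n ih =>
    obtain ⟨s, hs, hw⟩ := ih fun k hk => h k (by omega)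
    refine ⟨s ++ [γ (n + 1) - γ n], hs.append (isSteps_nil.cons (mem_dirs_of_latAdj
      (h n (by omega)))), fun k hk => ?_⟩
    rcases Nat.le_succ_iff.1 hk with hk | rfl
    · rw [walk_append_left _ (hs.1.symm ▸ hk), hw k hk]
    · rw [walk_of_length_le (by simp [hs.1]), List.sum_append, List.sum_singleton, hw n le_rfl,
        ← walk_length s, hs.1, add_sub_cancel]

namespace IsSRW4

variable {μ : V4 → Measure (ℕ → V4)}

lemma ae_exists_steps (hμ : IsSRW4 μ) (n : ℕ) :
    ∀ᵐ ω ∂μ 0, ∃ s, IsSteps n s ∧ ∀ k ≤ n, ω k = walk s k := by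
  have key : ∀ g : Fin (n + 1) → V4, ∀ᵐ ω ∂μ 0, (∀ k ≤ n, ω k = g (Fin.ofNat (n + 1) k)) →
      ∃ s, IsSteps n s ∧ ∀ k ≤ n, ω k = walk s k := by
    intro g
    by_cases hg : g (Fin.ofNat (n + 1) 0) = 0 ∧
        ∀ k < n, latAdj (g (Fin.ofNat (n + 1) k)) (g (Fin.ofNat (n + 1) (k + 1)))
    · obtain ⟨s, hs, hw⟩ := exists_steps_of_latAdj n (γ := fun k => g (Fin.ofNat (n + 1) k))
        hg.1 hg.2
      exact Eventually.of_forall fun ω hω => ⟨s, hs, fun k hk => (hω k hk).trans (hw k hk)⟩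
    · have h0 : μ 0 {ω | ∀ k ≤ n, ω k = g (Fin.ofNat (n + 1) k)} = 0 := by
        rw [hμ.2 0 n fun k => g (Fin.ofNat (n + 1) k), mul_eq_zero]
        by_cases hz : g (Fin.ofNat (n + 1) 0) = 0
        · right
          simp only [hz, true_and, not_forall] at hg
          obtain ⟨k, hk, hadj⟩ := hg
          exact Finset.prod_eq_zero (Finset.mem_range.2 hk) (if_neg hadj)
        · left; exact if_neg hz
      filter_upwards [measure_eq_zero_iff_ae_notMem.1 h0] with ω hω hω'
      exact absurd hω' hω
  filter_upwards [ae_all_iff.2 key] with ω hω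
  refine hω (fun i => ω i) fun k hk => ?_
  rw [Fin.ofNat]
  simp [Nat.mod_eq_of_lt (Nat.lt_succ_of_le hk)]

/-- Events depending on the first `n` steps have probability given by path counting. -/
lemma measure_le_Es (hμ : IsSRW4 μ) {n : ℕ} {Q : (ℕ → V4) → Prop}
    (hQ : ∀ ω ω' : ℕ → V4, (∀ k ≤ n, ω k = ω' k) → Q ω → Q ω') :
    μ 0 {ω | Q ω} ≤ ENNReal.ofReal (Es n fun s => ind (Q (walk s))) := by
  have h := hμ.measure_exists_steps_le n 0 [] (fun s => Q (walk s)) rfl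
  simp only [pow_zero, one_mul, zero_add, List.nil_append] at h
  refine (measure_mono_ae ?_).trans h
  filter_upwards [hμ.ae_exists_steps n] with ω ⟨s, hs, hw⟩ hω
  exact ⟨s, hs, hQ _ _ hw hω, hw⟩

lemma ae_isTransient (hμ : IsSRW4 μ) : ∀ᵐ ω ∂μ 0, IsTransient ω := by
  refine ae_all_iff.2 fun v => ?_
  have h1 : ∀ k : ℕ, μ 0 {ω | ω k = v} ≤ ENNReal.ofReal (25600 / ((k : ℝ) + 1) ^ 2) := fun k => by
    refine (hμ.measure_le_Es (n := k) fun ω ω' h e => (h k le_rfl).symm.trans e).trans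
      (ENNReal.ofReal_le_ofReal (le_trans (le_of_eq ?_) (pk_le k 0 v)))
    exact Es_congr fun s hs => by rw [← hs.1, walk_length, zero_add]
  have hsum : Summable fun k : ℕ => 25600 / ((k : ℝ) + 1) ^ 2 := by
    have := (summable_nat_add_iff 1).2 (Real.summable_one_div_nat_pow.2 one_lt_two)
    simpa [div_eq_mul_inv] using this.mul_left 25600
  have h2 : μ 0 {ω | ∃ᶠ k in atTop, ω k = v} = 0 := by
    refine measure_setOfPred_frequently_eq_zero (ne_top_of_le_ne_top ?_ (ENNReal.tsum_le_tsum h1))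
    rw [← ENNReal.ofReal_tsum_of_nonneg (fun k => by positivity) hsum]
    exact ENNReal.ofReal_ne_top
  filter_upwards [measure_eq_zero_iff_ae_notMem.1 h2] with ω hω
  by_contra hinf
  exact hω (Nat.frequently_atTop_iff_infinite.2 hinf)

lemma ae_apply_zero (hμ : IsSRW4 μ) : ∀ᵐ ω ∂μ 0, ω 0 = 0 := by
  filter_upwards [hμ.ae_exists_steps 0] with ω ⟨s, _, hw⟩
  rw [hw 0 le_rfl, walk_zero]

end IsSRW4

/-! ### Proof of the capacity bound -/

lemma IsSRW4.measure_cap4_lt_le {μ : V4 → Measure (ℕ → V4)} (hμ : IsSRW4 μ) {n m B b : ℕ}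
    (hb : b = 8 * m) {X Y p q : ℝ} (hY : Y ≤ n + 1)
    (hp : Es (b + B * (2 * b)) (fun s => ind (Y ≤
      ∑ k ∈ Finset.range (B * (2 * b)), ind (Survives (walk s) k (k + b)))) ≤ p)
    (hq : ∀ T, Es (16 * m * B + T)
      (fun s => ind (cap4 (stablePts (2 * m) B (walk s) T : Finset V4) < X)) ≤ q) :
    μ 0 {ω | cap4 (leSet ω n) < X} ≤ ENNReal.ofReal p + ENNReal.ofReal q := by
  set S : Set (ℕ → V4) := {ω | Y ≤
    ∑ k ∈ Finset.range (B * (2 * b)), ind (Survives ω k (k + b))} with hS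
  set E : ℕ → Set (ℕ → V4) := fun T =>
    {ω | cap4 (stablePts (2 * m) B ω T : Finset V4) < X} with hE
  have hSp : μ 0 S ≤ ENNReal.ofReal p := by
    refine (hμ.measure_le_Es (n := b + B * (2 * b)) fun ω ω' h hω => hω.trans_eq ?_).trans
      (ENNReal.ofReal_le_ofReal hp)
    refine Finset.sum_congr rfl fun k hk => ind_congr ?_
    have hk := Finset.mem_range.1 hk
    unfold Survives
    refine forall_congr' fun r => forall_congr' fun h1 => forall_congr' fun h2 => ?_
    rw [h r (by omega), lew_congr fun i hi => h i (by omega)]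
  have hEq : ∀ T, μ 0 (E T) ≤ ENNReal.ofReal q := fun T => by
    refine (hμ.measure_le_Es (n := 16 * m * B + T) fun ω ω' h hω => ?_).trans
      (ENNReal.ofReal_le_ofReal (hq T))
    rwa [stablePts_congr fun i hi => (h i (hi.trans_eq (by ring))).symm]
  have hmono : Monotone E := fun T T' hT ω hω =>
    (cap4_mono (stablePts_anti _ _ ω hT)).trans_lt hω
  have hsub : ∀ᵐ ω ∂μ 0, ω ∈ {ω | cap4 (leSet ω n) < X} → ω ∈ S ∪ ⋃ T, E T := by
    filter_upwards [hμ.ae_isTransient] with ω htr hω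
    by_cases hs : ω ∈ S
    · exact Or.inl hs
    · have hlast := htr.le_lastVisit_of_survivors ((not_le.1 hs).trans_le hY)
      obtain ⟨T, hT⟩ := htr.exists_stablePts_subset (a := 2 * m) (B := B)
        (le_trans (by rw [hb]; exact le_of_eq (by ring)) hlast)
      refine Or.inr (mem_iUnion.2 ⟨T, ?_⟩)
      have hω : cap4 (leSet ω n) < X := hω
      rw [leSet_eq_coe] at hT hω
      exact (cap4_mono (Finset.coe_subset.1 hT)).trans_lt hω
  calc μ 0 {ω | cap4 (leSet ω n) < X} ≤ μ 0 (S ∪ ⋃ T, E T) := measure_mono_ae hsub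
    _ ≤ μ 0 S + μ 0 (⋃ T, E T) := measure_union_le _ _
    _ ≤ _ := by
        refine add_le_add hSp ?_
        rw [hmono.measure_iUnion]
        exact iSup_le hEq

lemma IsSRW4.ae_le_cap4_leSet {μ : V4 → Measure (ℕ → V4)} (hμ : IsSRW4 μ) (n : ℕ) :
    ∀ᵐ ω ∂μ 0, 8 / 51200 ≤ cap4 (leSet ω n) := by
  filter_upwards [hμ.ae_apply_zero] with ω h0
  rw [leSet_eq_coe]
  refine (cap4_singleton_ge 0).trans (cap4_mono (Finset.singleton_subset_iff.2 ?_))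
  exact Finset.mem_image.2 ⟨0, by simp, h0⟩

lemma eventually_log_pow_le (c : ℝ) {r : ℝ} (hr : 0 < r) :
    ∀ᶠ n : ℕ in atTop, c * Real.log n ^ 2 ≤ (n : ℝ) ^ r := by
  have h1 : (fun x : ℝ => Real.log x ^ (2 : ℝ)) =o[atTop] fun x => x ^ r :=
    isLittleO_log_rpow_rpow_atTop 2 hr
  have h2 := (h1.const_mul_left c).comp_tendsto tendsto_natCast_atTop_atTop
  filter_upwards [h2.bound one_pos, eventually_ge_atTop 1] with n hn h1
  have h0 : (0 : ℝ) ≤ (n : ℝ) ^ r := by positivity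
  simp only [Function.comp_apply, Real.rpow_two, one_mul, Real.norm_eq_abs, abs_of_nonneg h0] at hn
  exact (le_abs_self _).trans hn

/-- Block lengths and numbers of blocks adapted to `n` steps of the loop erasure. -/
lemma eventually_exists_blocks {D : ℝ} (hD : 1 ≤ D) (m₀ : ℕ) : ∀ᶠ n : ℕ in atTop,
    1 ≤ Real.log (Real.log n) ∧ ∃ m B : ℕ, m₀ ≤ m ∧ 1 ≤ B ∧ Real.log n ^ 2 ≤ B ∧
      B ≤ 2 * Real.log n ^ 2 ∧ 16 * (B : ℝ) ≤ (m : ℝ) ^ (1 / 8 : ℝ) ∧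
      Real.log n / 2 ≤ Real.log m ∧ Real.log m ≤ Real.log n ∧
      Real.log (8 * m : ℕ) ≤ 2 * Real.log n ∧
      m * B ≤ n * Real.log n ^ (1 / 3 : ℝ) / D ∧
      n * Real.log n ^ (1 / 3 : ℝ) / (2 * D) ≤ m * B := by
  have hlog := tendsto_log_natCast
  filter_upwards [(Real.tendsto_log_atTop.comp hlog).eventually_ge_atTop 1,
    hlog.eventually_ge_atTop 1, eventually_log_pow_le 32 (r := 1 / 16) (by norm_num),
    eventually_log_pow_le (4 * D) (r := 1 / 2) (by norm_num), eventually_ge_atTop (m₀ ^ 2),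
    eventually_ge_atTop 8] with n h1 h2 h3 h4 h5 h6
  refine ⟨h1, ?_⟩
  set ℓ := Real.log n with hℓ
  have hn8 : (8 : ℝ) ≤ n := by exact_mod_cast h6
  have hn0 : (0 : ℝ) < n := by linarith
  have hB1 : ℓ ^ 2 ≤ (⌈ℓ ^ 2⌉₊ : ℕ) := Nat.le_ceil _
  have hB2 : ((⌈ℓ ^ 2⌉₊ : ℕ) : ℝ) ≤ 2 * ℓ ^ 2 := by
    have := (Nat.ceil_lt_add_one (by positivity : (0 : ℝ) ≤ ℓ ^ 2)).le
    nlinarith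
  generalize ⌈ℓ ^ 2⌉₊ = B at hB1 hB2
  have hB0 : (1 : ℝ) ≤ B := by nlinarith
  have hr1 : 1 ≤ ℓ ^ (1 / 3 : ℝ) := Real.one_le_rpow h2 (by norm_num)
  have hr2 : ℓ ^ (1 / 3 : ℝ) ≤ ℓ := by
    simpa using Real.rpow_le_rpow_of_exponent_le h2 (show (1 / 3 : ℝ) ≤ 1 by norm_num)
  set x : ℝ := n * ℓ ^ (1 / 3 : ℝ) / (D * B) with hx
  have hDB : 0 < D * B := by positivity
  have hsq : (n : ℝ) ^ (1 / 2 : ℝ) * (n : ℝ) ^ (1 / 2 : ℝ) = n := by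
    rw [← Real.rpow_add hn0]; norm_num
  have hs1 : 1 ≤ (n : ℝ) ^ (1 / 2 : ℝ) := Real.one_le_rpow (by linarith) (by norm_num)
  have hx1 : 2 * (n : ℝ) ^ (1 / 2 : ℝ) ≤ x := by
    rw [hx, le_div_iff₀ hDB]
    calc 2 * (n : ℝ) ^ (1 / 2 : ℝ) * (D * B)
        ≤ 2 * (n : ℝ) ^ (1 / 2 : ℝ) * (D * (2 * ℓ ^ 2)) := by gcongr
      _ = (n : ℝ) ^ (1 / 2 : ℝ) * (4 * D * ℓ ^ 2) := by ring
      _ ≤ (n : ℝ) ^ (1 / 2 : ℝ) * (n : ℝ) ^ (1 / 2 : ℝ) := by gcongr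
      _ = n * 1 := by rw [hsq, mul_one]
      _ ≤ _ := by gcongr
  have hx2 : x ≤ n := by
    rw [hx, div_le_iff₀ hDB]
    refine mul_le_mul_of_nonneg_left (hr2.trans ?_) hn0.le
    nlinarith
  have hm1 : ((⌊x⌋₊ : ℕ) : ℝ) ≤ x := Nat.floor_le (by linarith)
  have hm2 : x < (⌊x⌋₊ : ℕ) + 1 := Nat.lt_floor_add_one x
  generalize ⌊x⌋₊ = m at hm1 hm2
  have hm3 : x / 2 ≤ m := by linarith
  have hm4 : (n : ℝ) ^ (1 / 2 : ℝ) ≤ m := by linarith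
  have hm0 : (0 : ℝ) < m := by linarith
  have hxB : x * B = n * ℓ ^ (1 / 3 : ℝ) / D := by rw [hx]; field_simp
  refine ⟨m, B, ?_, by exact_mod_cast hB0, hB1, hB2, ?_, ?_, ?_, ?_, ?_, ?_⟩
  · have : ((m₀ : ℝ) ^ 2) ^ (1 / 2 : ℝ) ≤ (n : ℝ) ^ (1 / 2 : ℝ) :=
      Real.rpow_le_rpow (by positivity) (by exact_mod_cast h5) (by norm_num)
    rw [← Real.sqrt_eq_rpow, Real.sqrt_sq (by positivity)] at this
    exact_mod_cast this.trans hm4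
  · calc 16 * (B : ℝ) ≤ 32 * ℓ ^ 2 := by linarith
      _ ≤ (n : ℝ) ^ (1 / 16 : ℝ) := h3
      _ = ((n : ℝ) ^ (1 / 2 : ℝ)) ^ (1 / 8 : ℝ) := by rw [← Real.rpow_mul hn0.le]; norm_num
      _ ≤ _ := Real.rpow_le_rpow (by positivity) hm4 (by norm_num)
  · have := Real.log_le_log (by positivity) hm4
    rw [Real.log_rpow hn0] at this
    linarith
  · exact Real.log_le_log hm0 (hm1.trans hx2)
  · have : Real.log (8 * m : ℕ) ≤ Real.log ((n : ℝ) ^ 2) :=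
      Real.log_le_log (by push_cast; linarith) (by push_cast; nlinarith)
    rwa [Real.log_pow] at this
  · rw [← hxB]; gcongr
  · calc n * ℓ ^ (1 / 3 : ℝ) / (2 * D) = x / 2 * B := by rw [div_mul_eq_mul_div, hxB]; field_simp
      _ ≤ _ := by gcongr

lemma exp_neg_le_inv {x : ℝ} (hx : 0 < x) : Real.exp (-x) ≤ 1 / x := by
  rw [Real.exp_neg, ← one_div]
  exact one_div_le_one_div_of_le hx (by linarith [Real.add_one_le_exp x])

lemma exists_eventually_measure_cap4_le (μ : V4 → Measure (ℕ → V4)) (hμ : IsSRW4 μ) :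
    ∃ C C' : ℝ, 0 < C ∧ 0 < C' ∧ ∀ᶠ n : ℕ in atTop,
      μ 0 {ω | cap4 (leSet ω n) < C * (n : ℝ) / Real.log n ^ ((2:ℝ)/3)} ≤
        ENNReal.ofReal (C' * Real.log (Real.log n) / Real.log n ^ ((2:ℝ)/3)) := by
  obtain ⟨K, hK, b₀, hsurv⟩ := exists_Es_survivors_le
  obtain ⟨c, hc, C, hC, m₀, hstab⟩ := exists_Es_cap4_stablePts_le
  set D : ℝ := 16 * K + 1 with hD
  have hD1 : 1 ≤ D := by rw [hD]; linarith
  refine ⟨c / (2 * D), 14 * C + 36, by positivity, by positivity, ?_⟩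
  filter_upwards [eventually_exists_blocks hD1 (max (max m₀ b₀) 2)] with n
    ⟨h1, m, B, hm, hB, hB1, hB2, hBm, hlm1, hlm2, hl8, hmB1, hmB2⟩
  set ℓ := Real.log n with hℓ
  have hm0 : m₀ ≤ m := (le_max_left _ _).trans ((le_max_left _ _).trans hm)
  have hb0 : b₀ ≤ 8 * m := ((le_max_right _ _).trans ((le_max_left _ _).trans hm)).trans (by omega)
  have hm2 : 2 ≤ m := (le_max_right _ _).trans hm
  have hm2r : (2 : ℝ) ≤ m := by exact_mod_cast hm2
  have hBr : (1 : ℝ) ≤ B := by exact_mod_cast hB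
  have hlmpos : 0 < Real.log m := Real.log_pos (by linarith)
  have hℓ0 : 0 < ℓ := hlmpos.trans_le hlm2
  have hℓ1 : 1 ≤ ℓ := by
    by_contra! hlt
    linarith [Real.log_nonpos hℓ0.le hlt.le]
  have hlb : Real.log m ≤ Real.log (8 * m : ℕ) :=
    Real.log_le_log (by linarith) (by push_cast; linarith)
  have hlb0 : 0 < Real.log (8 * m : ℕ) := by linarith
  have hn0 : (0 : ℝ) ≤ n := by positivity
  have hthird : ℓ ^ (1 / 3 : ℝ) * ℓ ^ ((2 : ℝ) / 3) = ℓ := by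
    rw [← Real.rpow_add hℓ0]; norm_num
  have h23 : 0 < ℓ ^ ((2 : ℝ) / 3) := by positivity
  have hsurv' : K * B * (8 * m : ℕ) * Real.log (8 * m : ℕ) ^ (-(1 / 3) : ℝ) ≤ n + 1 := by
    have e1 : Real.log (8 * m : ℕ) ^ (-(1 / 3) : ℝ) ≤ 2 * (ℓ ^ (1 / 3 : ℝ))⁻¹ := by
      rw [Real.rpow_neg hlb0.le, ← div_eq_mul_inv, le_div_iff₀ (by positivity),
        inv_mul_le_iff₀ (by positivity)]
      calc ℓ ^ (1 / 3 : ℝ) ≤ (8 * Real.log (8 * m : ℕ)) ^ (1 / 3 : ℝ) :=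
            Real.rpow_le_rpow hℓ0.le (by linarith) (by norm_num)
        _ = Real.log (8 * m : ℕ) ^ (1 / 3 : ℝ) * 2 := by
            rw [Real.mul_rpow (by norm_num) hlb0.le, show (8 : ℝ) = 2 ^ (3 : ℝ) by norm_num,
              ← Real.rpow_mul (by norm_num)]
            norm_num [mul_comm]
    calc K * B * (8 * m : ℕ) * Real.log (8 * m : ℕ) ^ (-(1 / 3) : ℝ)
        ≤ K * B * (8 * m : ℕ) * (2 * (ℓ ^ (1 / 3 : ℝ))⁻¹) := by gcongr
      _ = 16 * K * (ℓ ^ (1 / 3 : ℝ))⁻¹ * (m * B) := by push_cast; ring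
      _ ≤ 16 * K * (ℓ ^ (1 / 3 : ℝ))⁻¹ * (n * ℓ ^ (1 / 3 : ℝ) / D) := by gcongr
      _ = n * (16 * K / D) := by
          have : ℓ ^ (1 / 3 : ℝ) ≠ 0 := by positivity
          field_simp
      _ ≤ n * 1 := by
          gcongr
          rw [div_le_one (by linarith)]; linarith
      _ ≤ _ := by linarith
  have hbound := hμ.measure_cap4_lt_le (b := 8 * m) rfl hsurv' (hsurv (8 * m) hb0 B)
    fun T => hstab m hm0 B hB hBm T _ le_rfl
  have hX : c / (2 * D) * n / ℓ ^ ((2 : ℝ) / 3) ≤ c * (m * B / Real.log m) := by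
    rw [div_le_iff₀ h23]
    calc c / (2 * D) * n = c * (n * ℓ ^ (1 / 3 : ℝ) / (2 * D) / ℓ) * ℓ ^ ((2 : ℝ) / 3) := by
          nth_rewrite 2 [← hthird]
          have : ℓ ^ (1 / 3 : ℝ) ≠ 0 := by positivity
          field_simp
      _ ≤ _ := by gcongr
  refine (measure_mono fun ω (hω : _ < _) => hω.trans_le hX).trans (hbound.trans ?_)
  rw [← ENNReal.ofReal_add (by positivity) (by
    have := Real.log_nonneg (show (1 : ℝ) ≤ 16 * B by linarith)
    positivity)]
  refine ENNReal.ofReal_le_ofReal ?_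
  have hp1 : Real.exp (-(B * Real.log (8 * m : ℕ) ^ (-(1 / 3) : ℝ))) ≤ 2 / ℓ := by
    have e1 : (2 * ℓ)⁻¹ ≤ Real.log (8 * m : ℕ) ^ (-(1 / 3) : ℝ) := by
      calc (2 * ℓ)⁻¹ = (2 * ℓ) ^ (-1 : ℝ) := (Real.rpow_neg_one _).symm
        _ ≤ (2 * ℓ) ^ (-(1 / 3) : ℝ) :=
            Real.rpow_le_rpow_of_exponent_le (by linarith) (by norm_num)
        _ ≤ _ := Real.rpow_le_rpow_of_nonpos hlb0 hl8 (by norm_num)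
    have e2 : ℓ / 2 ≤ B * Real.log (8 * m : ℕ) ^ (-(1 / 3) : ℝ) := by
      calc ℓ / 2 = ℓ ^ 2 * (2 * ℓ)⁻¹ := by field_simp
        _ ≤ _ := by gcongr
    calc _ ≤ Real.exp (-(ℓ / 2)) := Real.exp_le_exp.2 (by linarith)
      _ ≤ 1 / (ℓ / 2) := exp_neg_le_inv (by linarith)
      _ = _ := by field_simp
  have hp2 : Real.exp (-((B : ℝ) / 32)) ≤ 32 / ℓ := by
    calc _ ≤ Real.exp (-(ℓ / 32)) := Real.exp_le_exp.2 (by nlinarith)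
      _ ≤ 1 / (ℓ / 32) := exp_neg_le_inv (by linarith)
      _ = _ := by field_simp
  have hp3 : (1 + Real.log (16 * B)) / Real.log m ≤ 14 * Real.log ℓ / ℓ := by
    have e1 : Real.log (16 * B) ≤ Real.log (2 ^ 5 * ℓ ^ 2) :=
      Real.log_le_log (by linarith) (by linarith)
    rw [Real.log_mul (x := 2 ^ 5) (by norm_num) (by positivity), Real.log_pow, Real.log_pow] at e1
    have e2 := Real.log_two_lt_d9
    push_cast at e1
    rw [div_le_div_iff₀ hlmpos hℓ0]
    have e3 : 1 + Real.log (16 * B) ≤ 7 * Real.log ℓ := by linarith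
    nlinarith
  have hle : 1 / ℓ ≤ 1 / ℓ ^ ((2 : ℝ) / 3) := by
    refine one_div_le_one_div_of_le h23 ?_
    simpa using Real.rpow_le_rpow_of_exponent_le hℓ1 (show (2 / 3 : ℝ) ≤ 1 by norm_num)
  calc _ ≤ 2 * (2 / ℓ) + (C * (14 * Real.log ℓ / ℓ) + 32 / ℓ) := by gcongr
    _ = (14 * C * Real.log ℓ + 36) * (1 / ℓ) := by ring
    _ ≤ ((14 * C + 36) * Real.log ℓ) * (1 / ℓ ^ ((2 : ℝ) / 3)) := by
        refine mul_le_mul (by nlinarith) hle (by positivity) ?_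
        positivity
    _ = _ := by ring

/-- **Capacity of the loop-erased random walk in `ℤ⁴`** (Proposition 2.10): there exist
constants `C > 0` and `C'` such that
`P(Cap(LE(X)^n) ≤ C n/(log n)^{2/3}) ≤ C' (log log n)/(log n)^{2/3}` for every `n ≥ 2`. -/
theorem lerw_capacity_lower
    (μ : V4 → Measure (ℕ → V4)) (hμ : IsSRW4 μ) :
    ∃ C C' : ℝ, 0 < C ∧ 0 < C' ∧ ∀ n : ℕ, 2 ≤ n →
      μ 0 {ω | cap4 (leSet ω n) ≤ C * (n : ℝ) / Real.log n ^ ((2:ℝ)/3)} ≤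
        ENNReal.ofReal (C' * Real.log (Real.log n) / Real.log n ^ ((2:ℝ)/3)) := by
  obtain ⟨C, C', hC, hC', h⟩ := exists_eventually_measure_cap4_le μ hμ
  obtain ⟨N, hN⟩ := eventually_atTop.1 h
  refine ⟨min (C / 2) (1 / (25600 * (N + 1))), C', by positivity, hC', fun n hn => ?_⟩
  have hn2 : (2 : ℝ) ≤ n := by exact_mod_cast hn
  have hl : 0 < Real.log n := Real.log_pos (by linarith)
  have hl23 : 0 < Real.log n ^ ((2 : ℝ) / 3) := by positivity
  by_cases hnN : N ≤ n
  · refine le_trans (measure_mono fun ω hω => ?_) (hN n hnN)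
    refine lt_of_le_of_lt (mem_ofPred_eq.mp hω) ?_
    have : min (C / 2) (1 / (25600 * ((N : ℝ) + 1))) < C := (min_le_left _ _).trans_lt (by linarith)
    gcongr
  · have hnN : (n : ℝ) ≤ N + 1 := by exact_mod_cast (show n ≤ N + 1 by omega)
    have hhalf : 1 / 2 ≤ Real.log n ^ ((2 : ℝ) / 3) := by
      have e2 := Real.log_two_gt_d9
      calc (1 / 2 : ℝ) = (1 / 2) ^ (1 : ℝ) := by norm_num
        _ ≤ (1 / 2) ^ ((2 : ℝ) / 3) :=
            Real.rpow_le_rpow_of_exponent_ge (by norm_num) (by norm_num) (by norm_num)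
        _ ≤ _ := Real.rpow_le_rpow (by norm_num)
            (by linarith [Real.log_le_log two_pos hn2]) (by norm_num)
    have hsmall : min (C / 2) (1 / (25600 * ((N : ℝ) + 1))) * n / Real.log n ^ ((2 : ℝ) / 3) <
        8 / 51200 := by
      rw [div_lt_iff₀ hl23]
      calc min (C / 2) (1 / (25600 * ((N : ℝ) + 1))) * n
          ≤ 1 / (25600 * ((N : ℝ) + 1)) * (N + 1) := by
            gcongr
            exact min_le_right _ _
        _ = 1 / 25600 := by field_simp
        _ < 8 / 51200 * (1 / 2) := by norm_num
        _ ≤ _ := by gcongr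
    refine le_of_eq_of_le (measure_eq_zero_iff_ae_notMem.2 ?_) zero_le
    filter_upwards [hμ.ae_le_cap4_leSet n] with ω hω hω'
    exact absurd (hω.trans hω') (not_le.2 hsmall)
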